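/- Let G be the semilinear operator on ℝ^d defined in the context, and assume in addition that r is bounded above: R₀ := sup_{x∈ℝ^d, u∈U} r(x,u) < ∞. Then the generalized principal eigenvalue λ⁺ = inf{ λ ∈ ℝ : ∃ φ ∈ C²(ℝ^d), φ > 0 on ℝ^d, Gφ ≤ λφ on ℝ^d } is a finite real number with λ⁺ ≤ R₀, and there exists ψ ∈ C²(ℝ^d) with ψ > 0 on ℝ^d, ψ(0) = 1, and Gψ = λ⁺ ψ on all of ℝ^d. (Existence part of Theorem 4.1, bounded-cost case, classical-solution rendering.) -/

import Mathlib

open Metric Set MeasureTheory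

noncomputable def sdv {d : ℕ} (φ : EuclideanSpace ℝ (Fin d) → ℝ)
    (x : EuclideanSpace ℝ (Fin d)) (i j : Fin d) : ℝ :=
  fderiv ℝ (fun y => fderiv ℝ φ y (EuclideanSpace.single j 1)) x (EuclideanSpace.single i 1)

/-- The semilinear operator
`Gφ(x) = Σ_{i,j} a_{ij}(x) ∂²φ/∂x_i∂x_j(x) + inf_{u∈U} (b(x,u)·∇φ(x) + r(x,u) φ(x))`. -/
noncomputable def Gop {d : ℕ} {U : Type*}
    (a : EuclideanSpace ℝ (Fin d) → Matrix (Fin d) (Fin d) ℝ)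
    (b : EuclideanSpace ℝ (Fin d) → U → EuclideanSpace ℝ (Fin d))
    (r : EuclideanSpace ℝ (Fin d) → U → ℝ)
    (φ : EuclideanSpace ℝ (Fin d) → ℝ) (x : EuclideanSpace ℝ (Fin d)) : ℝ :=
  (∑ i, ∑ j, a x i j * sdv φ x i j)
    + ⨅ u : U, ((inner ℝ (b x u) (gradient φ x) : ℝ) + r x u * φ x)

/-- The quadratic form `zᵀ A z`. -/
noncomputable def quadForm {d : ℕ}
    (A : Matrix (Fin d) (Fin d) ℝ) (z : EuclideanSpace ℝ (Fin d)) : ℝ :=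
  ∑ i, ∑ j, z i * A i j * z j


open Metric Set MeasureTheory

noncomputable section

abbrev Eu (d : ℕ) := EuclideanSpace ℝ (Fin d)

def Hs {d : ℕ} (u : Eu d → ℝ) (x : Eu d) : Eu d →L[ℝ] Eu d →L[ℝ] ℝ := fderiv ℝ (fderiv ℝ u) x

def Lap {d : ℕ} (u : Eu d → ℝ) (x : Eu d) : ℝ :=
  ∑ i, Hs u x (EuclideanSpace.single i 1) (EuclideanSpace.single i 1)

variable {d : ℕ}

lemma c2_D {u : Eu d → ℝ} (hu : ContDiff ℝ 2 u) : ContDiff ℝ 1 (fderiv ℝ u) :=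
  hu.fderiv_right (by norm_num)

lemma c2_Hs {u : Eu d → ℝ} (hu : ContDiff ℝ 2 u) : Continuous (Hs u) :=
  (c2_D hu).continuous_fderiv (by norm_num)

lemma c2_d1 {u : Eu d → ℝ} (hu : ContDiff ℝ 2 u) (x : Eu d) : HasFDerivAt u (fderiv ℝ u x) x :=
  (hu.differentiable (by norm_num) x).hasFDerivAt

lemma c2_d2 {u : Eu d → ℝ} (hu : ContDiff ℝ 2 u) (x : Eu d) :
    HasFDerivAt (fderiv ℝ u) (Hs u x) x :=
  ((c2_D hu).differentiable (by norm_num) x).hasFDerivAt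

lemma c2_Lap {u : Eu d → ℝ} (hu : ContDiff ℝ 2 u) : Continuous (Lap u) := by
  unfold Lap
  have := c2_Hs hu
  fun_prop

lemma Hs_symm {u : Eu d → ℝ} (hu : ContDiff ℝ 2 u) (x h k : Eu d) : Hs u x h k = Hs u x k h :=
  (hu.contDiffAt.isSymmSndFDerivAt (by simp)) h k

lemma line1 {u : Eu d → ℝ} (hu : ContDiff ℝ 2 u) (x h : Eu d) (t : ℝ) :
    HasDerivAt (fun t : ℝ => u (x + t • h)) (fderiv ℝ u (x + t • h) h) t := by
  have h1 : HasDerivAt (fun t : ℝ => x + t • h) h t := by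
    simpa using ((hasDerivAt_id t).smul_const h).const_add x
  exact (c2_d1 hu (x + t • h)).comp_hasDerivAt t h1

lemma line2 {u : Eu d → ℝ} (hu : ContDiff ℝ 2 u) (x h k : Eu d) (t : ℝ) :
    HasDerivAt (fun t : ℝ => fderiv ℝ u (x + t • h) k) (Hs u (x + t • h) h k) t := by
  have h1 : HasDerivAt (fun t : ℝ => x + t • h) h t := by
    simpa using ((hasDerivAt_id t).smul_const h).const_add x
  have h2 := (c2_d2 hu (x + t • h)).comp_hasDerivAt t h1
  simpa using h2.clm_apply (hasDerivAt_const t k)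

/-- comparison form of the mean value inequality -/
lemma mvb {f f' B B' : ℝ → ℝ} {a b : ℝ} (hab : a ≤ b)
    (hf : ∀ t ∈ Icc a b, HasDerivAt f (f' t) t) (hBc : ContinuousOn B (Icc a b))
    (hB : ∀ t ∈ Ico a b, HasDerivWithinAt B (B' t) (Ici t) t)
    (hle : ∀ t ∈ Ico a b, |f' t| ≤ B' t) : |f b - f a| ≤ B b - B a := by
  have := image_norm_le_of_norm_deriv_right_le_deriv_boundary' (f := fun t => f t - f a) (f' := f')
    (a := a) (b := b) (B := fun t => B t - B a) (B' := B')
    (fun t ht => ((hf t ht).continuousAt.sub continuousAt_const).continuousWithinAt)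
    (fun t ht => ((hf t ⟨ht.1, ht.2.le⟩).sub_const _).hasDerivWithinAt)
    (by simp) (hBc.sub continuousOn_const) (fun t ht => (hB t ht).sub_const _) hle
    (x := b) ⟨hab, le_rfl⟩
  simpa using this

/-- second order Taylor estimates -/
lemma taylor1 {u : Eu d → ℝ} (hu : ContDiff ℝ 2 u) (x h : Eu d) {M : ℝ} {B : Eu d →L[ℝ] Eu d →L[ℝ] ℝ}
    (hM : ∀ t ∈ Icc (0:ℝ) 1, |Hs u (x + t • h) h h - B h h| ≤ M) :
    |u (x + h) - u x - fderiv ℝ u x h - B h h / 2| ≤ M / 2 := by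
  have k1 : ∀ t ∈ Icc (0:ℝ) 1, |fderiv ℝ u (x + t • h) h - fderiv ℝ u x h - t * B h h| ≤ M * t := by
    intro t ht
    have := mvb (f := fun s => fderiv ℝ u (x + s • h) h - s * B h h)
      (f' := fun s => Hs u (x + s • h) h h - 1 * B h h) (B := fun s => M * s) (B' := fun s => M * 1)
      (a := 0) (b := t) ht.1 (fun s _ => (line2 hu x h h s).sub ((hasDerivAt_id s).mul_const _))
      (by fun_prop) (fun s _ => ((hasDerivAt_id s).const_mul M).hasDerivWithinAt)
      (fun s hs => by simpa using hM s ⟨hs.1, hs.2.le.trans ht.2⟩)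
    simp at this
    convert this using 2; ring
  have := mvb (f := fun s => u (x + s • h) - s * fderiv ℝ u x h - s ^ 2 / 2 * B h h)
      (f' := fun s => fderiv ℝ u (x + s • h) h - 1 * fderiv ℝ u x h - s * B h h)
      (B := fun s => M * (s ^ 2 / 2)) (B' := fun s => M * s)
      (a := 0) (b := 1) zero_le_one
      (fun s _ => ((line1 hu x h s).sub ((hasDerivAt_id s).mul_const _)).sub
        (HasDerivAt.mul_const (by simpa using ((hasDerivAt_id s).pow 2).div_const 2) _))
      (by fun_prop) (fun s _ => (HasDerivAt.const_mul M
        (by simpa using ((hasDerivAt_id s).pow 2).div_const 2)).hasDerivWithinAt)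
      (fun s hs => by simpa using k1 s ⟨hs.1, hs.2.le⟩)
  simp at this
  convert this using 2 <;> ring

lemma taylor2 {u : Eu d → ℝ} (hu : ContDiff ℝ 2 u) (x h : Eu d) {M : ℝ} {B : Eu d →L[ℝ] Eu d →L[ℝ] ℝ}
    (hM : ∀ t ∈ Icc (-1:ℝ) 1, |Hs u (x + t • h) h h - B h h| ≤ M) :
    |u (x + h) + u (x - h) - 2 * u x - B h h| ≤ M := by
  have h1 := taylor1 hu x h (M := M) (B := B) (fun t ht => hM t ⟨by linarith [ht.1], ht.2⟩)
  have h2 := taylor1 hu x (-h) (M := M) (B := B) (fun t ht => by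
    have := hM (-t) ⟨by linarith [ht.2], by linarith [ht.1]⟩
    simpa using this)
  simp only [map_neg, neg_apply, neg_neg, ← sub_eq_add_neg] at h2
  rw [abs_le] at *
  constructor <;> linarith [h1.1, h1.2, h2.1, h2.2]

lemma sdiff_bd {u : Eu d → ℝ} (hu : ContDiff ℝ 2 u) {M : ℝ} (hM : ∀ x, ‖Hs u x‖ ≤ M) (x h : Eu d) :
    |u (x + h) + u (x - h) - 2 * u x| ≤ M * ‖h‖ ^ 2 := by
  have := taylor2 hu x h (B := 0) (M := M * ‖h‖ ^ 2) (fun t _ => by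
    have h1 := (Hs u (x + t • h)).le_opNorm₂ h h
    simp only [zero_apply, sub_zero]
    rw [Real.norm_eq_abs] at h1
    nlinarith [hM (x + t • h), norm_nonneg h])
  simpa using this

/-- recover a Hessian bound from second differences -/
lemma hs_of_sdiff {u : Eu d → ℝ} (hu : ContDiff ℝ 2 u) (x e : Eu d) {A : ℝ} {E : ℝ → ℝ}
    (hE : Filter.Tendsto E (nhdsWithin 0 (Ioi 0)) (nhds 0)) {t0 : ℝ} (ht0 : 0 < t0)
    (h : ∀ t, 0 < t → t < t0 →
      |u (x + t • e) + u (x - t • e) - 2 * u x| ≤ t ^ 2 * (A + E t)) : |Hs u x e e| ≤ A := by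
  refine le_of_forall_pos_le_add fun ε hε => ?_
  have hc : Filter.Tendsto (fun y => Hs u y e e) (nhds x) (nhds (Hs u x e e)) := by
    have := c2_Hs hu
    exact (show Continuous fun y => Hs u y e e by fun_prop).tendsto x
  obtain ⟨δ, hδ, H⟩ := Metric.tendsto_nhds_nhds.1 hc (ε / 2) (by linarith)
  have e1 : ∀ᶠ t in nhdsWithin (0:ℝ) (Ioi 0), E t < ε / 2 := hE.eventually_lt_const (by linarith)
  have e2 : ∀ᶠ t in nhdsWithin (0:ℝ) (Ioi 0), t < t0 :=
    nhdsWithin_le_nhds (Iio_mem_nhds ht0)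
  have e3 : ∀ᶠ t in nhdsWithin (0:ℝ) (Ioi 0), t < δ / (‖e‖ + 1) :=
    nhdsWithin_le_nhds (Iio_mem_nhds (by positivity))
  obtain ⟨t, ⟨⟨q1, q2⟩, q3⟩, q4⟩ := (((e1.and e2).and e3).and self_mem_nhdsWithin).exists
  have tp : 0 < t := q4
  rw [lt_div_iff₀ (by positivity)] at q3
  have T := taylor2 hu x (t • e) (B := Hs u x) (M := t ^ 2 * (ε / 2)) (fun s hs => by
    have h3 : dist (x + s • t • e) x < δ := by
      rw [dist_eq_norm, add_sub_cancel_left, norm_smul, norm_smul, Real.norm_eq_abs, Real.norm_eq_abs,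
        abs_of_pos tp]
      have : |s| ≤ 1 := abs_le.2 hs
      nlinarith [norm_nonneg e, mul_nonneg tp.le (norm_nonneg e)]
    have := (H h3).le
    rw [Real.dist_eq] at this
    simp only [map_smul, smul_apply, smul_eq_mul]
    rw [← mul_sub, ← mul_sub, abs_mul, abs_mul, abs_of_pos tp]
    nlinarith [mul_le_mul_of_nonneg_left this (sq_nonneg t)])
  have h4 := h t tp q2
  simp only [map_smul, smul_apply, smul_eq_mul] at T
  have h5 : t ^ 2 * |Hs u x e e| ≤ t ^ 2 * (A + E t + ε / 2) := by
    have : t ^ 2 * |Hs u x e e| = |t * (t * Hs u x e e)| := by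
      rw [← mul_assoc, abs_mul, ← pow_two, abs_of_nonneg (sq_nonneg t)]
    rw [this]
    rw [abs_le] at *
    constructor <;> nlinarith [T.1, T.2, h4.1, h4.2]
  have := le_of_mul_le_mul_left h5 (by positivity)
  linarith

lemma polar {B : Eu d →L[ℝ] Eu d →L[ℝ] ℝ} (hs : ∀ h k, B h k = B k h) {M : ℝ} (hM0 : 0 ≤ M)
    (hM : ∀ e, |B e e| ≤ M * ‖e‖ ^ 2) : ‖B‖ ≤ 2 * M := by
  refine B.opNorm_le_bound₂ (by positivity) fun h k => ?_
  rcases eq_or_ne h 0 with rfl | hh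
  · simp
  rcases eq_or_ne k 0 with rfl | hk
  · simp
  have ph := norm_pos_iff.2 hh
  have pk := norm_pos_iff.2 hk
  set x := ‖h‖⁻¹ • h with hx
  set y := ‖k‖⁻¹ • k with hy
  have nx : ‖x‖ = 1 := by rw [hx, norm_smul, norm_inv, norm_norm, inv_mul_cancel₀ ph.ne']
  have ny : ‖y‖ = 1 := by rw [hy, norm_smul, norm_inv, norm_norm, inv_mul_cancel₀ pk.ne']
  have e1 : h = ‖h‖ • x := by rw [hx, smul_smul, mul_inv_cancel₀ ph.ne', one_smul]
  have e2 : k = ‖k‖ • y := by rw [hy, smul_smul, mul_inv_cancel₀ pk.ne', one_smul]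
  have key : |B x y| ≤ 2 * M := by
    have h1 := hM (x + y)
    have h2 := hM (x - y)
    have n1 : ‖x + y‖ ≤ 2 := (norm_add_le x y).trans (by rw [nx, ny]; norm_num)
    have n2 : ‖x - y‖ ≤ 2 := (norm_sub_le x y).trans (by rw [nx, ny]; norm_num)
    have m1 : M * ‖x + y‖ ^ 2 ≤ M * 4 := mul_le_mul_of_nonneg_left (by nlinarith [norm_nonneg (x + y)]) hM0
    have m2 : M * ‖x - y‖ ^ 2 ≤ M * 4 := mul_le_mul_of_nonneg_left (by nlinarith [norm_nonneg (x - y)]) hM0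
    simp only [map_add, map_sub, add_apply, sub_apply] at h1 h2
    rw [hs y x] at h1 h2
    rw [abs_le] at *
    constructor <;> linarith [h1.1, h1.2, h2.1, h2.2]
  have : B h k = ‖h‖ * (‖k‖ * B x y) := by
    conv_lhs => rw [e1, e2]
    simp [mul_left_comm]
  rw [this, Real.norm_eq_abs, abs_mul, abs_mul, abs_norm, abs_norm]
  have : 0 ≤ ‖h‖ * ‖k‖ := by positivity
  nlinarith

end

open Metric Set MeasureTheory

noncomputable section
variable {d : ℕ}

def p0 (s : ℝ) : ℝ := Real.smoothTransition (4 * (1 - s))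
def q0 (s : ℝ) : ℝ := ∫ t in s..1, p0 t
def cK (d : ℕ) : ℝ := (∫ z : Eu d, p0 (‖z‖ ^ 2))⁻¹
def rh (z : Eu d) : ℝ := cK d * p0 (‖z‖ ^ 2)
def Rh (z : Eu d) : ℝ := cK d * q0 (‖z‖ ^ 2)

lemma p0_cd : ContDiff ℝ 3 p0 := by
  unfold p0
  exact (Real.smoothTransition.contDiff (n := 3)).comp (by fun_prop)
lemma p0_nn (s : ℝ) : 0 ≤ p0 s := Real.smoothTransition.nonneg _
lemma p0_zero {s : ℝ} (h : 1 ≤ s) : p0 s = 0 := Real.smoothTransition.zero_of_nonpos (by linarith)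
lemma p0_one {s : ℝ} (h : s ≤ 3 / 4) : p0 s = 1 := Real.smoothTransition.one_of_one_le (by linarith)
lemma q0_d (s : ℝ) : HasDerivAt q0 (-(p0 s)) s :=
  intervalIntegral.integral_hasDerivAt_left (p0_cd.continuous.intervalIntegrable _ _)
    (p0_cd.continuous.stronglyMeasurableAtFilter _ _) p0_cd.continuous.continuousAt
lemma q0_cd : ContDiff ℝ 3 q0 := by
  rw [show (3 : WithTop ℕ∞) = 2 + 1 by norm_num, contDiff_succ_iff_deriv]
  refine ⟨fun s => (q0_d s).differentiableAt, by simp, ?_⟩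
  rw [show deriv q0 = fun s => -(p0 s) from funext fun s => (q0_d s).deriv]
  exact (p0_cd.of_le (by norm_num)).neg
lemma q0_zero {s : ℝ} (h : 1 ≤ s) : q0 s = 0 := by
  unfold q0
  rw [intervalIntegral.integral_symm, intervalIntegral.integral_congr (g := fun _ => 0)]
  · simp
  · intro t ht
    rw [uIcc_of_le h] at ht
    exact p0_zero ht.1

lemma cs_of {k : Eu d → ℝ} (hz : ∀ z, 1 ≤ ‖z‖ → k z = 0) : HasCompactSupport k :=
  HasCompactSupport.intro (isCompact_closedBall (0 : Eu d) 1) fun z hzz => hz z (by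
    simp at hzz; exact hzz.le)

lemma rh_cd : ContDiff ℝ 3 (rh (d := d)) :=
  contDiff_const.mul (p0_cd.comp (contDiff_norm_sq ℝ))
lemma Rh_cd : ContDiff ℝ 3 (Rh (d := d)) :=
  contDiff_const.mul (q0_cd.comp (contDiff_norm_sq ℝ))
lemma rh_zero (z : Eu d) (h : 1 ≤ ‖z‖) : rh z = 0 := by
  unfold rh; rw [p0_zero (by nlinarith)]; simp
lemma Rh_zero (z : Eu d) (h : 1 ≤ ‖z‖) : Rh z = 0 := by
  unfold Rh; rw [q0_zero (by nlinarith)]; simp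

lemma cK_pos : 0 < cK d := by
  unfold cK
  rw [inv_pos]
  have hc : Continuous fun z : Eu d => p0 (‖z‖ ^ 2) := p0_cd.continuous.comp (by fun_prop)
  refine hc.integral_pos_of_hasCompactSupport_nonneg_nonzero
    (cs_of fun z hz => p0_zero (by nlinarith)) (fun z => p0_nn _) (x := 0) ?_
  rw [p0_one (by simp; norm_num)]; simp
lemma rh_nn (z : Eu d) : 0 ≤ rh z := mul_nonneg cK_pos.le (p0_nn _)
lemma rh_int : ∫ z : Eu d, rh z = 1 := by
  unfold rh
  rw [integral_const_mul]
  have := cK_pos (d := d)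
  unfold cK at *
  exact inv_mul_cancel₀ (inv_pos.1 this).ne'
lemma rh_plateau {x z : Eu d} (hx : ‖x‖ ≤ 1 / 2) : rh (z - x) ≤ rh ((1 / 2 : ℝ) • z) := by
  rcases le_or_gt 1 ‖z - x‖ with h | h
  · rw [rh_zero _ h]; exact rh_nn _
  · unfold rh
    refine mul_le_mul_of_nonneg_left ?_ cK_pos.le
    have : ‖z‖ ≤ 3 / 2 := by
      have := norm_add_le (z - x) x
      rw [sub_add_cancel] at this; linarith
    rw [p0_one (s := ‖(1 / 2 : ℝ) • z‖ ^ 2)]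
    · exact Real.smoothTransition.le_one _
    · rw [norm_smul]; norm_num; nlinarith [norm_nonneg z]

lemma Rh_d (z h : Eu d) : fderiv ℝ Rh z h = -2 * inner ℝ z h * rh z := by
  have h1 : HasFDerivAt (fun z : Eu d => ‖z‖ ^ 2) (2 • (innerSL ℝ z)) z := (hasStrictFDerivAt_norm_sq z).hasFDerivAt
  have h2 := ((q0_d (‖z‖ ^ 2)).comp_hasFDerivAt z h1).const_mul (cK d)
  rw [show fderiv ℝ Rh z = _ from h2.fderiv]
  simp [rh]; ring

lemma Hs_add_right (u : Eu d → ℝ) (y x : Eu d) : Hs (fun z => u (z + y)) x = Hs u (x + y) := by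
  unfold Hs
  rw [show fderiv ℝ (fun z => u (z + y)) = fun z => fderiv ℝ u (z + y) from
    funext fun z => fderiv_comp_add_right y]
  exact fderiv_comp_add_right (f := fderiv ℝ u) y

lemma D_sub {u v : Eu d → ℝ} (hu : ContDiff ℝ 2 u) (hv : ContDiff ℝ 2 v) (x : Eu d) :
    fderiv ℝ (fun z => u z - v z) x = fderiv ℝ u x - fderiv ℝ v x :=
  ((c2_d1 hu x).sub (c2_d1 hv x)).fderiv

lemma Hs_sub {u v : Eu d → ℝ} (hu : ContDiff ℝ 2 u) (hv : ContDiff ℝ 2 v) (x : Eu d) :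
    Hs (fun z => u z - v z) x = Hs u x - Hs v x := by
  rw [Hs, show fderiv ℝ (fun z => u z - v z) = fun z => fderiv ℝ u z - fderiv ℝ v z from
    funext fun z => D_sub hu hv z]
  exact ((c2_d2 hu x).sub (c2_d2 hv x)).fderiv

lemma lip_D {F : Type*} [NormedAddCommGroup F] [NormedSpace ℝ F] {f : Eu d → F} (hf : ContDiff ℝ 2 f)
    (cs : HasCompactSupport f) : ∃ C : NNReal, LipschitzWith C (fderiv ℝ f) :=
  ContDiff.lipschitzWith_of_hasCompactSupport (n := 1) (cs.fderiv ℝ) (hf.fderiv_right (by norm_num)) (by norm_num)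

lemma kern_bd {k : Eu d → ℝ} (hk : ContDiff ℝ 3 k) (hz : ∀ z, 1 ≤ ‖z‖ → k z = 0) :
    ∃ L : ℝ, 0 ≤ L ∧ (∀ z, |k z| ≤ L) ∧ (∀ z η, |k (z + η) - k z| ≤ L * ‖η‖) ∧
      (∀ z η, |k (z + η) + k (z - η) - 2 * k z| ≤ L * ‖η‖ ^ 2) ∧
      (∀ z η ζ, |(k (z + ζ + η) + k (z + ζ - η) - 2 * k (z + ζ)) -
        (k (z + η) + k (z - η) - 2 * k z)| ≤ L * ‖η‖ ^ 2 * ‖ζ‖) := by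
  have cs := cs_of hz
  have c2 : ContDiff ℝ 2 k := hk.of_le (by norm_num)
  have c3 : ContDiff ℝ 2 (fderiv ℝ k) := hk.fderiv_right (by norm_num)
  obtain ⟨L1, h1⟩ := c2.lipschitzWith_of_hasCompactSupport cs (by norm_num)
  obtain ⟨L2, h2⟩ := c3.lipschitzWith_of_hasCompactSupport (cs.fderiv ℝ) (by norm_num)
  obtain ⟨L3, h3⟩ := lip_D c3 (cs.fderiv ℝ)
  obtain ⟨L0, h0⟩ := hk.continuous.bounded_above_of_compact_support cs
  have b2 : ∀ x, ‖Hs k x‖ ≤ L2 := fun x => norm_fderiv_le_of_lipschitz ℝ h2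
  have b0 : 0 ≤ L0 := (norm_nonneg _).trans (h0 0)
  obtain ⟨L, hL⟩ : ∃ L : ℝ, L = L0 + (L1 : ℝ) + (L2 : ℝ) + (L3 : ℝ) := ⟨_, rfl⟩
  have n1 : (0:ℝ) ≤ L1 := L1.coe_nonneg
  have n2 : (0:ℝ) ≤ L2 := L2.coe_nonneg
  have n3 : (0:ℝ) ≤ L3 := L3.coe_nonneg
  refine ⟨L, by linarith, fun z => ?_, fun z η => ?_, fun z η => ?_, fun z η ζ => ?_⟩
  · exact (h0 z).trans (by linarith)
  · have h6 := h1.norm_sub_le (z + η) z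
    rw [add_sub_cancel_left] at h6
    exact h6.trans (mul_le_mul_of_nonneg_right (by linarith) (norm_nonneg _))
  · exact (sdiff_bd c2 b2 z η).trans (mul_le_mul_of_nonneg_right (by linarith) (by positivity))
  · have cc : ContDiff ℝ 2 (fun z => k (z + ζ)) := c2.comp (by fun_prop)
    have := sdiff_bd (u := fun z => k (z + ζ) - k z) (cc.sub c2) (M := L3 * ‖ζ‖) (fun x => by
      rw [Hs_sub cc c2, Hs_add_right]
      have h6 := h3.norm_sub_le (x + ζ) x
      rw [add_sub_cancel_left] at h6
      exact h6) z η
    have e1 : z + η + ζ = z + ζ + η := by abel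
    have e2 : z - η + ζ = z + ζ - η := by abel
    rw [e1, e2] at this
    refine le_trans (le_of_eq ?_) (this.trans ?_)
    · congr 1; ring
    · rw [mul_right_comm]
      exact mul_le_mul_of_nonneg_right (mul_le_mul_of_nonneg_right (by linarith) (by positivity)) (by positivity)

def W (v : Eu d → ℝ) (s : ℝ) (x : Eu d) : ℝ := ∫ z, v (x + s • z) * rh z
def WL (v : Eu d → ℝ) (s : ℝ) (x : Eu d) : ℝ := ∫ z, Lap v (x + s • z) * Rh z

lemma W_zero (v : Eu d → ℝ) (x : Eu d) : W v 0 x = v x := by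
  simp [W, integral_const_mul, rh_int]

lemma int_k {g k : Eu d → ℝ} (hg : Continuous g) (hk : Continuous k) (hz : ∀ z, 1 ≤ ‖z‖ → k z = 0) :
    Integrable (fun z => g z * k z) :=
  (hg.mul hk).integrable_of_hasCompactSupport (cs_of hz).mul_left

lemma W_deriv {v : Eu d → ℝ} (hv : ContDiff ℝ 2 v) (x : Eu d) (s : ℝ) :
    HasDerivAt (fun s => W v s x) (s / 2 * WL v s x) s := by
  have cv := hv.continuous
  have cD := (c2_D hv).continuous
  have cr := (rh_cd (d := d)).continuous
  have cR := (Rh_cd (d := d)).continuous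
  have cH := c2_Hs hv
  obtain ⟨M, hM⟩ := (isCompact_closedBall x (|s| + 1)).exists_bound_of_continuousOn cD.continuousOn
  have h1 := (hasDerivAt_integral_of_dominated_loc_of_deriv_le (μ := volume) (x₀ := s)
    (F := fun s z => v (x + s • z) * rh z) (s := ball s 1)
    (F' := fun s z => fderiv ℝ v (x + s • z) z * rh z) (bound := fun z => M * rh z)
    (ball_mem_nhds s one_pos) (Filter.Eventually.of_forall fun s => by
      exact (int_k (by fun_prop) cr rh_zero).aestronglyMeasurable)
    (int_k (by fun_prop) cr rh_zero)
    (int_k (by fun_prop) cr rh_zero).aestronglyMeasurable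
    (Filter.Eventually.of_forall fun z t ht => by
      rcases le_or_gt 1 ‖z‖ with h | h
      · rw [rh_zero z h]; simp
      rw [norm_mul, Real.norm_of_nonneg (rh_nn z)]
      refine mul_le_mul_of_nonneg_right ?_ (rh_nn z)
      refine ((fderiv ℝ v (x + t • z)).le_opNorm z).trans ?_
      have h3 : |t| ≤ |s| + 1 := by
        rw [mem_ball, Real.dist_eq] at ht
        have := abs_add_le (t - s) s
        rw [sub_add_cancel] at this; linarith
      have h4 := hM (x + t • z) (by
        rw [mem_closedBall, dist_eq_norm, add_sub_cancel_left, norm_smul, Real.norm_eq_abs]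
        nlinarith [abs_nonneg t, norm_nonneg z])
      nlinarith [norm_nonneg z, norm_nonneg (fderiv ℝ v (x + t • z))])
    (int_k continuous_const cr rh_zero)
    (Filter.Eventually.of_forall fun z t ht => (line1 hv x z t).mul_const _)).2
  refine h1.congr_deriv ?_
  -- integration by parts
  have ibp : ∀ i : Fin d, ∫ z : Eu d, fderiv ℝ v (x + s • z) (EuclideanSpace.single i 1) *
      fderiv ℝ Rh z (EuclideanSpace.single i 1) = - ∫ z, s * Hs v (x + s • z)
        (EuclideanSpace.single i 1) (EuclideanSpace.single i 1) * Rh z := by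
    intro i
    have hf : ∀ z : Eu d, HasFDerivAt (fun z : Eu d => fderiv ℝ v (x + s • z) (EuclideanSpace.single i 1))
        (s • ((Hs v (x + s • z)).flip (EuclideanSpace.single i 1))) z := by
      intro z
      have g1 : HasFDerivAt (fun z : Eu d => x + s • z) (s • ContinuousLinearMap.id ℝ (Eu d)) z :=
        ((hasFDerivAt_id z).const_smul s).const_add x
      have g2 := ((c2_d2 hv (x + s • z)).comp z g1).clm_apply (hasFDerivAt_const (EuclideanSpace.single i (1:ℝ)) z)
      refine g2.congr_fderiv ?_
      ext w; simp
    have e : ∀ z, fderiv ℝ (fun z : Eu d => fderiv ℝ v (x + s • z) (EuclideanSpace.single i 1)) z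
        (EuclideanSpace.single i 1) = s * Hs v (x + s • z)
        (EuclideanSpace.single i 1) (EuclideanSpace.single i 1) := fun z => by
      rw [(hf z).fderiv]; simp
    rw [integral_mul_fderiv_eq_neg_fderiv_mul_of_integrable]
    · simp_rw [e]
    · simp_rw [e]
      exact int_k (by fun_prop) cR Rh_zero
    · refine Continuous.integrable_of_hasCompactSupport ?_ ?_
      · have := (Rh_cd (d := d)).continuous_fderiv (by norm_num)
        fun_prop
      · exact ((cs_of Rh_zero).fderiv_apply ℝ _).mul_left
    · exact int_k (by fun_prop) cR Rh_zero
    · exact fun z _ => (hf z).differentiableAt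
    · exact fun z _ => (Rh_cd.differentiable (by norm_num)) z
  have e1 : ∀ z : Eu d, fderiv ℝ v (x + s • z) z * rh z = ∑ i, (-1 / 2 : ℝ) *
      (fderiv ℝ v (x + s • z) (EuclideanSpace.single i 1) * fderiv ℝ Rh z (EuclideanSpace.single i 1)) := by
    intro z
    have hz : fderiv ℝ v (x + s • z) z = ∑ i, z i * fderiv ℝ v (x + s • z) (EuclideanSpace.single i 1) := by
      have := (EuclideanSpace.basisFun (Fin d) ℝ).sum_repr z
      generalize fderiv ℝ v (x + s • z) = A
      conv_lhs => rw [← this]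
      simp
    rw [hz, Finset.sum_mul]
    refine Finset.sum_congr rfl fun i _ => ?_
    rw [Rh_d]; simp [EuclideanSpace.inner_single_right]; ring
  simp_rw [e1]
  rw [integral_finsetSum]
  · simp_rw [integral_const_mul, ibp]
    unfold WL Lap
    simp_rw [Finset.sum_mul]
    rw [integral_finsetSum, Finset.mul_sum]
    · refine Finset.sum_congr rfl fun i _ => ?_
      simp_rw [mul_assoc]
      rw [integral_const_mul]; ring
    · intro i _
      exact int_k (by fun_prop) cR Rh_zero
  · intro i _
    refine Integrable.const_mul (Continuous.integrable_of_hasCompactSupport ?_ ?_) _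
    · have := (Rh_cd (d := d)).continuous_fderiv (by norm_num)
      fun_prop
    · exact ((cs_of Rh_zero).fderiv_apply ℝ _).mul_left

def VB (d : ℕ) : ℝ := volume.real (closedBall (0 : Eu d) 3)

lemma kb {ι : Type} [Fintype ι] {k g : Eu d → ℝ} (hk : Continuous k) (hz : ∀ z, 1 ≤ ‖z‖ → k z = 0)
    (hg : Continuous g) (c : ι → ℝ) (p : ι → Eu d) {s B ω : ℝ} (hs : 0 < s) (hc : ∑ i, c i = 0)
    (hp : ∀ i, ‖p i‖ ≤ 2 * s) (hB : ∀ z, |∑ i, c i * k (z - s⁻¹ • p i)| ≤ B)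
    (hω : ∀ x, ‖x‖ ≤ 3 * s → |g x - g 0| ≤ ω) :
    |∑ i, c i * ∫ z, g (p i + s • z) * k z| ≤ VB d * B * ω := by
  have ω0 : 0 ≤ ω := (abs_nonneg _).trans (hω 0 (by simp; positivity))
  have B0 : 0 ≤ B := (abs_nonneg _).trans (hB 0)
  have e1 : ∀ i, ∫ z, g (p i + s • z) * k z = ∫ z, g (s • z) * k (z - s⁻¹ • p i) := by
    intro i
    rw [← integral_sub_right_eq_self (fun z => g (p i + s • z) * k z) (s⁻¹ • p i)]
    refine integral_congr_ae (Filter.Eventually.of_forall fun z => ?_)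
    simp only [smul_sub, smul_smul, mul_inv_cancel₀ hs.ne', one_smul, add_sub_cancel]
  have hz3 : ∀ z : Eu d, z ∉ closedBall (0 : Eu d) 3 → ∀ i, k (z - s⁻¹ • p i) = 0 := by
    intro z hz3 i
    refine hz _ ?_
    rw [mem_closedBall, dist_zero_right, not_le] at hz3
    have h1 : ‖s⁻¹ • p i‖ ≤ 2 := by
      rw [norm_smul, norm_inv, Real.norm_of_nonneg hs.le, inv_mul_le_iff₀ hs]; linarith [hp i]
    have := norm_sub_norm_le z (s⁻¹ • p i); linarith
  have ik : ∀ i (f : Eu d → ℝ), Continuous f → Integrable (fun z => f z * k (z - s⁻¹ • p i)) := by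
    intro i f hf
    refine (hf.mul (hk.comp (by fun_prop))).integrable_of_hasCompactSupport
      (HasCompactSupport.intro (isCompact_closedBall (0 : Eu d) 3) fun z h => ?_)
    simp [hz3 z h i]
  have e2 : ∑ i, c i * ∫ z, g (p i + s • z) * k z =
      ∫ z in closedBall (0 : Eu d) 3, (g (s • z) - g 0) * ∑ i, c i * k (z - s⁻¹ • p i) := by
    rw [setIntegral_eq_integral_of_forall_compl_eq_zero]
    · have : ∀ z, (g (s • z) - g 0) * ∑ i, c i * k (z - s⁻¹ • p i) =
        ∑ i, (c i * (g (s • z) * k (z - s⁻¹ • p i)) - c i * (g 0 * k (z - s⁻¹ • p i))) := by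
        intro z; rw [Finset.mul_sum]; exact Finset.sum_congr rfl fun i _ => by ring
      simp_rw [this]
      rw [integral_finsetSum]
      · have : ∀ i, ∫ z, (c i * (g (s • z) * k (z - s⁻¹ • p i)) - c i * (g 0 * k (z - s⁻¹ • p i))) =
          c i * (∫ z, g (p i + s • z) * k z) - c i * (g 0 * ∫ z, k z) := by
          intro i
          rw [integral_sub ((ik i _ (by fun_prop)).const_mul _) ((ik i _ continuous_const).const_mul _),
            integral_const_mul, integral_const_mul, integral_const_mul, e1,
            integral_sub_right_eq_self (fun z => k z)]
        simp_rw [this]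
        rw [Finset.sum_sub_distrib, ← Finset.sum_mul, hc]; simp
      · exact fun i _ => ((ik i _ (by fun_prop)).const_mul _).sub ((ik i _ continuous_const).const_mul _)
    · intro z h
      simp [hz3 z h]
  rw [e2, ← Real.norm_eq_abs]
  have := norm_setIntegral_le_of_norm_le_const (μ := volume) (s := closedBall (0 : Eu d) 3) (C := B * ω)
    (f := fun z => (g (s • z) - g 0) * ∑ i, c i * k (z - s⁻¹ • p i))
    (isCompact_closedBall _ _).measure_lt_top (fun z h => by
      rw [norm_mul, Real.norm_eq_abs, Real.norm_eq_abs, mul_comm]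
      refine mul_le_mul (hB z) (hω _ ?_) (abs_nonneg _) B0
      rw [mem_closedBall, dist_zero_right] at h
      rw [norm_smul, Real.norm_of_nonneg hs.le]; nlinarith)
  refine this.trans (le_of_eq ?_)
  unfold VB; ring

end

open Metric Set MeasureTheory

noncomputable section
variable {d : ℕ}

def D2 (F : Eu d → ℝ) (h : Eu d) : ℝ := F h + F (-h) - 2 * F 0

lemma kc_ex (d : ℕ) : ∃ L : ℝ, 0 ≤ L ∧ ∀ k : Eu d → ℝ, k = rh ∨ k = Rh →
      Continuous k ∧ (∀ z, 1 ≤ ‖z‖ → k z = 0) ∧ (∀ z, |k z| ≤ L) ∧ (∀ z η, |k (z + η) - k z| ≤ L * ‖η‖) ∧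
      (∀ z η, |k (z + η) + k (z - η) - 2 * k z| ≤ L * ‖η‖ ^ 2) ∧
      (∀ z η ζ, |(k (z + ζ + η) + k (z + ζ - η) - 2 * k (z + ζ)) -
        (k (z + η) + k (z - η) - 2 * k z)| ≤ L * ‖η‖ ^ 2 * ‖ζ‖) := by
  obtain ⟨L1, n1, a1, a2, a3, a4⟩ := kern_bd (rh_cd (d := d)) rh_zero
  obtain ⟨L2, n2, b1, b2, b3, b4⟩ := kern_bd (Rh_cd (d := d)) Rh_zero
  refine ⟨L1 + L2, by positivity, ?_⟩
  rintro k (rfl | rfl)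
  · refine ⟨rh_cd.continuous, rh_zero, fun z => (a1 z).trans (by linarith), fun z η => (a2 z η).trans ?_,
      fun z η => (a3 z η).trans ?_, fun z η ζ => (a4 z η ζ).trans ?_⟩ <;> gcongr <;> linarith
  · refine ⟨Rh_cd.continuous, Rh_zero, fun z => (b1 z).trans (by linarith), fun z η => (b2 z η).trans ?_,
      fun z η => (b3 z η).trans ?_, fun z η ζ => (b4 z η ζ).trans ?_⟩ <;> gcongr <;> linarith

def KL (d : ℕ) : ℝ := (kc_ex d).choose
lemma KL_nn : 0 ≤ KL d := (kc_ex d).choose_spec.1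
/-- total constant -/
def KV (d : ℕ) : ℝ := VB d * KL d
lemma VB_nn : 0 ≤ VB d := measureReal_nonneg
lemma KV_nn : 0 ≤ KV d := mul_nonneg VB_nn KL_nn

def isK (k : Eu d → ℝ) : Prop := k = rh ∨ k = Rh

lemma kb0 {k g : Eu d → ℝ} (hk : isK k) (hg : Continuous g) {x : Eu d} {s ω A : ℝ}
    (hω : ∀ z : Eu d, ‖z‖ ≤ 1 → |g (x + s • z) - A| ≤ ω) :
    |(∫ z, g (x + s • z) * k z) - A * ∫ z, k z| ≤ KV d * ω := by
  obtain ⟨ck, hz, h0, -⟩ := (kc_ex d).choose_spec.2 k hk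
  have ω0 : 0 ≤ ω := (abs_nonneg _).trans (hω 0 (by simp))
  rw [← integral_const_mul, ← integral_sub (int_k (by fun_prop) ck hz) (int_k continuous_const ck hz),
    ← setIntegral_eq_integral_of_forall_compl_eq_zero (s := closedBall (0 : Eu d) 3)]
  · rw [← Real.norm_eq_abs]
    refine (norm_setIntegral_le_of_norm_le_const (C := KL d * ω)
      (isCompact_closedBall _ _).measure_lt_top (fun z h => ?_)).trans (le_of_eq ?_)
    · rw [← sub_mul, norm_mul, mul_comm]
      rcases le_or_gt 1 ‖z‖ with h | h
      · rw [hz z h]; simp; exact mul_nonneg KL_nn ω0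
      · exact mul_le_mul (h0 z) (hω z h.le) (abs_nonneg _) KL_nn
    · unfold KV VB; ring
  · intro z h
    rw [hz z]; · simp
    simp at h; linarith

lemma kb1 {k g : Eu d → ℝ} (hk : isK k) (hg : Continuous g) {h : Eu d} {s ω : ℝ} (hs : 0 < s)
    (hh : ‖h‖ ≤ s) (hω : ∀ x, ‖x‖ ≤ 3 * s → |g x - g 0| ≤ ω) :
    |(∫ z, g (h + s • z) * k z) - ∫ z, g (-h + s • z) * k z| ≤ KV d * (2 * ‖h‖ / s) * ω := by
  obtain ⟨ck, hz, h0, h1, h2, h3⟩ := (kc_ex d).choose_spec.2 k hk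
  have := kb ck hz hg ![1, -1] ![h, -h] hs (B := KL d * (2 * ‖h‖ / s)) (ω := ω) (by simp)
    (by intro i; fin_cases i <;> simp <;> linarith) (fun z => ?_) hω
  · simp [Fin.sum_univ_two] at this
    refine (le_of_eq ?_).trans (this.trans (le_of_eq (by unfold KV; ring)))
    rw [sub_eq_add_neg]
  · have := h1 (z + s⁻¹ • h) (-(2 * s⁻¹) • h)
    simp [Fin.sum_univ_two]
    refine le_trans (le_of_eq ?_) (this.trans (le_of_eq ?_))
    · rw [← sub_eq_add_neg]; congr 3; module
    · simp only [KL]; rw [norm_smul]; simp [abs_of_pos hs]; left; field_simp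

lemma kb2 {k g : Eu d → ℝ} (hk : isK k) (hg : Continuous g) {h : Eu d} {s ω : ℝ} (hs : 0 < s)
    (hh : ‖h‖ ≤ s) (hω : ∀ x, ‖x‖ ≤ 3 * s → |g x - g 0| ≤ ω) :
    |D2 (fun x => ∫ z, g (x + s • z) * k z) h| ≤ KV d * (‖h‖ ^ 2 / s ^ 2) * ω := by
  obtain ⟨ck, hz, h0, h1, h2, h3⟩ := (kc_ex d).choose_spec.2 k hk
  have := kb ck hz hg ![1, 1, -2] ![h, -h, 0] hs (B := KL d * (‖h‖ ^ 2 / s ^ 2)) (ω := ω)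
    (by simp [Fin.sum_univ_three]; norm_num)
    (by intro i; fin_cases i <;> simp <;> linarith) (fun z => ?_) hω
  · simp [Fin.sum_univ_three] at this
    unfold D2
    refine (le_of_eq ?_).trans (this.trans (le_of_eq (by unfold KV; ring)))
    congr 1; simp; ring
  · have := h2 z (s⁻¹ • h)
    simp [Fin.sum_univ_three]
    refine le_trans (le_of_eq ?_) (this.trans (le_of_eq ?_))
    · congr 1; ring
    · simp only [KL]; rw [norm_smul, mul_pow]; simp; left; field_simp

lemma kb4 {k g : Eu d → ℝ} (hk : isK k) (hg : Continuous g) {h y : Eu d} {s ω : ℝ} (hs : 0 < s)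
    (hh : ‖h‖ ≤ s) (hy : ‖y‖ ≤ s) (hω : ∀ x, ‖x‖ ≤ 3 * s → |g x - g 0| ≤ ω) :
    |D2 (fun x => (∫ z, g (x + y + s • z) * k z) - ∫ z, g (x + s • z) * k z) h|
      ≤ KV d * (‖h‖ ^ 2 * ‖y‖ / s ^ 3) * ω := by
  obtain ⟨ck, hz, h0, h1, h2, h3⟩ := (kc_ex d).choose_spec.2 k hk
  have := kb ck hz hg ![1, 1, -2, -1, -1, 2] ![h + y, -h + y, y, h, -h, 0] hs
    (B := KL d * (‖h‖ ^ 2 * ‖y‖ / s ^ 3)) (ω := ω)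
    (by simp [Fin.sum_univ_six]; norm_num)
    (by
      have q1 := norm_add_le h y
      have q2 := norm_add_le (-h) y
      rw [norm_neg] at q2
      intro i; fin_cases i <;> simp <;> linarith) (fun z => ?_) hω
  · simp [Fin.sum_univ_six] at this
    unfold D2
    refine (le_of_eq ?_).trans (this.trans (le_of_eq (by unfold KV; ring)))
    congr 1; simp; ring
  · have := h3 z (s⁻¹ • h) (-(s⁻¹ • y))
    simp [Fin.sum_univ_six]
    refine le_trans (le_of_eq ?_) (this.trans (le_of_eq ?_))
    · have e1 : z - (s⁻¹ • h + s⁻¹ • y) = z + -(s⁻¹ • y) - s⁻¹ • h := by abel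
      have e2 : z - (-(s⁻¹ • h) + s⁻¹ • y) = z + -(s⁻¹ • y) + s⁻¹ • h := by abel
      have e3 : z - s⁻¹ • y = z + -(s⁻¹ • y) := by abel
      rw [e1, e2, e3]
      congr 1; ring
    · simp only [KL]; rw [norm_neg, norm_smul, norm_smul, mul_pow]; simp [abs_of_pos hs]; field_simp

lemma D2_deriv {v : Eu d → ℝ} (hv : ContDiff ℝ 2 v) (h : Eu d) (s : ℝ) :
    HasDerivAt (fun s => D2 (W v s) h) (s / 2 * D2 (WL v s) h) s := by
  unfold D2
  exact (((W_deriv hv h s).add (W_deriv hv (-h) s)).sub ((W_deriv hv 0 s).const_mul 2)).congr_deriv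
    (by ring)

lemma sq3 : Real.sqrt 3 ≤ 2 := by rw [Real.sqrt_le_left (by norm_num)]; norm_num

lemma lemA {v : Eu d → ℝ} (hv : ContDiff ℝ 2 v) {h : Eu d} {s0 H : ℝ} (hh : h ≠ 0) (hs : ‖h‖ ≤ s0)
    (hH0 : 0 ≤ H) (hH : ∀ x, ‖x‖ ≤ 3 * s0 → |Lap v x - Lap v 0| ≤ H * √‖x‖) :
    |D2 v h| ≤ |D2 (W v s0) h| + 4 * KV d * H * ‖h‖ ^ 2 * √s0 := by
  have ph := norm_pos_iff.2 hh
  have hK := KV_nn (d := d)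
  have A := mvb (f := fun s => D2 (W v s) h) (f' := fun s => s / 2 * D2 (WL v s) h)
    (B := fun s => (2 * KV d * H * (2 * √‖h‖)) * (s ^ 2 / 2)) (B' := fun s => (2 * KV d * H * (2 * √‖h‖)) * s)
    (a := 0) (b := ‖h‖) ph.le (fun s _ => D2_deriv hv h s) (by fun_prop)
    (fun s _ => (HasDerivAt.const_mul _
        (by simpa using ((hasDerivAt_id s).pow 2).div_const 2)).hasDerivWithinAt) (fun s hs' => by
      have key : ∀ x : Eu d, ‖x‖ ≤ ‖h‖ → |WL v s x - Lap v 0 * ∫ z : Eu d, Rh z| ≤ KV d * (H * (2 * √‖h‖)) := by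
        intro x hx
        refine kb0 (Or.inr rfl) (c2_Lap hv) fun z hz => ?_
        have n1 : ‖x + s • z‖ ≤ 3 * ‖h‖ := by
          have := norm_add_le x (s • z)
          rw [norm_smul, Real.norm_of_nonneg hs'.1] at this
          nlinarith [hs'.1, hs'.2, norm_nonneg z]
        refine (hH _ (by linarith)).trans (mul_le_mul_of_nonneg_left ?_ hH0)
        refine (Real.sqrt_le_sqrt n1).trans ?_
        rw [Real.sqrt_mul (by norm_num)]
        exact mul_le_mul_of_nonneg_right sq3 (Real.sqrt_nonneg _)
      have k1 := key h le_rfl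
      have k2 := key (-h) (by simp)
      have k3 := key 0 (by simp)
      rw [abs_mul, abs_of_nonneg (by linarith [hs'.1])]
      have : |D2 (WL v s) h| ≤ 4 * (KV d * (H * (2 * √‖h‖))) := by
        unfold D2
        rw [abs_le] at *; constructor <;> linarith [k1.1, k1.2, k2.1, k2.2, k3.1, k3.2]
      nlinarith [hs'.1])
  have B := mvb (f := fun s => D2 (W v s) h) (f' := fun s => s / 2 * D2 (WL v s) h)
    (B := fun s => (2 * KV d * H * ‖h‖ ^ 2) * √s) (B' := fun s => (2 * KV d * H * ‖h‖ ^ 2) * (1 / (2 * √s)))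
    (a := ‖h‖) (b := s0) hs (fun s _ => D2_deriv hv h s) (by fun_prop)
    (fun s hs' => ((Real.hasDerivAt_sqrt (ph.trans_le hs'.1).ne').const_mul _).hasDerivWithinAt)
    (fun s hs' => by
      have sp : 0 < s := ph.trans_le hs'.1
      have := kb2 (k := Rh) (Or.inr rfl) (c2_Lap hv) (h := h) (ω := H * (2 * √s)) sp hs'.1 (fun x hx => by
        refine (hH _ (by linarith [hs'.2])).trans (mul_le_mul_of_nonneg_left ?_ hH0)
        refine (Real.sqrt_le_sqrt hx).trans ?_
        rw [Real.sqrt_mul (by norm_num)]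
        exact mul_le_mul_of_nonneg_right sq3 (Real.sqrt_nonneg _))
      rw [abs_mul, abs_of_pos (by linarith)]
      refine (mul_le_mul_of_nonneg_left this (by linarith)).trans (le_of_eq ?_)
      have hq : √s * √s = s := Real.mul_self_sqrt sp.le
      have hq0 : √s ≠ 0 := (Real.sqrt_pos.2 sp).ne'
      field_simp
      rw [pow_two, hq]; ring)
  have e0 : D2 (W v 0) h = D2 v h := by simp [D2, W_zero]
  rw [e0] at A
  have h4 : √‖h‖ ≤ √s0 := Real.sqrt_le_sqrt hs
  have h5 : KV d * H * ‖h‖ ^ 2 * √‖h‖ ≤ KV d * H * ‖h‖ ^ 2 * √s0 :=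
    mul_le_mul_of_nonneg_left h4 (by positivity)
  have t1 := abs_sub_abs_le_abs_sub (D2 v h) (D2 (W v ‖h‖) h)
  have t2 := abs_sub_abs_le_abs_sub (D2 (W v ‖h‖) h) (D2 (W v s0) h)
  rw [abs_sub_comm] at t1 t2
  have h6 : 0 ≤ KV d * H * ‖h‖ ^ 2 * √s0 := by positivity
  linarith


lemma E0a {v : Eu d → ℝ} (hv : ContDiff ℝ 2 v) {r ω H : ℝ} (hr : 0 < r) (hH0 : 0 ≤ H)
    (hω : ∀ x, ‖x‖ ≤ r → |v x - v 0| ≤ ω) (hH : ∀ x, ‖x‖ ≤ r → |Lap v x - Lap v 0| ≤ H * √‖x‖)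
    (e : Eu d) : |Hs v 0 e e| ≤ 9 * KV d * (ω / r ^ 2 + H * √r) * ‖e‖ ^ 2 := by
  have hK := KV_nn (d := d)
  rcases eq_or_ne e 0 with rfl | he
  · simp
  have pe := norm_pos_iff.2 he
  refine hs_of_sdiff hv 0 e (E := fun _ => 0) tendsto_const_nhds (t0 := r / 3 / ‖e‖) (by positivity)
    fun t t0 ht => ?_
  rw [lt_div_iff₀ pe] at ht
  have nt : ‖t • e‖ = t * ‖e‖ := by rw [norm_smul, Real.norm_of_nonneg t0.le]
  have A := lemA hv (h := t • e) (s0 := r / 3) (H := H) (by simp [t0.ne', he]) (by rw [nt]; exact ht.le) hH0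
    (fun x hx => hH x (by linarith))
  have B := kb2 (k := rh) (Or.inl rfl) hv.continuous (h := t • e) (s := r / 3) (ω := ω) (by positivity)
    (by rw [nt]; exact ht.le) (fun x hx => hω x (by linarith))
  change |D2 (W v (r / 3)) (t • e)| ≤ _ at B
  have e1 : D2 v (t • e) = v (0 + t • e) + v (0 - t • e) - 2 * v 0 := by simp [D2]
  rw [← e1]
  rw [nt] at A B
  have h4 : √(r / 3) ≤ √r := Real.sqrt_le_sqrt (by linarith)
  have h5 : KV d * H * (t * ‖e‖) ^ 2 * √(r / 3) ≤ KV d * H * (t * ‖e‖) ^ 2 * √r :=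
    mul_le_mul_of_nonneg_left h4 (by positivity)
  have h6 : 0 ≤ KV d * H * (t * ‖e‖) ^ 2 * √r := by positivity
  have h7 : KV d * ((t * ‖e‖) ^ 2 / (r / 3) ^ 2) * ω = 9 * (KV d * (ω / r ^ 2) * (t * ‖e‖) ^ 2) := by
    field_simp; ring
  rw [h7] at B
  nlinarith

lemma E0b {v : Eu d → ℝ} (hv : ContDiff ℝ 2 v) {r ω H : ℝ} (hr : 0 < r) (hH0 : 0 ≤ H)
    (hω : ∀ x, ‖x‖ ≤ r → |v x - v 0| ≤ ω)
    (hH : ∀ x y, ‖x‖ ≤ r → ‖y‖ ≤ r → |Lap v x - Lap v y| ≤ H * √‖x - y‖)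
    (y e : Eu d) (hy : ‖y‖ ≤ r / 4) :
    |Hs v y e e - Hs v 0 e e| ≤ 27 * KV d * (ω * ‖y‖ / r ^ 3 + H * √‖y‖) * ‖e‖ ^ 2 := by
  have hK := KV_nn (d := d)
  rcases eq_or_ne e 0 with rfl | he
  · simp
  rcases eq_or_ne y 0 with rfl | hy0
  · simp
  have pe := norm_pos_iff.2 he
  have py := norm_pos_iff.2 hy0
  have cc : ContDiff ℝ 2 (fun z => v (z + y)) := hv.comp (by fun_prop)
  have hvy : ContDiff ℝ 2 (fun z => v (z + y) - v z) := cc.sub hv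
  have eH : ∀ x, Hs (fun z => v (z + y) - v z) x = Hs v (x + y) - Hs v x := fun x => by
    rw [Hs_sub cc hv, Hs_add_right]
  have eL : ∀ x, Lap (fun z => v (z + y) - v z) x = Lap v (x + y) - Lap v x := fun x => by
    simp [Lap, eH]
  have e0 : Hs v y e e - Hs v 0 e e = Hs (fun z => v (z + y) - v z) 0 e e := by simp [eH]
  rw [e0]
  refine hs_of_sdiff hvy 0 e (E := fun _ => 0) tendsto_const_nhds (t0 := ‖y‖ / ‖e‖) (by positivity)
    fun t t0 ht => ?_
  rw [lt_div_iff₀ pe] at ht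
  set h := t • e with hh
  have nt : ‖h‖ = t * ‖e‖ := by rw [hh, norm_smul, Real.norm_of_nonneg t0.le]
  rw [← nt] at ht
  have A := lemA hvy (h := h) (s0 := ‖y‖) (H := 2 * H) (by simp [hh, t0.ne', he]) ht.le (by positivity)
    (fun x hx => by
      rw [eL, eL]
      have n1 := norm_add_le x y
      have a1 := hH (x + y) y (by linarith) (by linarith)
      have a2 := hH x 0 (by linarith) (by simp; linarith)
      rw [add_sub_cancel_right] at a1
      rw [sub_zero] at a2
      rw [zero_add]
      rw [abs_le] at *; constructor <;> linarith [a1.1, a1.2, a2.1, a2.2])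
  have eW : ∀ s, D2 (W (fun z => v (z + y) - v z) s) h =
      D2 (fun x => W v s (x + y) - W v s x) h := by
    intro s
    have : ∀ x, W (fun z => v (z + y) - v z) s x = W v s (x + y) - W v s x := by
      intro x
      have cv := hv.continuous
      have cr := (rh_cd (d := d)).continuous
      unfold W
      rw [← integral_sub (int_k (by fun_prop) cr rh_zero) (int_k (by fun_prop) cr rh_zero)]
      refine integral_congr_ae (Filter.Eventually.of_forall fun z => ?_)
      simp only
      rw [← sub_mul, add_right_comm]
    simp [D2, this]
  rw [eW] at A
  have B := mvb (f := fun s => D2 (fun x => W v s (x + y) - W v s x) h)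
    (f' := fun s => s / 2 * D2 (fun x => WL v s (x + y) - WL v s x) h)
    (B := fun s => (2 * KV d * H * (‖h‖ ^ 2 * ‖y‖)) * (- (√s)⁻¹))
    (B' := fun s => (2 * KV d * H * (‖h‖ ^ 2 * ‖y‖)) * (1 / (2 * √s) / (√s) ^ 2))
    (a := ‖y‖) (b := r / 3) (by linarith) (fun s _ => by
      unfold D2
      exact ((((W_deriv hv _ s).sub (W_deriv hv _ s)).add ((W_deriv hv _ s).sub (W_deriv hv _ s))).sub
        (((W_deriv hv _ s).sub (W_deriv hv _ s)).const_mul 2)).congr_deriv (by ring))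
    (by
      refine continuousOn_const.mul (ContinuousOn.neg (ContinuousOn.inv₀ (by fun_prop) fun s hs => ?_))
      exact (Real.sqrt_pos.2 (py.trans_le hs.1)).ne')
    (fun s hs' => by
      have sp : 0 < s := py.trans_le hs'.1
      have := ((Real.hasDerivAt_sqrt sp.ne').inv (Real.sqrt_pos.2 sp).ne').neg
      refine (HasDerivAt.const_mul _ (this.congr_deriv ?_)).hasDerivWithinAt
      ring)
    (fun s hs' => by
      have sp : 0 < s := py.trans_le hs'.1
      have := kb4 (k := Rh) (Or.inr rfl) (c2_Lap hv) (h := h) (y := y) (ω := H * (2 * √s)) sp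
        (ht.le.trans hs'.1) hs'.1 (fun x hx => by
        have := hH x 0 (by linarith [hs'.2]) (by simp; linarith)
        rw [sub_zero] at this
        refine this.trans (mul_le_mul_of_nonneg_left ?_ hH0)
        refine (Real.sqrt_le_sqrt hx).trans ?_
        rw [Real.sqrt_mul (by norm_num)]
        exact mul_le_mul_of_nonneg_right sq3 (Real.sqrt_nonneg _))
      rw [abs_mul, abs_of_pos (by linarith)]
      refine (mul_le_mul_of_nonneg_left this (by linarith)).trans (le_of_eq ?_)
      have hq : √s ^ 2 = s := Real.sq_sqrt sp.le
      have hq0 : √s ≠ 0 := (Real.sqrt_pos.2 sp).ne'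
      rw [hq]
      field_simp
      rw [hq]; ring)
  have C := kb4 (k := rh) (Or.inl rfl) hv.continuous (h := h) (y := y) (s := r / 3) (ω := ω) (by positivity)
    (by linarith) (by linarith) (fun x hx => hω x (by linarith))
  change |D2 (fun x => W v (r / 3) (x + y) - W v (r / 3) x) h| ≤ _ at C
  have e1 : D2 (fun z => v (z + y) - v z) h = (fun z => v (z + y) - v z) (0 + h) +
    (fun z => v (z + y) - v z) (0 - h) - 2 * (fun z => v (z + y) - v z) 0 := by simp [D2]
  rw [e1] at A
  have sy : ‖y‖ * (√‖y‖)⁻¹ = √‖y‖ := by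
    have hq : √‖y‖ * √‖y‖ = ‖y‖ := Real.mul_self_sqrt py.le
    have hq0 : √‖y‖ ≠ 0 := (Real.sqrt_pos.2 py).ne'
    field_simp; rw [pow_two, hq]
  have h7 : KV d * (‖h‖ ^ 2 * ‖y‖ / (r / 3) ^ 3) * ω = 27 * (KV d * (ω * ‖y‖ / r ^ 3) * ‖h‖ ^ 2) := by
    field_simp; ring
  rw [h7] at C
  have t2 := abs_sub_abs_le_abs_sub (D2 (fun x => W v ‖y‖ (x + y) - W v ‖y‖ x) h)
    (D2 (fun x => W v (r / 3) (x + y) - W v (r / 3) x) h)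
  rw [abs_sub_comm] at t2
  have h8 : (2 * KV d * H * (‖h‖ ^ 2 * ‖y‖)) * (- (√(r / 3))⁻¹) ≤ 0 :=
    mul_nonpos_of_nonneg_of_nonpos (by positivity) (neg_nonpos.2 (by positivity))
  have h9 : (2 * KV d * H * (‖h‖ ^ 2 * ‖y‖)) * (- (√‖y‖)⁻¹) = - (2 * (KV d * H * ‖h‖ ^ 2 * √‖y‖)) := by
    rw [show ∀ a b c e : ℝ, 2 * a * b * (c * e) * -(√‖y‖)⁻¹ = -(2 * (a * b * c * (e * (√‖y‖)⁻¹))) from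
      fun a b c e => by ring, sy]
  rw [h9] at B
  have h6 : 0 ≤ KV d * H * ‖h‖ ^ 2 * √‖y‖ := by positivity
  have h10 : t ^ 2 * (27 * KV d * (ω * ‖y‖ / r ^ 3 + H * √‖y‖) * ‖e‖ ^ 2 + 0) =
    27 * (KV d * (ω * ‖y‖ / r ^ 3) * ‖h‖ ^ 2) + 27 * (KV d * H * ‖h‖ ^ 2 * √‖y‖) := by rw [nt]; ring
  rw [h10]
  linarith

lemma E1 {v : Eu d → ℝ} (hv : ContDiff ℝ 2 v) {r ω θ : ℝ} (hr : 0 < r)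
    (hω : ∀ x, ‖x‖ ≤ r → |v x - v 0| ≤ ω) (hθ : ∀ x, ‖x‖ ≤ r → |Lap v x| ≤ θ)
    (e : Eu d) : |fderiv ℝ v 0 e| ≤ 3 * KV d * (ω / r + r * θ) * ‖e‖ := by
  have hK := KV_nn (d := d)
  rcases eq_or_ne e 0 with rfl | he
  · simp
  have pe := norm_pos_iff.2 he
  have θ0 : 0 ≤ θ := (abs_nonneg _).trans (hθ 0 (by simp; positivity))
  have main : ∀ t, 0 < t → t < r / 3 / ‖e‖ → |v (t • e) - v (-(t • e))| ≤
      2 * t * (3 * KV d * (ω / r + r * θ) * ‖e‖) := by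
    intro t t0 ht
    rw [lt_div_iff₀ pe] at ht
    set h := t • e with hh
    have nt : ‖h‖ = t * ‖e‖ := by rw [hh, norm_smul, Real.norm_of_nonneg t0.le]
    rw [← nt] at ht
    have ph : 0 < ‖h‖ := by rw [nt]; positivity
    have A := mvb (f := fun s => W v s h - W v s (-h)) (f' := fun s => s / 2 * (WL v s h - WL v s (-h)))
      (B := fun s => (2 * KV d * ‖h‖ * θ) * s) (B' := fun s => (2 * KV d * ‖h‖ * θ) * 1)
      (a := 0) (b := r / 3) (by linarith)
      (fun s _ => ((W_deriv hv h s).sub (W_deriv hv (-h) s)).congr_deriv (by ring)) (by fun_prop)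
      (fun s _ => ((hasDerivAt_id s).const_mul _).hasDerivWithinAt) (fun s hs' => by
        rw [abs_mul, abs_of_nonneg (by linarith [hs'.1])]
        rcases le_or_gt s ‖h‖ with hsh | hsh
        · have key : ∀ x : Eu d, ‖x‖ ≤ ‖h‖ → |WL v s x - 0 * ∫ z : Eu d, Rh z| ≤ KV d * θ := by
            intro x hx
            refine kb0 (Or.inr rfl) (c2_Lap hv) fun z hz => ?_
            rw [sub_zero]
            refine hθ _ ?_
            have := norm_add_le x (s • z)
            rw [norm_smul, Real.norm_of_nonneg hs'.1] at this
            nlinarith [hs'.1, hs'.2, norm_nonneg z]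
          have k1 := key h le_rfl
          have k2 := key (-h) (by simp)
          have : |WL v s h - WL v s (-h)| ≤ 2 * (KV d * θ) := by
            rw [abs_le] at *; constructor <;> linarith [k1.1, k1.2, k2.1, k2.2]
          have h3 : 0 ≤ KV d * θ := by positivity
          nlinarith [hs'.1]
        · have sp := ph.trans hsh
          have := kb1 (k := Rh) (Or.inr rfl) (c2_Lap hv) (h := h) (ω := 2 * θ) sp hsh.le (fun x hx => by
            have a1 := hθ x (by linarith [hs'.2])
            have a2 := hθ 0 (by simp; linarith)
            rw [abs_le] at *; constructor <;> linarith [a1.1, a1.2, a2.1, a2.2])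
          refine (mul_le_mul_of_nonneg_left this (by linarith)).trans (le_of_eq ?_)
          field_simp)
    have B := kb1 (k := rh) (Or.inl rfl) hv.continuous (h := h) (s := r / 3) (ω := ω) (by positivity)
      ht.le (fun x hx => hω x (by linarith))
    change |W v (r / 3) h - W v (r / 3) (-h)| ≤ _ at B
    simp only [W_zero] at A
    have t2 := abs_sub_abs_le_abs_sub (v h - v (-h)) (W v (r / 3) h - W v (r / 3) (-h))
    rw [abs_sub_comm (v h - v (-h)) (W v (r / 3) h - W v (r / 3) (-h))] at t2
    have h7 : KV d * (2 * ‖h‖ / (r / 3)) * ω = 6 * (KV d * (ω / r) * ‖h‖) := by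
      field_simp; ring
    have h6 : 0 ≤ KV d * (r * θ) * ‖h‖ := by positivity
    rw [h7] at B
    rw [show 2 * t * (3 * KV d * (ω / r + r * θ) * ‖e‖) = 6 * (KV d * (ω / r) * ‖h‖) +
      6 * (KV d * (r * θ) * ‖h‖) by rw [nt]; ring]
    linarith
  have hd := (line1 hv 0 e 0).tendsto_slope_zero_right
  have hd' : HasDerivAt (fun t : ℝ => v (t • e) - v (-(t • e))) (2 * fderiv ℝ v 0 e) 0 := by
    have a1 := line1 hv 0 e 0
    have a2 := line1 hv 0 (-e) 0
    simp only [zero_add, smul_neg, zero_smul, neg_zero, map_neg] at a1 a2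
    exact (a1.sub a2).congr_deriv (by ring)
  have l1 := hd'.tendsto_slope_zero_right.abs
  simp only [zero_add, zero_smul, neg_zero, sub_self, sub_zero, smul_eq_mul] at l1
  have := le_of_tendsto l1 (b := 2 * (3 * KV d * (ω / r + r * θ) * ‖e‖)) (by
    filter_upwards [self_mem_nhdsWithin, nhdsWithin_le_nhds (Iio_mem_nhds (show 0 < r / 3 / ‖e‖ by positivity))]
      with t ht1 ht2
    have tp : 0 < t := ht1
    rw [abs_mul, abs_of_pos (inv_pos.2 tp), inv_mul_le_iff₀ tp]
    have := main t tp ht2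
    linarith)
  rw [abs_mul] at this
  norm_num at this
  linarith

lemma Hk {v : Eu d → ℝ} (hv : ContDiff ℝ 2 v) (vp : ∀ x, 0 ≤ v x) {t θ : ℝ} (ht : 0 < t)
    (hθ : ∀ x, ‖x‖ ≤ 2 * t → |Lap v x| ≤ θ) (x : Eu d) (hx : ‖x‖ ≤ t / 2) :
    v x ≤ 2 ^ d * v 0 + (2 ^ d + 1) * KV d * t ^ 2 * θ := by
  have hK := KV_nn (d := d)
  have θ0 : 0 ≤ θ := (abs_nonneg _).trans (hθ 0 (by simp; positivity))
  have key : ∀ (x : Eu d) (s0 : ℝ), 0 ≤ s0 → ‖x‖ + s0 ≤ 2 * t → |W v s0 x - v x| ≤ KV d * θ * (s0 ^ 2 / 4) := by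
    intro x s0 h0 hxs
    have A := mvb (f := fun s => W v s x) (f' := fun s => s / 2 * WL v s x)
      (B := fun s => (KV d * θ / 2) * (s ^ 2 / 2)) (B' := fun s => (KV d * θ / 2) * s)
      (a := 0) (b := s0) h0 (fun s _ => W_deriv hv x s) (by fun_prop)
      (fun s _ => (HasDerivAt.const_mul _
        (by simpa using ((hasDerivAt_id s).pow 2).div_const 2)).hasDerivWithinAt) (fun s hs' => by
        rw [abs_mul, abs_of_nonneg (by linarith [hs'.1])]
        have := kb0 (k := Rh) (Or.inr rfl) (c2_Lap hv) (x := x) (s := s) (A := 0) (ω := θ) fun z hz => by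
          rw [sub_zero]
          refine hθ _ ?_
          have := norm_add_le x (s • z)
          rw [norm_smul, Real.norm_of_nonneg hs'.1] at this
          nlinarith [hs'.1, hs'.2, norm_nonneg z]
        rw [zero_mul, sub_zero] at this
        change |WL v s x| ≤ _ at this
        nlinarith [hs'.1])
    rw [W_zero] at A
    linarith
  have k1 := key x t ht.le (by linarith)
  have k2 := key 0 (2 * t) (by linarith) (by simp)
  have cv := hv.continuous
  have cr := (rh_cd (d := d)).continuous
  have k3 : W v t x ≤ 2 ^ d * W v (2 * t) 0 := by
    unfold W
    rw [← integral_sub_right_eq_self (fun z => v (x + t • z) * rh z) (t⁻¹ • x)]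
    have e1 := Measure.integral_comp_smul (volume : Measure (Eu d)) (fun z => v (0 + (2 * t) • z) * rh z) (1 / 2 : ℝ)
    have e2 : |(((1 / 2 : ℝ)) ^ (Module.finrank ℝ (Eu d)))⁻¹| = 2 ^ d := by
      simp
    rw [e2, smul_eq_mul] at e1
    rw [← e1]
    refine integral_mono ?_ ?_ fun z => ?_
    · exact (int_k (g := fun z => v (x + t • z)) (by fun_prop) cr rh_zero).comp_sub_right (t⁻¹ • x)
    · exact (int_k (g := fun z => v (0 + (2 * t) • z)) (by fun_prop) cr rh_zero).comp_smul (by norm_num)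
    · simp only [smul_sub, smul_smul, mul_inv_cancel₀ ht.ne', one_smul, add_sub_cancel]
      rw [show 2 * t * (1 / 2) = t by ring, zero_add]
      refine mul_le_mul_of_nonneg_left (rh_plateau ?_) (vp _)
      rw [norm_smul, norm_inv, Real.norm_of_nonneg ht.le, inv_mul_le_iff₀ ht]; linarith
  rw [abs_le] at k1 k2
  have h2 : (0:ℝ) < 2 ^ d := by positivity
  have h3 : 0 ≤ KV d * t ^ 2 * θ := by positivity
  have h4 : 2 ^ d * W v (2 * t) 0 ≤ 2 ^ d * (v 0 + KV d * θ * ((2 * t) ^ 2 / 4)) :=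
    mul_le_mul_of_nonneg_left (by linarith [k2.2]) h2.le
  nlinarith [k1.1, k1.2]

end

open Metric Set MeasureTheory

noncomputable section
variable {d : ℕ}

abbrev Bil (d : ℕ) := Eu d →L[ℝ] Eu d →L[ℝ] ℝ

abbrev eb (i : Fin d) : Eu d := EuclideanSpace.single i 1

def trM (A : Matrix (Fin d) (Fin d) ℝ) (B : Bil d) : ℝ :=
  ∑ i, ∑ j, A i j * B (eb i) (eb j)

def Ell (L : ℝ) (A : Matrix (Fin d) (Fin d) ℝ) : Prop :=
  A.IsSymm ∧ ∀ z, L⁻¹ * ‖z‖ ^ 2 ≤ quadForm A z ∧ quadForm A z ≤ L * ‖z‖ ^ 2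

lemma trM_sub_left (A A' : Matrix (Fin d) (Fin d) ℝ) (B : Bil d) :
    trM (A - A') B = trM A B - trM A' B := by
  simp [trM, sub_mul]

lemma trM_sub_right (A : Matrix (Fin d) (Fin d) ℝ) (B B' : Bil d) :
    trM A (B - B') = trM A B - trM A B' := by
  simp [trM, mul_sub]

lemma trM_bd {A : Matrix (Fin d) (Fin d) ℝ} {c : ℝ} (h : ∀ i j, |A i j| ≤ c) (B : Bil d) :
    |trM A B| ≤ d ^ 2 * c * ‖B‖ := by
  have : ∀ i j, |A i j * B (eb i) (eb j)| ≤ c * ‖B‖ := by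
    intro i j
    rw [abs_mul]
    refine mul_le_mul (h i j) ?_ (abs_nonneg _) ((abs_nonneg _).trans (h i j))
    simpa using B.le_opNorm₂ (eb i) (eb j)
  calc |trM A B| ≤ ∑ i : Fin d, ∑ j : Fin d, c * ‖B‖ :=
        (Finset.abs_sum_le_sum_abs _ _).trans (Finset.sum_le_sum fun i _ =>
          (Finset.abs_sum_le_sum_abs _ _).trans (Finset.sum_le_sum fun j _ => this i j))
    _ = _ := by simp; ring

open scoped MatrixOrder in
lemma sqA {A : Matrix (Fin d) (Fin d) ℝ} (h : A.IsSymm) (hq : ∀ z, 0 ≤ quadForm A z) :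
    ∃ C : Matrix (Fin d) (Fin d) ℝ, C.IsSymm ∧ C * C = A := by
  have hp : A.PosSemidef := by
    refine Matrix.PosSemidef.of_dotProduct_mulVec_nonneg (by rw [Matrix.IsHermitian, Matrix.conjTranspose_eq_transpose_of_trivial]; exact h) fun z => ?_
    have := hq (WithLp.toLp 2 z)
    have e : star z ⬝ᵥ A.mulVec z = quadForm A (WithLp.toLp 2 z) := by
      simp [quadForm, dotProduct, Matrix.mulVec, Finset.mul_sum, mul_assoc]
    rw [e]; exact this
  have h0 : 0 ≤ A := hp.nonneg
  refine ⟨CFC.sqrt A, ?_, CFC.sqrt_mul_sqrt_self A h0⟩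
  have := (Matrix.nonneg_iff_posSemidef.1 (CFC.sqrt_nonneg A)).1
  rwa [Matrix.IsHermitian, Matrix.conjTranspose_eq_transpose_of_trivial] at this

lemma sqrtM {L : ℝ} (hL : 1 ≤ L) {A : Matrix (Fin d) (Fin d) ℝ} (h : Ell L A) :
    ∃ T : Eu d ≃L[ℝ] Eu d, (∀ z, ‖T z‖ ≤ √L * ‖z‖) ∧ (∀ z, ‖T.symm z‖ ≤ √L * ‖z‖) ∧
      ∀ B : Bil d, ∑ i, B (T (eb i)) (T (eb i)) = trM A B := by
  have hL0 : 0 < L := by linarith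
  obtain ⟨C, hCs, hC⟩ := sqA h.1 (fun z => le_trans (by positivity) (h.2 z).1)
  have ap : ∀ (z : Eu d) i, Matrix.toEuclideanLin C z i = ∑ j, C i j * z j := by
    intro z i; simp [Matrix.toLpLin_apply, Matrix.mulVec, dotProduct]
  have hA : ∀ i j, A i j = ∑ k, C k i * C k j := by
    intro i j
    rw [← hC, Matrix.mul_apply]
    exact Finset.sum_congr rfl fun k _ => by rw [hCs.apply]
  have nq : ∀ z : Eu d, ‖Matrix.toEuclideanLin C z‖ ^ 2 = quadForm A z := by
    intro z
    rw [EuclideanSpace.norm_sq_eq]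
    simp only [ap, Real.norm_eq_abs, sq_abs]
    simp only [quadForm, hA, sq, Finset.mul_sum, Finset.sum_mul]
    rw [Finset.sum_comm]
    refine Finset.sum_congr rfl fun i _ => ?_
    rw [Finset.sum_comm]
    refine Finset.sum_congr rfl fun j _ => ?_
    exact Finset.sum_congr rfl fun k _ => by ring
  have inj : Function.Injective (Matrix.toEuclideanLin C) := by
    rw [← LinearMap.ker_eq_bot, LinearMap.ker_eq_bot']
    intro z hz
    have h1 := nq z
    have h2 := (h.2 z).1
    rw [← h1, hz] at h2
    by_contra hne
    have : 0 < L⁻¹ * ‖z‖ ^ 2 := by have := norm_pos_iff.2 hne; positivity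
    simp at h2; linarith
  let T := (LinearEquiv.ofInjectiveEndo (Matrix.toEuclideanLin C) inj).toContinuousLinearEquiv
  have Tv : ∀ z, T z = Matrix.toEuclideanLin C z := fun z => rfl
  have up : ∀ z, ‖T z‖ ^ 2 ≤ L * ‖z‖ ^ 2 := fun z => by rw [Tv, nq]; exact (h.2 z).2
  have lo : ∀ z, ‖z‖ ^ 2 ≤ L * ‖T z‖ ^ 2 := fun z => by
    have := (h.2 z).1
    rw [← nq, ← Tv, inv_mul_le_iff₀ hL0] at this; exact this
  refine ⟨T, fun z => ?_, fun z => ?_, fun B => ?_⟩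
  · refine (abs_le_of_sq_le_sq' ?_ (by positivity)).2
    rw [mul_pow, Real.sq_sqrt hL0.le]; exact up z
  · refine (abs_le_of_sq_le_sq' ?_ (by positivity)).2
    rw [mul_pow, Real.sq_sqrt hL0.le]; simpa using lo (T.symm z)
  · have Te : ∀ i, T (eb i) = ∑ k, C k i • eb k := by
      intro i
      ext j
      rw [Tv, ap]; simp [Finset.sum_apply, eb, Pi.single_apply]
    simp only [Te, map_sum, map_smul, sum_apply, smul_apply, smul_eq_mul, trM]
    have hA2 : ∀ i j, A i j = ∑ k, C i k * C j k := by
      intro i j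
      rw [← hC, Matrix.mul_apply]
      exact Finset.sum_congr rfl fun k _ => by rw [hCs.apply j k]
    simp only [hA2, Finset.sum_mul, Finset.mul_sum]
    rw [Finset.sum_comm]
    conv_rhs => rw [Finset.sum_comm]
    refine Finset.sum_congr rfl fun i _ => ?_
    rw [Finset.sum_comm]
    refine Finset.sum_congr rfl fun j _ => ?_
    exact Finset.sum_congr rfl fun k _ => by ring

lemma core_g {a : Eu d → Matrix (Fin d) (Fin d) ℝ} {u : Eu d → ℝ} {x p q : Eu d}
    {s k N F0 L1 : ℝ} (hs : 0 < s) (hk : 0 < k) (hk1 : k ≤ 1/3) (hN : 0 ≤ N) (hL1 : 0 ≤ L1)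
    (hp : ‖p - x‖ ≤ k ^ 2 * s ^ 2) (hq : ‖q - x‖ ≤ k ^ 2 * s ^ 2)
    (ha1 : ∀ i j, |a p i j - a q i j| ≤ ‖p - q‖ / s ^ 2)
    (ha2 : ∀ i j, |a q i j - a x i j| ≤ ‖q - x‖ / s ^ 2)
    (hf : |trM (a p) (Hs u p) - trM (a q) (Hs u q)| ≤ F0 / s ^ 5 * √‖p - q‖ + L1 / s ^ 6 * ‖p - q‖)
    (hN1 : ‖Hs u p‖ ≤ 2 * N / s ^ 4) (hN2 : ‖Hs u p - Hs u q‖ ≤ 4 * N / s ^ 5 * √‖p - q‖) :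
    |trM (a x) (Hs u p) - trM (a x) (Hs u q)| ≤
      (F0 + 2 * k * L1 + 8 * d ^ 2 * k * N) / s ^ 5 * √‖p - q‖ := by
  set t := √‖p - q‖ with ht
  have t0 : 0 ≤ t := Real.sqrt_nonneg _
  have tt : ‖p - q‖ = t ^ 2 := (Real.sq_sqrt (norm_nonneg _)).symm
  have tk : t ≤ 2 * k * s := by
    refine abs_le_of_sq_le_sq' ?_ (by positivity) |>.2
    rw [← tt]
    have : ‖p - q‖ ≤ ‖p - x‖ + ‖q - x‖ := by
      have := norm_sub_le (p - x) (q - x); simpa using this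
    nlinarith [sq_nonneg (k * s)]
  have e1 := trM_bd (A := a p - a q) ha1 (Hs u p)
  have e2 := trM_bd (A := a q - a x) (c := k ^ 2) (fun i j => (ha2 i j).trans (by
    rw [div_le_iff₀ (by positivity)]; exact hq)) (Hs u p - Hs u q)
  have key : trM (a x) (Hs u p) - trM (a x) (Hs u q) =
      (trM (a p) (Hs u p) - trM (a q) (Hs u q)) - trM (a p - a q) (Hs u p)
        - trM (a q - a x) (Hs u p - Hs u q) := by
    simp only [trM_sub_left, trM_sub_right]; ring
  have b1 : L1 / s ^ 6 * t ^ 2 ≤ 2 * k * L1 / s ^ 5 * t := by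
    calc L1 / s ^ 6 * t ^ 2 = L1 / s ^ 6 * t * t := by ring
      _ ≤ L1 / s ^ 6 * t * (2 * k * s) := by gcongr
      _ = _ := by field_simp
  have b2 : d ^ 2 * (t ^ 2 / s ^ 2) * ‖Hs u p‖ ≤ 4 * d ^ 2 * k * N / s ^ 5 * t := by
    calc d ^ 2 * (t ^ 2 / s ^ 2) * ‖Hs u p‖ ≤ d ^ 2 * (t ^ 2 / s ^ 2) * (2 * N / s ^ 4) := by gcongr
      _ = 2 * d ^ 2 * N / s ^ 6 * t * t := by field_simp
      _ ≤ 2 * d ^ 2 * N / s ^ 6 * t * (2 * k * s) := by gcongr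
      _ = _ := by field_simp; ring
  have b3 : d ^ 2 * k ^ 2 * ‖Hs u p - Hs u q‖ ≤ 4 * d ^ 2 * k * N / s ^ 5 * t := by
    have hkk : k ^ 2 ≤ k := by nlinarith
    calc d ^ 2 * k ^ 2 * ‖Hs u p - Hs u q‖ ≤ d ^ 2 * k * (4 * N / s ^ 5 * t) := by gcongr
      _ = _ := by ring
  rw [tt] at hf e1
  have : (F0 + 2 * k * L1 + 8 * d ^ 2 * k * N) / s ^ 5 * t = F0 / s ^ 5 * t + 2 * k * L1 / s ^ 5 * t
    + 4 * d ^ 2 * k * N / s ^ 5 * t + 4 * d ^ 2 * k * N / s ^ 5 * t := by ring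
  rw [key, this]
  have h1 := abs_sub ((trM (a p) (Hs u p) - trM (a q) (Hs u q)) - trM (a p - a q) (Hs u p))
    (trM (a q - a x) (Hs u p - Hs u q))
  have h2 := abs_sub (trM (a p) (Hs u p) - trM (a q) (Hs u q)) (trM (a p - a q) (Hs u p))
  linarith

lemma Hs_comp {u : Eu d → ℝ} (hu : ContDiff ℝ 2 u) (T : Eu d →L[ℝ] Eu d) (x y h k : Eu d) :
    Hs (fun y => u (x + T y)) y h k = Hs u (x + T y) (T h) (T k) := by
  have hT : ∀ y, HasFDerivAt (fun y => x + T y) T y := fun y => (T.hasFDerivAt).const_add x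
  have h1 : fderiv ℝ (fun y => u (x + T y)) = fun y => (fderiv ℝ u (x + T y)).comp T := by
    funext y
    exact ((c2_d1 hu (x + T y)).comp y (hT y)).fderiv
  have h2 := (((c2_d2 hu (x + T y)).comp y (hT y)).clm_comp (hasFDerivAt_const T y))
  unfold Hs
  rw [h1]
  have h3 := h2.fderiv
  simp only [Function.comp_def] at h3
  rw [h3]
  simp [Hs]

lemma D_comp {u : Eu d → ℝ} (hu : ContDiff ℝ 2 u) (T : Eu d →L[ℝ] Eu d) (x y h : Eu d) :
    fderiv ℝ (fun y => u (x + T y)) y h = fderiv ℝ u (x + T y) (T h) := by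
  have hT : HasFDerivAt (fun y => x + T y) T y := (T.hasFDerivAt).const_add x
  have := ((c2_d1 hu (x + T y)).comp y hT).fderiv
  simp only [Function.comp_def] at this
  rw [this]; rfl

lemma absorb {P : ℝ → Prop} (mono : ∀ N N', N ≤ N' → P N → P N')
    (cl : ∀ N, (∀ ε > 0, P (N + ε)) → P N) {Q : ℝ} (hQ : 0 ≤ Q) (h0 : ∃ N ≥ 0, P N)
    (step : ∀ N ≥ 0, P N → P (N / 2 + Q)) : P (2 * Q) := by
  obtain ⟨N0, hN0, h0⟩ := h0
  have h : ∀ n : ℕ, P (2 * Q + N0 / 2 ^ n) := by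
    intro n
    induction n with
    | zero => exact mono _ _ (by simp; linarith) h0
    | succ n ih =>
      have := step _ (by positivity) ih
      refine mono _ _ (le_of_eq ?_) this
      rw [pow_succ]; field_simp; ring
  refine cl _ fun ε hε => ?_
  obtain ⟨n, hn⟩ := pow_unbounded_of_one_lt (N0 / ε) (one_lt_two)
  refine mono _ _ ?_ (h n)
  have : N0 / 2 ^ n ≤ ε := by
    rw [div_le_iff₀ (by positivity)]; rw [div_lt_iff₀ hε] at hn; linarith
  linarith
end

open Metric Set MeasureTheory
noncomputable section
variable {d : ℕ}

lemma core {A : Matrix (Fin d) (Fin d) ℝ} {u : Eu d → ℝ} (hu : ContDiff ℝ 2 u) {x : Eu d}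
    {s k m Q L : ℝ} (hL : 1 ≤ L) (hA : Ell L A) (hs : 0 < s) (hk : 0 < k) (hQ : 0 ≤ Q)
    (hm : ∀ p, ‖p - x‖ ≤ k ^ 2 * s ^ 2 → |u p - u x| ≤ m)
    (hg : ∀ p q, ‖p - x‖ ≤ k ^ 2 * s ^ 2 → ‖q - x‖ ≤ k ^ 2 * s ^ 2 →
      |trM A (Hs u p) - trM A (Hs u q)| ≤ Q / s ^ 5 * √‖p - q‖) :
    s ^ 4 * ‖Hs u x‖ ≤ 18 * KV d * √L ^ 4 * (m / k ^ 4 + k * Q) ∧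
    ∀ p, ‖p - x‖ ≤ k ^ 2 * s ^ 2 / (4 * √L ^ 2) →
      s ^ 5 * ‖Hs u p - Hs u x‖ ≤ 54 * KV d * √L ^ 6 * (m / k ^ 5 + Q) * √‖p - x‖ := by
  obtain ⟨T, T1, T2, T3⟩ := sqrtM hL hA
  set S := √L with hS
  have S1 : 1 ≤ S := by rw [hS]; exact Real.one_le_sqrt.2 hL
  have S0 : 0 < S := by linarith
  have hK := KV_nn (d := d)
  have m0 : 0 ≤ m := (abs_nonneg _).trans (hm x (by simp; positivity))
  set v : Eu d → ℝ := fun y => u (x + T y) with hv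
  have cv : ContDiff ℝ 2 v := by
    have : ContDiff ℝ 2 (fun y => x + T y) := contDiff_const.add T.contDiff
    exact hu.comp this
  have vH : ∀ y e, Hs v y (T.symm e) (T.symm e) = Hs u (x + T y) e e := by
    intro y e
    have := Hs_comp hu (T : Eu d →L[ℝ] Eu d) x y (T.symm e) (T.symm e)
    simpa using this
  have vL : ∀ y, Lap v y = trM A (Hs u (x + T y)) := by
    intro y
    rw [← T3]
    exact Finset.sum_congr rfl fun i _ => by
      simpa using Hs_comp hu (T : Eu d →L[ℝ] Eu d) x y (eb i) (eb i)
  set r := k ^ 2 * s ^ 2 / S with hr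
  have r0 : 0 < r := by positivity
  have rin : ∀ y, ‖y‖ ≤ r → ‖x + T y - x‖ ≤ k ^ 2 * s ^ 2 := by
    intro y hy
    rw [add_sub_cancel_left]
    refine (T1 y).trans ?_
    rw [hr, le_div_iff₀ S0] at hy; linarith
  have sS : √S ≤ S := by
    rw [Real.sqrt_le_left S0.le]; nlinarith
  have hω : ∀ y, ‖y‖ ≤ r → |v y - v 0| ≤ m := by
    intro y hy
    have := hm _ (rin y hy)
    simpa [hv] using this
  have hH : ∀ y z, ‖y‖ ≤ r → ‖z‖ ≤ r → |Lap v y - Lap v z| ≤ S * Q / s ^ 5 * √‖y - z‖ := by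
    intro y z hy hz
    rw [vL, vL]
    refine (hg _ _ (rin y hy) (rin z hz)).trans ?_
    have : √‖x + T y - (x + T z)‖ ≤ S * √‖y - z‖ := by
      calc √‖x + T y - (x + T z)‖ = √‖T (y - z)‖ := by simp
        _ ≤ √(S * ‖y - z‖) := Real.sqrt_le_sqrt (T1 _)
        _ = √S * √‖y - z‖ := Real.sqrt_mul S0.le _
        _ ≤ _ := by gcongr
    calc _ ≤ Q / s ^ 5 * (S * √‖y - z‖) := by gcongr
      _ = _ := by ring
  have H0 : 0 ≤ S * Q / s ^ 5 := by positivity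
  constructor
  · have h1 := E0a cv r0 H0 hω (fun y hy => by simpa using hH y 0 hy (by simpa using r0.le))
    have rk : √r ≤ k * s := by
      rw [Real.sqrt_le_left (by positivity), hr, div_le_iff₀ S0]; nlinarith [sq_nonneg (k*s)]
    have h2 : ∀ e, |Hs u x e e| ≤ (9 * KV d * S ^ 4 * (m / k ^ 4 + k * Q)) / s ^ 4 * ‖e‖ ^ 2 := by
      intro e
      have h3 := h1 (T.symm e)
      rw [vH] at h3
      simp only [map_zero, add_zero] at h3
      refine h3.trans ?_
      have e1 : m / r ^ 2 = S ^ 2 * (m / k ^ 4 / s ^ 4) := by rw [hr]; field_simp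
      have e2 : S * Q / s ^ 5 * √r ≤ S ^ 2 * (k * Q / s ^ 4) := by
        calc S * Q / s ^ 5 * √r ≤ S * Q / s ^ 5 * (k * s) := by gcongr
          _ = S * (k * Q / s ^ 4) := by field_simp
          _ ≤ _ := by
            have : S ≤ S ^ 2 := by nlinarith
            gcongr
      have e3 : ‖T.symm e‖ ^ 2 ≤ (S * ‖e‖) ^ 2 := by gcongr; exact T2 e
      rw [e1]
      calc _ ≤ 9 * KV d * (S ^ 2 * (m / k ^ 4 / s ^ 4) + S ^ 2 * (k * Q / s ^ 4)) * (S * ‖e‖) ^ 2 := by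
            gcongr
        _ = _ := by ring
    have h3 := polar (Hs_symm hu x) (by positivity) h2
    refine (mul_le_mul_of_nonneg_left h3 (by positivity : 0 ≤ s ^ 4)).trans (le_of_eq ?_)
    field_simp; ring
  · intro p hp
    set y := T.symm (p - x) with hy
    have xy : x + T y = p := by simp [hy]
    have ny : ‖y‖ ≤ S * ‖p - x‖ := T2 _
    have yr : ‖y‖ ≤ r / 4 := by
      refine ny.trans ?_
      calc S * ‖p - x‖ ≤ S * (k ^ 2 * s ^ 2 / (4 * S ^ 2)) := by gcongr
        _ = _ := by rw [hr]; field_simp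
    have h1 := fun e => E0b cv r0 H0 hω hH y e yr
    set t := √‖p - x‖ with ht
    have t0 : 0 ≤ t := Real.sqrt_nonneg _
    have tt : ‖p - x‖ = t ^ 2 := (Real.sq_sqrt (norm_nonneg _)).symm
    have tk : t ≤ k * s := by
      rw [ht, Real.sqrt_le_left (by positivity)]
      refine hp.trans ?_
      rw [div_le_iff₀ (by positivity)]
      nlinarith [sq_nonneg (k*s), sq_nonneg S, mul_nonneg (sq_nonneg (k*s)) (by nlinarith : 0 ≤ S^2 - 1)]
    have sy : √‖y‖ ≤ S * t := by
      calc √‖y‖ ≤ √(S * ‖p - x‖) := Real.sqrt_le_sqrt ny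
        _ = √S * t := Real.sqrt_mul S0.le _
        _ ≤ _ := by gcongr
    have h2 : ∀ e, |(Hs u p - Hs u x) e e| ≤
        (27 * KV d * S ^ 6 * (m / k ^ 5 + Q) * t) / s ^ 5 * ‖e‖ ^ 2 := by
      intro e
      have h3 := h1 (T.symm e)
      rw [vH, vH, xy] at h3
      simp only [map_zero, add_zero] at h3
      rw [sub_apply, sub_apply]
      refine h3.trans ?_
      have e1 : m * ‖y‖ / r ^ 3 ≤ S ^ 4 * (m / k ^ 5 * t / s ^ 5) := by
        calc m * ‖y‖ / r ^ 3 ≤ m * (S * (t * (k * s))) / r ^ 3 := by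
              gcongr
              refine ny.trans ?_
              rw [tt, sq]; gcongr
          _ = _ := by rw [hr]; field_simp
      have e2 : S * Q / s ^ 5 * √‖y‖ ≤ S ^ 4 * (Q * t / s ^ 5) := by
        calc S * Q / s ^ 5 * √‖y‖ ≤ S * Q / s ^ 5 * (S * t) := by gcongr
          _ = S ^ 2 * (Q * t / s ^ 5) := by ring
          _ ≤ _ := by
            have : S ^ 2 ≤ S ^ 4 := pow_le_pow_right₀ S1 (by norm_num)
            gcongr
      have e3 : ‖T.symm e‖ ^ 2 ≤ (S * ‖e‖) ^ 2 := by gcongr; exact T2 e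
      calc _ ≤ 27 * KV d * (S ^ 4 * (m / k ^ 5 * t / s ^ 5) + S ^ 4 * (Q * t / s ^ 5)) * (S * ‖e‖) ^ 2 := by
            gcongr
        _ = _ := by ring
    have h3 := polar (B := Hs u p - Hs u x) (fun h k => by
      simp only [sub_apply, Hs_symm hu p h k, Hs_symm hu x h k]) (by positivity) h2
    refine (mul_le_mul_of_nonneg_left h3 (by positivity : 0 ≤ s ^ 5)).trans (le_of_eq ?_)
    field_simp; ring

lemma bil_sub_le (A B : Bil d) : ‖A - B‖ ≤ ‖A‖ + ‖B‖ := norm_sub_le A B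

def GC (d : ℕ) (L : ℝ) : ℝ := 180 * KV d * √L ^ 6

lemma GC_nn (d : ℕ) (L : ℝ) : 0 ≤ GC d L := by
  have := KV_nn (d := d)
  unfold GC; positivity

def PN (u : Eu d → ℝ) (x0 : Eu d) (R N : ℝ) : Prop :=
  ∀ x s, 0 < s → s ^ 2 = R - ‖x - x0‖ → s ^ 4 * ‖Hs u x‖ ≤ N ∧
    ∀ y, ‖y - x‖ ≤ s ^ 2 / 2 → s ^ 5 * ‖Hs u y - Hs u x‖ ≤ N * √‖y - x‖

lemma PN_mono {u : Eu d → ℝ} {x0 : Eu d} {R N N' : ℝ} (h : N ≤ N') (hp : PN u x0 R N) :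
    PN u x0 R N' := fun x s hs e =>
  ⟨(hp x s hs e).1.trans h, fun y hy => ((hp x s hs e).2 y hy).trans (by gcongr)⟩

lemma PN_cl {u : Eu d → ℝ} {x0 : Eu d} {R N : ℝ} (h : ∀ ε > 0, PN u x0 R (N + ε)) :
    PN u x0 R N := by
  intro x s hs e
  refine ⟨le_of_forall_pos_le_add fun ε hε => (h ε hε x s hs e).1, fun y hy => ?_⟩
  have : Filter.Tendsto (fun ε => (N + ε) * √‖y - x‖) (nhdsWithin 0 (Ioi 0))
      (nhds ((N + 0) * √‖y - x‖)) := by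
    apply Filter.Tendsto.mono_left _ nhdsWithin_le_nhds
    exact (Continuous.tendsto (by fun_prop) 0)
  rw [add_zero] at this
  refine ge_of_tendsto this ?_
  filter_upwards [self_mem_nhdsWithin] with ε hε
  exact (h ε hε x s hs e).2 y hy

set_option maxHeartbeats 1600000 in
/-- interior Schauder estimate -/
theorem schauder {a : Eu d → Matrix (Fin d) (Fin d) ℝ} {u : Eu d → ℝ} (hu : ContDiff ℝ 2 u)
    {x0 : Eu d} {R K L m F0 L1 k : ℝ} (hL : 1 ≤ L) (hKR : K * R ≤ 1)
    (hE : ∀ x ∈ ball x0 R, Ell L (a x))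
    (ha : ∀ x ∈ ball x0 R, ∀ y ∈ ball x0 R, ∀ i j, |a x i j - a y i j| ≤ K * ‖x - y‖)
    (hm : ∀ x ∈ ball x0 R, ∀ y ∈ ball x0 R, |u x - u y| ≤ m) (hm0 : 0 ≤ m)
    (hF0 : 0 ≤ F0) (hL1 : 0 ≤ L1)
    (hf : ∀ x s, 0 < s → s ^ 2 = R - ‖x - x0‖ → ∀ p q, ‖p - x‖ ≤ s ^ 2 / 4 → ‖q - x‖ ≤ s ^ 2 / 4 →
      |trM (a p) (Hs u p) - trM (a q) (Hs u q)| ≤ F0 / s ^ 5 * √‖p - q‖ + L1 / s ^ 6 * ‖p - q‖)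
    (h0 : ∃ N ≥ 0, PN u x0 R N)
    (hk : 0 < k) (hk1 : k ≤ 1 / 3) (hkG : 16 * d ^ 2 * GC d L * k ≤ 1) :
    PN u x0 R (2 * (GC d L * (m / k ^ 5 + F0 + 2 * k * L1))) := by
  have hG := GC_nn d L
  have hK := KV_nn (d := d)
  have S1 : 1 ≤ √L := Real.one_le_sqrt.2 hL
  have S0 : 0 < √L := by linarith
  refine absorb (P := PN u x0 R) (fun _ _ h => PN_mono h) (fun _ => PN_cl) (by positivity) h0 ?_
  intro N hN hP
  -- geometry
  have geo : ∀ x s, 0 < s → s ^ 2 = R - ‖x - x0‖ → ∀ p, ‖p - x‖ ≤ s ^ 2 / 2 →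
      p ∈ ball x0 R ∧ s ^ 2 - ‖p - x‖ ≤ R - ‖p - x0‖ := by
    intro x s hs e p hp
    have h1 : ‖p - x0‖ ≤ ‖p - x‖ + ‖x - x0‖ := by
      have := norm_add_le (p - x) (x - x0); simpa using this
    have : 0 < s ^ 2 := by positivity
    refine ⟨by rw [mem_ball_iff_norm]; linarith, by linarith⟩
  set Q := F0 + 2 * k * L1 + 8 * d ^ 2 * k * N with hQ
  have Q0 : 0 ≤ Q := by positivity
  have k2 : k ^ 2 ≤ 1 / 9 := by nlinarith
  have C := fun x s (hs : 0 < s) (e : s ^ 2 = R - ‖x - x0‖) => by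
    have xb : x ∈ ball x0 R := (geo x s hs e x (by simp; positivity)).1
    have ks : k ^ 2 * s ^ 2 ≤ s ^ 2 / 9 := by linarith [mul_le_mul_of_nonneg_right k2 (sq_nonneg s)]
    have inb : ∀ p, ‖p - x‖ ≤ k ^ 2 * s ^ 2 → p ∈ ball x0 R := fun p hp =>
      (geo x s hs e p (by linarith [sq_nonneg s])).1
    have Ks : K ≤ 1 / s ^ 2 := by
      rw [le_div_iff₀ (by positivity)]
      by_cases hK0 : 0 ≤ K
      · have := mul_nonneg hK0 (norm_nonneg (x - x0))
        rw [e]; linarith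
      · linarith [mul_nonneg (neg_nonneg.2 (not_le.1 hK0).le) (sq_nonneg s)]
    have al : ∀ p q, p ∈ ball x0 R → q ∈ ball x0 R → ∀ i j, |a p i j - a q i j| ≤ ‖p - q‖ / s ^ 2 := by
      intro p q hp hq i j
      refine (ha p hp q hq i j).trans ?_
      calc K * ‖p - q‖ ≤ 1 / s ^ 2 * ‖p - q‖ := by gcongr
        _ = _ := by ring
    exact core hu hL (hE x xb) hs hk Q0 (m := m) (fun p hp => hm p (inb p hp) x xb) (by
      intro p q hp hq
      have gp := (geo x s hs e p (by linarith [sq_nonneg s])).2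
      have pos : 0 < R - ‖p - x0‖ := by linarith [sq_pos_of_pos hs]
      obtain ⟨σ, σ0, σ2⟩ : ∃ σ, 0 < σ ∧ σ ^ 2 = R - ‖p - x0‖ :=
        ⟨_, Real.sqrt_pos.2 pos, Real.sq_sqrt pos.le⟩
      have σs : 8 / 9 * s ^ 2 ≤ σ ^ 2 := by linarith
      have σs1 : 9 / 10 * s ≤ σ := by
        refine (abs_le_of_sq_le_sq' ?_ σ0.le).2
        rw [mul_pow]; linarith [sq_nonneg s]
      have b4 : s ^ 4 ≤ 2 * σ ^ 4 := by
        have : (9 / 10 * s) ^ 4 ≤ σ ^ 4 := by gcongr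
        rw [mul_pow] at this; linarith [pow_pos hs 4]
      have b5 : s ^ 5 ≤ 4 * σ ^ 5 := by
        have : (9 / 10 * s) ^ 5 ≤ σ ^ 5 := by gcongr
        rw [mul_pow] at this; linarith [pow_pos hs 5]
      obtain ⟨P1, P2⟩ := hP p σ σ0 σ2
      have tri : ‖q - p‖ ≤ ‖q - x‖ + ‖p - x‖ := by
        have := norm_sub_le (q - x) (p - x); simpa using this
      have P3 := P2 q (by linarith)
      refine core_g hs hk hk1 hN hL1 hp hq (al p q (inb p hp) (inb q hq))
        (al q x (inb q hq) xb) (hf x s hs e p q (by linarith [sq_nonneg s]) (by linarith [sq_nonneg s])) ?_ ?_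
      · rw [le_div_iff₀ (by positivity)]
        linarith [mul_le_mul_of_nonneg_right b4 (norm_nonneg (Hs u p))]
      · rw [norm_sub_rev (Hs u p), norm_sub_rev p q, div_mul_eq_mul_div, le_div_iff₀ (by positivity)]
        linarith [mul_le_mul_of_nonneg_right b5 (norm_nonneg (Hs u q - Hs u p))])
  -- coarse constants
  set G := GC d L with hGd
  have GS : 180 * KV d * √L ^ 6 = G := rfl
  have S46 : √L ^ 5 ≤ √L ^ 6 := pow_le_pow_right₀ S1 (by norm_num)
  have S45 : √L ^ 4 ≤ √L ^ 6 := pow_le_pow_right₀ S1 (by norm_num)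
  set X := m / k ^ 5 + Q with hX
  have X0 : 0 ≤ X := by positivity
  have fin : G * X ≤ N / 2 + G * (m / k ^ 5 + F0 + 2 * k * L1) := by
    have : G * (8 * d ^ 2 * k * N) ≤ N / 2 := by linarith [mul_le_mul_of_nonneg_right hkG hN]
    rw [hX, hQ]; linarith
  have kX : m / k ^ 4 + k * Q = k * X := by rw [hX]; field_simp
  refine PN_mono fin ?_
  intro x s hs e
  obtain ⟨c1, c2⟩ := C x s hs e
  rw [kX] at c1
  have k1 : k ≤ 1 := by linarith
  constructor
  · refine c1.trans ?_
    rw [← GS]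
    calc 18 * KV d * √L ^ 4 * (k * X) ≤ 180 * KV d * √L ^ 6 * (1 * X) := by gcongr; norm_num
      _ = _ := by ring
  · intro y hy
    rcases le_total ‖y - x‖ (k ^ 2 * s ^ 2 / (4 * √L ^ 2)) with hyk | hyk
    · refine (c2 y hyk).trans ?_
      rw [← GS]
      gcongr; norm_num
    · have gy := (geo x s hs e y hy).2
      have pos : 0 < R - ‖y - x0‖ := by linarith [sq_pos_of_pos hs]
      obtain ⟨σ, σ0, σ2⟩ : ∃ σ, 0 < σ ∧ σ ^ 2 = R - ‖y - x0‖ :=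
        ⟨_, Real.sqrt_pos.2 pos, Real.sq_sqrt pos.le⟩
      have σs : s ^ 2 / 2 ≤ σ ^ 2 := by linarith
      have b4 : s ^ 4 ≤ 4 * σ ^ 4 := by
        have : (s ^ 2 / 2) ^ 2 ≤ (σ ^ 2) ^ 2 := by gcongr
        linarith
      have c3 := (C y σ σ0 σ2).1
      rw [kX] at c3
      set t := √‖y - x‖ with ht
      have st : k * s ≤ 2 * √L * t := by
        have : (k * s) / (2 * √L) ≤ t := by
          rw [ht]; apply Real.le_sqrt_of_sq_le
          refine le_trans (le_of_eq ?_) hyk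
          field_simp; ring
        rw [div_le_iff₀ (by positivity)] at this; linarith
      have c4 : s ^ 4 * ‖Hs u y‖ ≤ 4 * (18 * KV d * √L ^ 4 * (k * X)) := by
        linarith [mul_le_mul_of_nonneg_right b4 (norm_nonneg (Hs u y))]
      calc s ^ 5 * ‖Hs u y - Hs u x‖ ≤ s ^ 5 * (‖Hs u y‖ + ‖Hs u x‖) := by gcongr; exact bil_sub_le _ _
        _ = s * (s ^ 4 * ‖Hs u y‖ + s ^ 4 * ‖Hs u x‖) := by ring
        _ ≤ s * (4 * (18 * KV d * √L ^ 4 * (k * X)) + 18 * KV d * √L ^ 4 * (k * X)) := by gcongr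
        _ = 90 * KV d * √L ^ 4 * X * (k * s) := by ring
        _ ≤ 90 * KV d * √L ^ 4 * X * (2 * √L * t) := by gcongr
        _ = 180 * KV d * √L ^ 5 * X * t := by ring
        _ ≤ 180 * KV d * √L ^ 6 * X * t := by gcongr
end

open Metric Set MeasureTheory
noncomputable section
variable {d : ℕ}

instance iB1 : NormedAddCommGroup (Eu d →L[ℝ] Eu d →L[ℝ] ℝ) := ContinuousLinearMap.toNormedAddCommGroup
instance iB2 : SeminormedAddGroup (Eu d →L[ℝ] Eu d →L[ℝ] ℝ) :=
  ContinuousLinearMap.toNormedAddCommGroup.toSeminormedAddCommGroup.toSeminormedAddGroup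
instance iB3 : ContinuousSub (Eu d →L[ℝ] Eu d →L[ℝ] ℝ) := inferInstance

def GB (M : ℝ) (u : Eu d → ℝ) : Prop := ContDiff ℝ 2 u ∧ ∀ x, |u x| ≤ M ∧ ‖fderiv ℝ u x‖ ≤ M ∧
  ‖Hs u x‖ ≤ M ∧ ∀ y, ‖Hs u y - Hs u x‖ ≤ M * √‖y - x‖

def LB (R M : ℝ) (u : Eu d → ℝ) : Prop := ∀ x y, ‖x‖ < R → ‖y‖ < R → |u x| ≤ M ∧
  ‖fderiv ℝ u x‖ ≤ M ∧ ‖Hs u x‖ ≤ M ∧ ‖Hs u y - Hs u x‖ ≤ M * √‖y - x‖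

def Coef (L K : ℝ) (a : Eu d → Matrix (Fin d) (Fin d) ℝ) : Prop :=
  (∀ x, Ell L (a x)) ∧ ∀ x y i j, |a x i j - a y i j| ≤ K * ‖x - y‖

lemma grad_interp {u : Eu d → ℝ} (hu : ContDiff ℝ 2 u) {x : Eu d} {ρ M m : ℝ} (hρ : 0 < ρ)
    (hM : ∀ y, ‖y - x‖ ≤ ρ → ‖Hs u y‖ ≤ M) (hm : ∀ y, ‖y - x‖ ≤ ρ → |u y - u x| ≤ m) :
    ‖fderiv ℝ u x‖ ≤ m / ρ + ρ * M / 2 := by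
  have M0 : 0 ≤ M := (norm_nonneg _).trans (hM x (by simp; exact hρ.le))
  have m0 : 0 ≤ m := (abs_nonneg _).trans (hm x (by simp; exact hρ.le))
  refine ContinuousLinearMap.opNorm_le_bound _ (by positivity) fun e => ?_
  rcases eq_or_ne e 0 with rfl | he
  · simp
  have pe : 0 < ‖e‖ := norm_pos_iff.2 he
  set c := ρ / ‖e‖ with hc
  have c0 : 0 < c := by positivity
  have nh : ‖c • e‖ = ρ := by rw [norm_smul, Real.norm_of_nonneg c0.le, hc]; field_simp
  have h1 := taylor1 hu x (c • e) (M := M * ρ ^ 2) (B := 0) (by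
    intro t ht
    simp only [zero_apply, sub_zero]
    have := (Hs u (x + t • c • e)).le_opNorm₂ (c • e) (c • e)
    rw [nh] at this
    refine this.trans ?_
    have h2 := hM (x + t • c • e) (by
      rw [add_sub_cancel_left, norm_smul, nh, Real.norm_of_nonneg ht.1]; nlinarith [ht.2])
    calc ‖Hs u (x + t • c • e)‖ * ρ * ρ ≤ M * ρ * ρ := by gcongr
      _ = _ := by ring)
  have h2 := hm (x + c • e) (by simp [nh])
  simp only [zero_apply, map_smul, smul_eq_mul, smul_zero, mul_zero, zero_div, sub_zero] at h1
  have h3 : c * |fderiv ℝ u x e| ≤ m + M * ρ ^ 2 / 2 := by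
    rw [← abs_of_pos c0, ← abs_mul]
    rw [abs_le] at *
    constructor <;> linarith [h1.1, h1.2, h2.1, h2.2]
  rw [Real.norm_eq_abs]
  have : |fderiv ℝ u x e| = (c * |fderiv ℝ u x e|) / c := by field_simp
  rw [this, div_le_iff₀ c0]
  refine h3.trans (le_of_eq ?_)
  rw [hc]; field_simp

lemma lipU {u : Eu d → ℝ} (hu : ContDiff ℝ 2 u) {M : ℝ} {x y : Eu d}
    (h : ∀ z ∈ segment ℝ x y, ‖fderiv ℝ u z‖ ≤ M) : |u y - u x| ≤ M * ‖y - x‖ :=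
  (convex_segment x y).norm_image_sub_le_of_norm_hasFDerivWithin_le
    (fun z _ => (c2_d1 hu z).hasFDerivWithinAt) h (left_mem_segment _ _ _) (right_mem_segment _ _ _)

lemma lipDu {u : Eu d → ℝ} (hu : ContDiff ℝ 2 u) {M : ℝ} {x y : Eu d}
    (h : ∀ z ∈ segment ℝ x y, ‖Hs u z‖ ≤ M) : ‖fderiv ℝ u y - fderiv ℝ u x‖ ≤ M * ‖y - x‖ :=
  (convex_segment x y).norm_image_sub_le_of_norm_hasFDerivWithin_le
    (fun z _ => (c2_d2 hu z).hasFDerivWithinAt) h (left_mem_segment _ _ _) (right_mem_segment _ _ _)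

lemma tayU {u : Eu d → ℝ} (hu : ContDiff ℝ 2 u) {M : ℝ} {x y : Eu d}
    (h : ∀ z ∈ segment ℝ x y, ‖Hs u z‖ ≤ M) :
    ‖u y - u x - fderiv ℝ u x (y - x)‖ ≤ M * ‖y - x‖ * ‖y - x‖ := by
  have h1 : ∀ z ∈ segment ℝ x y, ‖fderiv ℝ u z - fderiv ℝ u x‖ ≤ M * ‖y - x‖ := by
    intro z hz
    have M0 : 0 ≤ M := (norm_nonneg (Hs u z)).trans (h z hz)
    have hs : segment ℝ x z ⊆ segment ℝ x y :=
      (convex_segment x y).segment_subset (left_mem_segment ℝ x y) hz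
    refine (lipDu hu (x := x) (y := z) (M := M) fun w hw => h w (hs hw)).trans ?_
    exact mul_le_mul_of_nonneg_left (norm_sub_le_of_mem_segment hz) M0
  exact (convex_segment x y).norm_image_sub_le_of_norm_hasFDerivWithin_le'
    (fun z _ => (c2_d1 hu z).hasFDerivWithinAt) h1 (left_mem_segment _ _ _) (right_mem_segment _ _ _)

lemma tayDu {u : Eu d → ℝ} (hu : ContDiff ℝ 2 u) {M : ℝ} (hM : 0 ≤ M) {x y : Eu d}
    (h : ∀ z ∈ segment ℝ x y, ‖Hs u z - Hs u x‖ ≤ M * √‖z - x‖) :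
    ‖fderiv ℝ u y - fderiv ℝ u x - Hs u x (y - x)‖ ≤ M * √‖y - x‖ * ‖y - x‖ :=
  (convex_segment x y).norm_image_sub_le_of_norm_hasFDerivWithin_le'
    (fun z _ => (c2_d2 hu z).hasFDerivWithinAt) (fun z hz => by
      refine (h z hz).trans ?_
      gcongr; exact norm_sub_le_of_mem_segment hz) (left_mem_segment _ _ _) (right_mem_segment _ _ _)

lemma ultra_lim {ι E : Type*} [NormedAddCommGroup E] [ProperSpace E] {U : Ultrafilter ι}
    {f : ι → E} {M : ℝ} (h : ∀ᶠ n in (U : Filter ι), ‖f n‖ ≤ M) :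
    ∃ l, Filter.Tendsto f U (nhds l) := by
  have := (isCompact_closedBall (0 : E) M).ultrafilter_le_nhds (U.map f) (by
    rw [Filter.le_principal_iff]
    exact Filter.mem_map.2 (h.mono fun n hn => by simpa using hn))
  obtain ⟨l, _, hl⟩ := this
  exact ⟨l, hl⟩

lemma hasF_of_bd {E F : Type*} [NormedAddCommGroup E] [NormedSpace ℝ E] [NormedAddCommGroup F]
    [NormedSpace ℝ F] {f : E → F} {A : E →L[ℝ] F} {x : E} {g : ℝ → ℝ} (hg : Continuous g) (g0 : g 0 = 0)
    {ρ : ℝ} (hρ : 0 < ρ)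
    (h : ∀ y, ‖y - x‖ < ρ → ‖f y - f x - A (y - x)‖ ≤ g ‖y - x‖ * ‖y - x‖) : HasFDerivAt f A x := by
  rw [hasFDerivAt_iff_isLittleO, Asymptotics.isLittleO_iff]
  intro c hc
  have : Filter.Tendsto (fun y => g ‖y - x‖) (nhds x) (nhds 0) := by
    have : Continuous fun y => g ‖y - x‖ := by fun_prop
    have := this.tendsto x
    simpa [g0] using this
  filter_upwards [this.eventually (gt_mem_nhds hc), Metric.ball_mem_nhds x hρ] with y h1 h2
  refine (h y (by simpa [dist_eq_norm] using h2)).trans ?_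
  gcongr

theorem compact_lim {ι : Type*} {U : Ultrafilter ι} {u : ι → Eu d → ℝ} (hu : ∀ n, ContDiff ℝ 2 (u n))
    (h : ∀ R, ∃ M, ∀ᶠ n in (U : Filter ι), LB R M (u n)) :
    ∃ v, ContDiff ℝ 2 v ∧ ∀ x, Filter.Tendsto (fun n => u n x) U (nhds (v x)) ∧
      Filter.Tendsto (fun n => fderiv ℝ (u n) x) U (nhds (fderiv ℝ v x)) ∧
      Filter.Tendsto (fun n => Hs (u n) x) U (nhds (Hs v x)) := by
  have h1 : ∀ x : Eu d, ‖x‖ < ‖x‖ + 1 := fun x => by linarith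
  have : ProperSpace (Eu d →L[ℝ] ℝ) := FiniteDimensional.proper ℝ _
  have : ProperSpace (Bil d) := FiniteDimensional.proper ℝ _
  have e0 : ∀ x, ∃ l, Filter.Tendsto (fun n => u n x) U (nhds l) := fun x => by
    obtain ⟨M, hM⟩ := h (‖x‖ + 1)
    exact ultra_lim (hM.mono fun n hn => (hn x x (h1 x) (h1 x)).1)
  have e1 : ∀ x, ∃ l, Filter.Tendsto (fun n => fderiv ℝ (u n) x) U (nhds l) := fun x => by
    obtain ⟨M, hM⟩ := h (‖x‖ + 1)
    exact ultra_lim (hM.mono fun n hn => (hn x x (h1 x) (h1 x)).2.1)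
  have e2 : ∀ x, ∃ l, Filter.Tendsto (fun n => Hs (u n) x) U (nhds l) := fun x => by
    obtain ⟨M, hM⟩ := h (‖x‖ + 1)
    exact ultra_lim (hM.mono fun n hn => (hn x x (h1 x) (h1 x)).2.2.1)
  choose v hv using e0
  choose g hg using e1
  choose B hB using e2
  have key : ∀ x, ∃ M, 0 ≤ M ∧ ∀ y, ‖y - x‖ < 1 →
      ‖v y - v x - g x (y - x)‖ ≤ M * ‖y - x‖ * ‖y - x‖ ∧
      ‖g y - g x - B x (y - x)‖ ≤ M * √‖y - x‖ * ‖y - x‖ ∧ ‖B y - B x‖ ≤ M * √‖y - x‖ := by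
    intro x
    obtain ⟨M, hM⟩ := h (‖x‖ + 1)
    obtain ⟨n, hn⟩ := hM.exists
    have M0 : 0 ≤ M := (abs_nonneg _).trans (hn x x (h1 x) (h1 x)).1
    refine ⟨M, M0, fun y hy => ?_⟩
    have hyR : ‖y‖ < ‖x‖ + 1 := by
      have := norm_add_le (y - x) x
      rw [sub_add_cancel] at this; linarith
    have seg : ∀ z ∈ segment ℝ x y, ‖z‖ < ‖x‖ + 1 := by
      intro z hz
      have := norm_sub_le_of_mem_segment hz
      have h2 := norm_add_le (z - x) x
      rw [sub_add_cancel] at h2; linarith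
    refine ⟨?_, ?_, ?_⟩
    · refine le_of_tendsto ((((hv y).sub (hv x)).sub (((ContinuousLinearMap.apply ℝ ℝ (y - x)).continuous.tendsto _).comp (hg x))).norm) ?_
      filter_upwards [hM] with n hn
      exact tayU (hu n) fun z hz => (hn z z (seg z hz) (seg z hz)).2.2.1
    · refine le_of_tendsto ((((hg y).sub (hg x)).sub (((ContinuousLinearMap.apply ℝ (Eu d →L[ℝ] ℝ) (y - x)).continuous.tendsto _).comp (hB x))).norm) ?_
      filter_upwards [hM] with n hn
      exact tayDu (hu n) M0 fun z hz => (hn x z (h1 x) (seg z hz)).2.2.2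
    · refine le_of_tendsto ((hB y).sub (hB x)).norm ?_
      filter_upwards [hM] with n hn
      exact (hn x y (h1 x) hyR).2.2.2
  choose M M0 key using key
  have dv : ∀ x, HasFDerivAt v (g x) x := fun x =>
    hasF_of_bd (g := fun t => M x * t) (by fun_prop) (by simp) one_pos fun y hy => (key x y hy).1
  have dg : ∀ x, HasFDerivAt g (B x) x := fun x =>
    hasF_of_bd (g := fun t => M x * √t) (by fun_prop) (by simp) one_pos fun y hy => (key x y hy).2.1
  have cB : Continuous B := by
    rw [continuous_iff_continuousAt]
    intro x
    rw [ContinuousAt, tendsto_iff_norm_sub_tendsto_zero]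
    have c : Filter.Tendsto (fun y => M x * √‖y - x‖) (nhds x) (nhds 0) := by
      have : Continuous fun y => M x * √‖y - x‖ := by fun_prop
      simpa using this.tendsto x
    refine squeeze_zero' (Filter.Eventually.of_forall fun _ => norm_nonneg _) ?_ c
    filter_upwards [Metric.ball_mem_nhds x one_pos] with y hy
    exact (key x y (by simpa [dist_eq_norm] using hy)).2.2
  have fv : fderiv ℝ v = g := funext fun x => (dv x).fderiv
  have fg : fderiv ℝ g = B := funext fun x => (dg x).fderiv
  refine ⟨v, ?_, fun x => ⟨hv x, by rw [fv]; exact hg x, by rw [Hs, fv, fg]; exact hB x⟩⟩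
  have c1 : ContDiff ℝ 1 g := contDiff_one_iff_fderiv.2 ⟨fun x => (dg x).differentiableAt, by rw [fg]; exact cB⟩
  have : ContDiff ℝ (1 + 1) v := contDiff_succ_iff_fderiv.2
    ⟨fun x => (dv x).differentiableAt, by simp, by rw [fv]; exact c1⟩
  simpa [one_add_one_eq_two] using this

lemma GB_LB {u : Eu d → ℝ} {M : ℝ} (h : GB M u) (R : ℝ) : LB R M u := fun x y _ _ =>
  ⟨(h.2 x).1, (h.2 x).2.1, (h.2 x).2.2.1, (h.2 x).2.2.2 y⟩

lemma GB_mono {u : Eu d → ℝ} {M M' : ℝ} (hM : M ≤ M') (h : GB M u) : GB M' u := ⟨h.1, fun x =>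
  ⟨(h.2 x).1.trans hM, (h.2 x).2.1.trans hM, (h.2 x).2.2.1.trans hM, fun y =>
    ((h.2 x).2.2.2 y).trans (by gcongr)⟩⟩

lemma GB_nn {u : Eu d → ℝ} {M : ℝ} (h : GB M u) : 0 ≤ M := (abs_nonneg _).trans (h.2 0).1

lemma compact_GB {ι : Type*} {U : Ultrafilter ι} {u : ι → Eu d → ℝ} {M : ℝ} (hu : ∀ n, GB M (u n)) :
    ∃ v, GB M v ∧ ∀ x, Filter.Tendsto (fun n => u n x) U (nhds (v x)) ∧
      Filter.Tendsto (fun n => fderiv ℝ (u n) x) U (nhds (fderiv ℝ v x)) ∧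
      Filter.Tendsto (fun n => Hs (u n) x) U (nhds (Hs v x)) := by
  obtain ⟨v, cv, hv⟩ := compact_lim (U := U) (fun n => (hu n).1)
    (fun R => ⟨M, Filter.Eventually.of_forall fun n => GB_LB (hu n) R⟩)
  refine ⟨v, ⟨cv, fun x => ⟨?_, ?_, ?_, fun y => ?_⟩⟩, hv⟩
  · exact le_of_tendsto (hv x).1.abs (Filter.Eventually.of_forall fun n => ((hu n).2 x).1)
  · exact le_of_tendsto (hv x).2.1.norm (Filter.Eventually.of_forall fun n => ((hu n).2 x).2.1)
  · exact le_of_tendsto (hv x).2.2.norm (Filter.Eventually.of_forall fun n => ((hu n).2 x).2.2.1)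
  · exact le_of_tendsto ((hv y).2.2.sub (hv x).2.2).norm
      (Filter.Eventually.of_forall fun n => ((hu n).2 x).2.2.2 y)

lemma PN_of_GB {u : Eu d → ℝ} {M R : ℝ} (h : GB M u) (hR : R ≤ 1) (x0 : Eu d) : PN u x0 R M := by
  intro x s hs e
  have s1 : s ≤ 1 := by nlinarith [norm_nonneg (x - x0)]
  have M0 := GB_nn h
  refine ⟨?_, fun y _ => ?_⟩
  · calc s ^ 4 * ‖Hs u x‖ ≤ 1 * M := by
          gcongr
          · exact pow_le_one₀ hs.le s1
          · exact (h.2 x).2.2.1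
      _ = M := one_mul _
  · calc s ^ 5 * ‖Hs u y - Hs u x‖ ≤ 1 * (M * √‖y - x‖) := by
          gcongr
          · exact pow_le_one₀ hs.le s1
          · exact (h.2 x).2.2.2 y
      _ = _ := one_mul _

theorem global_est (d : ℕ) {L K : ℝ} (hL : 1 ≤ L) (hK : 1 ≤ K) : ∃ C ≥ 0, ∀ η > 0, ∃ Cη ≥ 0,
    ∀ a : Eu d → Matrix (Fin d) (Fin d) ℝ, Coef L K a → ∀ (u : Eu d → ℝ) (F0 L1 m : ℝ),
    (∃ M, GB M u) → (∀ x, |u x| ≤ m) → 0 ≤ F0 → 0 ≤ L1 →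
    (∀ x y, |trM (a x) (Hs u x) - trM (a y) (Hs u y)| ≤ F0 * √‖x - y‖ + L1 * ‖x - y‖) →
    GB (C * F0 + Cη * m + η * L1) u := by
  have hG := GC_nn d L
  set G := GC d L with hGd
  refine ⟨8 * K ^ 3 * G, by positivity, fun η hη => ?_⟩
  obtain ⟨k, hk, hk1, hkG, hkη⟩ : ∃ k : ℝ, 0 < k ∧ k ≤ 1 / 3 ∧ 16 * d ^ 2 * G * k ≤ 1 ∧
      16 * K ^ 3 * G * k ≤ η := by
    refine ⟨min (1 / 3) (min (1 / (16 * d ^ 2 * G + 1)) (η / (16 * K ^ 3 * G + 1))), by positivity,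
      min_le_left _ _, ?_, ?_⟩
    · calc 16 * d ^ 2 * G * _ ≤ 16 * d ^ 2 * G * (1 / (16 * d ^ 2 * G + 1)) := by
            gcongr; exact (min_le_right _ _).trans (min_le_left _ _)
        _ ≤ 1 := by rw [mul_one_div, div_le_one (by positivity)]; linarith
    · calc 16 * K ^ 3 * G * _ ≤ 16 * K ^ 3 * G * (η / (16 * K ^ 3 * G + 1)) := by
            gcongr; exact (min_le_right _ _).trans (min_le_right _ _)
        _ ≤ η := by rw [mul_div_assoc', div_le_iff₀ (by positivity)]; nlinarith
  refine ⟨2 + 16 * K ^ 3 * G / k ^ 5, by positivity, fun a ha u F0 L1 m hM hm hF0 hL1 hf => ?_⟩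
  obtain ⟨M, hM⟩ := hM
  have m0 : 0 ≤ m := (abs_nonneg _).trans (hm 0)
  have hu := hM.1
  have hR1 : 1 / K ≤ 1 := by rw [div_le_one (by linarith)]; exact hK
  set N := 2 * (G * (2 * m / k ^ 5 + F0 + 2 * k * L1)) with hN
  have N0 : 0 ≤ N := by positivity
  have P : ∀ x0, PN u x0 (1 / K) N := fun x0 =>
    schauder (a := a) hu hL (K := K) (by field_simp; rfl) (fun x _ => ha.1 x) (fun x _ y _ => ha.2 x y)
      (m := 2 * m) (fun x _ y _ => by
        have := abs_sub (u x) (u y); linarith [hm x, hm y]) (by positivity) hF0 hL1 (by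
        intro x s hs e p q _ _
        refine (hf p q).trans ?_
        have s1 : s ≤ 1 := by nlinarith [norm_nonneg (x - x0)]
        gcongr
        · exact le_div_self hF0 (by positivity) (pow_le_one₀ hs.le s1)
        · exact le_div_self hL1 (by positivity) (pow_le_one₀ hs.le s1))
      ⟨M, GB_nn hM, PN_of_GB hM hR1 x0⟩ hk hk1 hkG
  obtain ⟨s, hs, hs2⟩ : ∃ s, 0 < s ∧ s ^ 2 = 1 / K :=
    ⟨√(1 / K), by positivity, Real.sq_sqrt (by positivity)⟩
  have K0 : 0 < K := by linarith
  have s1 : s ≤ 1 := by nlinarith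
  have s4 : s ^ 4 * K ^ 2 = 1 := by
    calc s ^ 4 * K ^ 2 = (s ^ 2 * K) ^ 2 := by ring
      _ = 1 := by rw [hs2]; field_simp
  have s5 : 1 ≤ s ^ 5 * K ^ 3 := by
    have : s ^ 6 * K ^ 3 = 1 := by
      calc s ^ 6 * K ^ 3 = (s ^ 2 * K) ^ 3 := by ring
        _ = 1 := by rw [hs2]; field_simp
    rw [← this]; gcongr ?_ * _
    exact pow_le_pow_of_le_one hs.le s1 (by norm_num)
  have hH : ∀ x, ‖Hs u x‖ ≤ K ^ 2 * N := by
    intro x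
    have := (P x x s hs (by simpa using hs2)).1
    calc ‖Hs u x‖ = K ^ 2 * (s ^ 4 * ‖Hs u x‖) := by
          rw [← mul_assoc, mul_comm (K ^ 2), s4, one_mul]
      _ ≤ _ := by gcongr
  have K23 : K ^ 2 ≤ K ^ 3 := pow_le_pow_right₀ hK (by norm_num)
  have fin : 8 * K ^ 3 * G * F0 + (2 + 16 * K ^ 3 * G / k ^ 5) * m + η * L1 ≥ 2 * m + 4 * K ^ 3 * N := by
    have : 4 * K ^ 3 * N = 8 * K ^ 3 * G * F0 + 16 * K ^ 3 * G / k ^ 5 * m + 16 * K ^ 3 * G * k * L1 := by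
      rw [hN]; ring
    rw [this]
    linarith [mul_le_mul_of_nonneg_right hkη hL1]
  have KN : 0 ≤ K ^ 3 * N := by positivity
  have KN2 : K ^ 2 * N ≤ K ^ 3 * N := by gcongr
  refine GB_mono fin ⟨hu, fun x => ⟨?_, ?_, ?_, fun y => ?_⟩⟩
  · linarith [hm x]
  · have := grad_interp hu (x := x) one_pos (M := K ^ 2 * N) (m := 2 * m) (fun y _ => hH y)
      (fun y _ => by have := abs_sub (u y) (u x); linarith [hm x, hm y])
    linarith
  · linarith [hH x]
  · have sn := Real.sqrt_nonneg ‖y - x‖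
    suffices h : ‖Hs u y - Hs u x‖ ≤ 4 * K ^ 3 * N * √‖y - x‖ by
      refine h.trans ?_
      gcongr; linarith
    rcases le_total ‖y - x‖ (s ^ 2 / 2) with hy | hy
    · have := (P x x s hs (by simpa using hs2)).2 y hy
      calc ‖Hs u y - Hs u x‖ ≤ (s ^ 5 * K ^ 3) * ‖Hs u y - Hs u x‖ := le_mul_of_one_le_left (norm_nonneg _) s5
        _ = K ^ 3 * (s ^ 5 * ‖Hs u y - Hs u x‖) := by ring
        _ ≤ K ^ 3 * (N * √‖y - x‖) := by gcongr
        _ ≤ _ := by linarith [mul_nonneg KN sn]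
    · have h1 : 1 ≤ 2 * K * √‖y - x‖ := by
        have : 1 / (2 * K) ≤ √‖y - x‖ := by
          apply Real.le_sqrt_of_sq_le
          refine le_trans ?_ hy
          rw [hs2, div_pow, div_div, one_pow]
          apply one_div_le_one_div_of_le (by positivity); nlinarith
        rw [div_le_iff₀ (by positivity)] at this; linarith
      calc ‖Hs u y - Hs u x‖ ≤ ‖Hs u y‖ + ‖Hs u x‖ := bil_sub_le _ _
        _ ≤ 2 * K ^ 2 * N := by linarith [hH x, hH y]
        _ ≤ 2 * K ^ 2 * N * (2 * K * √‖y - x‖) := le_mul_of_one_le_right (by positivity) h1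
        _ = _ := by ring
end

open Metric Set MeasureTheory
noncomputable section
variable {d : ℕ}

lemma D_smul {u : Eu d → ℝ} (hu : ContDiff ℝ 2 u) (c : ℝ) (x : Eu d) :
    fderiv ℝ (fun z => c * u z) x = c • fderiv ℝ u x :=
  ((c2_d1 hu x).const_mul c).fderiv

lemma Hs_smul {u : Eu d → ℝ} (hu : ContDiff ℝ 2 u) (c : ℝ) (x : Eu d) :
    Hs (fun z => c * u z) x = c • Hs u x := by
  rw [Hs, show fderiv ℝ (fun z => c * u z) = fun z => c • fderiv ℝ u z from
    funext fun z => D_smul hu c z]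
  exact ((c2_d2 hu x).const_smul c).fderiv

lemma trM_smul (A : Matrix (Fin d) (Fin d) ℝ) (c : ℝ) (B : Bil d) : trM A (c • B) = c * trM A B := by
  simp only [trM, smul_apply, smul_eq_mul, Finset.mul_sum]
  exact Finset.sum_congr rfl fun i _ => Finset.sum_congr rfl fun j _ => by ring

lemma smax {u : Eu d → ℝ} (hu : ContDiff ℝ 2 u) {x : Eu d} (h : IsLocalMax u x) (e : Eu d) :
    Hs u x e e ≤ 0 := by
  by_contra! hk
  have hc : Filter.Tendsto (fun y => Hs u y e e) (nhds x) (nhds (Hs u x e e)) := by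
    have := c2_Hs hu
    exact (show Continuous fun y => Hs u y e e by fun_prop).tendsto x
  have h2 : ∀ᶠ y in nhds x, |Hs u y e e - Hs u x e e| < Hs u x e e := by
    have := hc.eventually (Metric.ball_mem_nhds (Hs u x e e) hk)
    simpa [Real.dist_eq] using this
  obtain ⟨δ, hδ, H⟩ := Metric.eventually_nhds_iff.1 (h2.and h)
  obtain ⟨t, ht, htδ⟩ : ∃ t : ℝ, 0 < t ∧ t * ‖e‖ < δ := by
    refine ⟨δ / (‖e‖ + 1), by positivity, ?_⟩
    rw [div_mul_eq_mul_div, div_lt_iff₀ (by positivity)]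
    nlinarith [norm_nonneg e]
  have hs : ∀ s ∈ Icc (-1:ℝ) 1, dist (x + s • t • e) x < δ := fun s hs => by
    rw [dist_eq_norm, add_sub_cancel_left, norm_smul, norm_smul, Real.norm_eq_abs, Real.norm_eq_abs,
      abs_of_pos ht]
    have : |s| ≤ 1 := abs_le.2 hs
    nlinarith [norm_nonneg e, mul_nonneg ht.le (norm_nonneg e)]
  obtain ⟨s0, hs0, hsmax⟩ := isCompact_Icc.exists_isMaxOn (nonempty_Icc.2 (by norm_num : (-1:ℝ) ≤ 1))
    (f := fun s : ℝ => |Hs u (x + s • t • e) e e - Hs u x e e|) (by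
      have := c2_Hs hu
      exact Continuous.continuousOn (by fun_prop))
  have T := taylor2 hu x (t • e) (B := Hs u x) (M := t ^ 2 * |Hs u (x + s0 • t • e) e e - Hs u x e e|) (fun s hs => by
    have := hsmax hs
    simp only [mem_ofPred_eq] at this
    simp only [map_smul, smul_apply, smul_eq_mul]
    rw [show t * (t * (Hs u (x + s • t • e) e e)) - t * (t * Hs u x e e) = t ^ 2 * (Hs u (x + s • t • e) e e - Hs u x e e) by ring, abs_mul, abs_of_nonneg (by positivity : (0:ℝ) ≤ t ^ 2)]
    gcongr)
  have a1 := (H (hs 1 (by norm_num))).2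
  have a2 := (H (hs (-1) (by norm_num))).2
  have a3 := (H (hs s0 hs0)).1
  simp only [one_smul, neg_smul, ← sub_eq_add_neg] at a1 a2
  simp only [map_smul, smul_apply, smul_eq_mul] at T
  have := (abs_le.1 T).1
  have := mul_lt_mul_of_pos_left a3 (show 0 < t ^ 2 by positivity)
  linarith

lemma trM_max {L : ℝ} (hL : 1 ≤ L) {A : Matrix (Fin d) (Fin d) ℝ} (hA : Ell L A) {u v : Eu d → ℝ}
    (hu : ContDiff ℝ 2 u) (hv : ContDiff ℝ 2 v) {x : Eu d} (h : IsLocalMax (fun y => u y - v y) x) :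
    fderiv ℝ u x = fderiv ℝ v x ∧ trM A (Hs u x) ≤ trM A (Hs v x) := by
  constructor
  · have := h.fderiv_eq_zero
    rw [D_sub hu hv] at this
    exact sub_eq_zero.1 this
  · obtain ⟨T, -, -, hT⟩ := sqrtM hL hA
    have h1 : trM A (Hs u x) - trM A (Hs v x) ≤ 0 := by
      rw [← trM_sub_right, ← Hs_sub hu hv, ← hT]
      exact Finset.sum_nonpos fun i _ => smax (hu.sub hv) h _
    linarith

lemma sq_c2 : ContDiff ℝ 2 (fun x : Eu d => ‖x‖ ^ 2) := contDiff_norm_sq ℝ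

lemma sq_D (x h : Eu d) : fderiv ℝ (fun x : Eu d => ‖x‖ ^ 2) x h = 2 * inner ℝ x h := by
  rw [(hasStrictFDerivAt_norm_sq x).hasFDerivAt.fderiv]
  simp

lemma sq_Hs (x h k : Eu d) : Hs (fun x : Eu d => ‖x‖ ^ 2) x h k = 2 * inner ℝ h k := by
  have e : fderiv ℝ (fun x : Eu d => ‖x‖ ^ 2) = fun x => (2 • innerSL ℝ : Eu d →L[ℝ] Eu d →L[ℝ] ℝ) x := by
    funext x; ext h; rw [sq_D]; simp; rfl
  rw [Hs, e, ContinuousLinearMap.fderiv]; simp; rfl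

lemma ell_diag {L : ℝ} {A : Matrix (Fin d) (Fin d) ℝ} (hA : Ell L A) (i : Fin d) : A i i ≤ L := by
  have := (hA.2 (eb i)).2
  simpa [quadForm, eb, Finset.sum_ite_eq, Pi.single_apply] using this

lemma sq_tr {L : ℝ} {A : Matrix (Fin d) (Fin d) ℝ} (hA : Ell L A) (x : Eu d) :
    trM A (Hs (fun x : Eu d => ‖x‖ ^ 2) x) ≤ 2 * d * L := by
  have : trM A (Hs (fun x : Eu d => ‖x‖ ^ 2) x) = ∑ i, 2 * A i i := by
    simp only [trM, sq_Hs]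
    refine Finset.sum_congr rfl fun i _ => ?_
    simp [eb, EuclideanSpace.inner_single_left]
    ring
  rw [this]
  calc _ ≤ ∑ i : Fin d, 2 * L := Finset.sum_le_sum fun i _ => by linarith [ell_diag hA i]
    _ = _ := by simp; ring

theorem maxP {L : ℝ} (hL : 1 ≤ L) {a : Eu d → Matrix (Fin d) (Fin d) ℝ} (hE : ∀ x, Ell L (a x))
    {u : Eu d → ℝ} (hu : ContDiff ℝ 2 u) {m : ℝ} (hm : ∀ x, |u x| ≤ m) {μ c : ℝ} (hμ : 0 < μ)
    (h : ∀ x, μ * u x - trM (a x) (Hs u x) ≤ c) (x : Eu d) : μ * u x ≤ c := by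
  have key : ∀ ε > 0, μ * u x ≤ c + ε * (2 * d * L + μ * ‖x‖ ^ 2) := by
    intro ε hε
    have hq : ContDiff ℝ 2 (fun y : Eu d => ε * ‖y‖ ^ 2) := contDiff_const.mul sq_c2
    obtain ⟨x0, hx0⟩ := (hu.sub hq).continuous.exists_forall_ge' (0 : Eu d) (by
      have : Filter.Tendsto (fun y : Eu d => ε * ‖y‖ ^ 2) (Filter.cocompact _) Filter.atTop :=
        ((Filter.tendsto_pow_atTop two_ne_zero).comp (tendsto_norm_cocompact_atTop)).const_mul_atTop hε
      filter_upwards [this.eventually_ge_atTop (2 * m)] with y hy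
      have h1 := abs_le.1 (hm y)
      have h2 := abs_le.1 (hm 0)
      simp
      linarith)
    have := (trM_max hL (hE x0) hu hq (x := x0) (Filter.Eventually.of_forall hx0)).2
    rw [Hs_smul sq_c2, trM_smul] at this
    have h3 := mul_le_mul_of_nonneg_left (sq_tr (hE x0) x0) hε.le
    have h4 := hx0 x
    have h5 := h x0
    have h6 : 0 ≤ μ * (ε * ‖x0‖ ^ 2) := by positivity
    have h7 := mul_le_mul_of_nonneg_left h4 hμ.le
    linarith
  refine le_of_forall_pos_le_add fun η hη => ?_
  have L0 : 0 < L := by linarith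
  have hp : 0 < 2 * d * L + μ * ‖x‖ ^ 2 + 1 := by positivity
  refine (key (η / (2 * d * L + μ * ‖x‖ ^ 2 + 1)) (by positivity)).trans ?_
  have : η / (2 * d * L + μ * ‖x‖ ^ 2 + 1) * (2 * d * L + μ * ‖x‖ ^ 2) ≤ η := by
    rw [div_mul_eq_mul_div, div_le_iff₀ hp]; nlinarith
  linarith

lemma maxP_abs {L : ℝ} (hL : 1 ≤ L) {a : Eu d → Matrix (Fin d) (Fin d) ℝ} (hE : ∀ x, Ell L (a x))
    {u : Eu d → ℝ} (hu : ContDiff ℝ 2 u) {m : ℝ} (hm : ∀ x, |u x| ≤ m) {μ c : ℝ} (hμ : 0 < μ)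
    (h : ∀ x, |μ * u x - trM (a x) (Hs u x)| ≤ c) (x : Eu d) : μ * |u x| ≤ c := by
  have h1 := maxP hL hE hu hm hμ (fun x => (abs_le.1 (h x)).2) x
  have h2 := maxP hL hE (u := fun z => -1 * u z) (contDiff_const.mul hu) (m := m) (by simpa using hm) hμ (c := c)
    (fun x => by rw [Hs_smul hu, trM_smul]; linarith [(abs_le.1 (h x)).1]) x
  rcases abs_cases (u x) with ⟨e, _⟩ | ⟨e, _⟩ <;> rw [e] <;> linarith
end

open Metric Set MeasureTheory
noncomputable section
variable {d : ℕ}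

def mo {F : Type*} [NormedAddCommGroup F] [NormedSpace ℝ F] (q : Eu d → ℝ) (g : Eu d → F) (x : Eu d) : F :=
  ∫ t : Eu d, q t • g (x - t)

lemma mo_d {F : Type*} [NormedAddCommGroup F] [NormedSpace ℝ F] {q : Eu d → ℝ} {g : Eu d → F}
    (hq : Continuous q) (hg : ContDiff ℝ 1 g) (hc : HasCompactSupport g) (x : Eu d) :
    HasFDerivAt (mo q g) (mo q (fderiv ℝ g) x) x := by
  have := hc.hasFDerivAt_convolution_right (ContinuousLinearMap.lsmul ℝ ℝ) (μ := volume)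
    (hq.locallyIntegrable) hg x
  exact this

lemma mo_bd {F : Type*} [NormedAddCommGroup F] [NormedSpace ℝ F] {q : Eu d → ℝ} {g : Eu d → F} {m : ℝ}
    (hq : ∀ x, |q x| ≤ m) (hg : Continuous g) (hc : HasCompactSupport g) (x : Eu d) :
    ‖mo q g x‖ ≤ (∫ t, ‖g t‖) * m := by
  have hi : Integrable (fun t => ‖g t‖) := (hg.integrable_of_hasCompactSupport hc).norm
  have := norm_integral_le_of_norm_le (f := fun t => q t • g (x - t)) ((hi.comp_sub_left x).mul_const m)
    (Filter.Eventually.of_forall fun t => by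
      rw [norm_smul, mul_comm]; exact mul_le_mul_of_nonneg_left (hq t) (norm_nonneg _))
  refine this.trans (le_of_eq ?_)
  rw [integral_mul_const, integral_sub_left_eq_self (fun t => ‖g t‖)]

lemma mo_lip {F : Type*} [NormedAddCommGroup F] [NormedSpace ℝ F] {g : Eu d → F} (hg : ContDiff ℝ 1 g)
    (hc : HasCompactSupport g) : ∃ C ≥ 0, ∀ (q : Eu d → ℝ) (m : ℝ), Continuous q → (∀ x, |q x| ≤ m) →
    ∀ x y, ‖mo q g y - mo q g x‖ ≤ C * m * ‖y - x‖ :=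
  ⟨∫ t, ‖fderiv ℝ g t‖, integral_nonneg fun _ => norm_nonneg _, fun q m hq hm x y =>
    (convex_univ (𝕜 := ℝ)).norm_image_sub_le_of_norm_hasFDerivWithin_le
      (fun z _ => (mo_d hq hg hc z).hasFDerivWithinAt)
      (fun z _ => mo_bd hm (hg.continuous_fderiv (by norm_num)) (hc.fderiv ℝ) z) (mem_univ _) (mem_univ _)⟩

lemma mol_exists (d : ℕ) {τ : ℝ} (hτ : 0 < τ) : ∃ g : Eu d → ℝ, Continuous g ∧ HasCompactSupport g ∧
    (∀ w, 0 ≤ g w) ∧ ∫ w, g w = 1 ∧ (∀ w, g w ≠ 0 → ‖w‖ < τ) ∧ ∃ M ≥ 0, ∀ (q : Eu d → ℝ) (m : ℝ),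
    Continuous q → (∀ x, |q x| ≤ m) → GB (M * m) (fun x => ∫ w, q (x - w) * g w) := by
  let B : ContDiffBump (0 : Eu d) := ⟨τ / 2, τ, by positivity, by linarith⟩
  let g := B.normed volume
  have g3 : ContDiff ℝ 3 g := B.contDiff_normed (n := 3)
  have hc : HasCompactSupport g := B.hasCompactSupport_normed
  have g2 : ContDiff ℝ 2 (fderiv ℝ g) := g3.fderiv_right (by norm_num)
  have g1 : ContDiff ℝ 1 (fderiv ℝ (fderiv ℝ g)) := g2.fderiv_right (by norm_num)
  have hc1 : HasCompactSupport (fderiv ℝ g) := hc.fderiv ℝ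
  have hc2 : HasCompactSupport (fderiv ℝ (fderiv ℝ g)) := hc1.fderiv ℝ
  obtain ⟨C3, hC3, b3⟩ := mo_lip g1 hc2
  have I0 : ∀ {F : Type} [NormedAddCommGroup F] (g : Eu d → F), 0 ≤ ∫ t, ‖g t‖ := fun g =>
    integral_nonneg fun _ => norm_nonneg _
  refine ⟨g, g3.continuous, hc, B.nonneg_normed, B.integral_normed, ?_, 
    (∫ t, ‖g t‖) + (∫ t, ‖fderiv ℝ g t‖) + 2 * (∫ t, ‖fderiv ℝ (fderiv ℝ g) t‖) +
     C3, ?_, ?_⟩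
  · intro w hw
    have : w ∈ Function.support g := hw
    rw [B.support_normed_eq] at this
    simpa using this
  · have := I0 g; have := I0 (fderiv ℝ g); have := I0 (fderiv ℝ (fderiv ℝ g))
    positivity
  · intro q m hq hm
    have e0 : (fun x => ∫ w, q (x - w) * g w) = mo q g := by
      funext x
      rw [mo, ← integral_sub_left_eq_self _ volume x]
      simp
    have e1 : fderiv ℝ (mo q g) = mo q (fderiv ℝ g) := funext fun x => (mo_d hq (g3.of_le (by norm_num)) hc x).fderiv
    have e2 : Hs (mo q g) = mo q (fderiv ℝ (fderiv ℝ g)) := by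
      funext x
      rw [Hs, e1]
      exact (mo_d hq (g2.of_le (by norm_num)) hc1 x).fderiv
    have m0 : 0 ≤ m := (abs_nonneg _).trans (hm 0)
    have p0 := mul_nonneg (I0 g) m0
    have p1 := mul_nonneg (I0 (fderiv ℝ g)) m0
    have p2 := mul_nonneg (I0 (fderiv ℝ (fderiv ℝ g))) m0
    have p3 := mul_nonneg hC3 m0
    have b2 := mo_bd hm g1.continuous hc2
    rw [e0]
    refine ⟨hc.contDiff_convolution_right (n := 2) (ContinuousLinearMap.lsmul ℝ ℝ) hq.locallyIntegrable (g3.of_le (by norm_num)), fun x => ⟨?_, ?_, ?_, fun y => ?_⟩⟩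
    · have := mo_bd hm g3.continuous hc x
      rw [Real.norm_eq_abs] at this
      linarith
    · have := mo_bd hm g2.continuous hc1 x
      rw [e1]
      linarith
    · have := b2 x
      rw [e2]
      linarith
    · rw [e2]
      have h1 : ‖mo q (fderiv ℝ (fderiv ℝ g)) y - mo q (fderiv ℝ (fderiv ℝ g)) x‖ ≤
          (C3 * m) * ‖y - x‖ :=
        b3 q m hq hm x y
      rcases le_total ‖y - x‖ 1 with h | h
      · refine h1.trans ?_
        have h2 : ‖y - x‖ ≤ √‖y - x‖ := Real.le_sqrt_of_sq_le (by nlinarith [norm_nonneg (y - x)])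
        exact mul_le_mul (by linarith) h2 (norm_nonneg _) (by linarith)
      · have h2 : 1 ≤ √‖y - x‖ := Real.one_le_sqrt.2 h
        have h3 := norm_sub_le (mo q (fderiv ℝ (fderiv ℝ g)) y) (mo q (fderiv ℝ (fderiv ℝ g)) x)
        have h4 := b2 x
        have h5 := b2 y
        refine le_trans (b := ((∫ t, ‖g t‖) + (∫ t, ‖fderiv ℝ g t‖) + 2 * (∫ t, ‖fderiv ℝ (fderiv ℝ g) t‖) +
     C3) * m * 1) (by linarith) ?_
        exact mul_le_mul_of_nonneg_left h2 (by linarith)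

open BoundedContinuousFunction in
lemma disc_solve {ε μ : ℝ} (hε : 0 < ε) (hμ : 0 < μ) {f : Eu d → ℝ} {m : ℝ} (hf : Continuous f)
    (hm : ∀ x, |f x| ≤ m) : ∃ q : Eu d → ℝ, Continuous q ∧ (∀ x, |q x| ≤ m / μ) ∧
    ∀ x, μ * q x - ∑ i : Fin d, (q (x + ε • eb i) + q (x - ε • eb i) - 2 * q x) / ε ^ 2 = f x := by
  have m0 : 0 ≤ m := (abs_nonneg _).trans (hm 0)
  let S (i : Fin d) (s : ℝ) : C(Eu d, Eu d) := ⟨fun x => x + s • eb i, by fun_prop⟩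
  let fb : Eu d →ᵇ ℝ := BoundedContinuousFunction.ofNormedAddCommGroup f hf m hm
  let σ : ℝ := μ + 2 * d / ε ^ 2
  have σ0 : 0 < σ := by positivity
  let T (q : Eu d →ᵇ ℝ) : Eu d →ᵇ ℝ :=
    σ⁻¹ • (fb + (ε ^ 2)⁻¹ • ∑ i, (q.compContinuous (S i ε) + q.compContinuous (S i (-ε))))
  have Tap : ∀ q x, T q x = σ⁻¹ * (f x + (ε ^ 2)⁻¹ * ∑ i, (q (x + ε • eb i) + q (x - ε • eb i))) := by
    intro q x
    simp [T, S, fb, sub_eq_add_neg, mul_add]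
  have k0 : 0 ≤ σ⁻¹ * (2 * d / ε ^ 2) := by positivity
  have kb : ∀ (q q' : Eu d →ᵇ ℝ) D, (∀ x, |q x - q' x| ≤ D) → ∀ x, |T q x - T q' x| ≤ σ⁻¹ * (2 * d / ε ^ 2) * D := by
    intro q q' D hD x
    rw [Tap, Tap]
    have : |∑ i : Fin d, (q (x + ε • eb i) + q (x - ε • eb i)) - ∑ i : Fin d, (q' (x + ε • eb i) + q' (x - ε • eb i))| ≤ ∑ i : Fin d, (2 * D) := by
      rw [← Finset.sum_sub_distrib]
      refine (Finset.abs_sum_le_sum_abs _ _).trans (Finset.sum_le_sum fun i _ => ?_)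
      have h1 := hD (x + ε • eb i)
      have h2 := hD (x - ε • eb i)
      rw [abs_le] at *
      constructor <;> linarith [h1.1, h1.2, h2.1, h2.2]
    rw [← mul_sub, add_sub_add_left_eq_sub, ← mul_sub, abs_mul, abs_mul, abs_of_pos (by positivity : 0 < σ⁻¹),
      abs_of_pos (by positivity : 0 < (ε ^ 2)⁻¹)]
    calc _ ≤ σ⁻¹ * ((ε ^ 2)⁻¹ * ∑ i : Fin d, (2 * D)) := by gcongr
      _ = _ := by simp; ring
  have hk1 : σ⁻¹ * (2 * d / ε ^ 2) < 1 := by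
    rw [inv_mul_lt_iff₀ σ0]; simp [σ, hμ]
  have hT : ContractingWith ⟨σ⁻¹ * (2 * d / ε ^ 2), k0⟩ T := by
    refine ⟨by exact_mod_cast hk1, LipschitzWith.of_dist_le_mul fun q q' => ?_⟩
    refine (BoundedContinuousFunction.dist_le (by positivity)).2 fun x => ?_
    exact kb q q' _ (fun y => q.dist_coe_le_dist y) x
  obtain ⟨q, hq⟩ : ∃ q, T q = q := ⟨_, hT.fixedPoint_isFixedPt⟩
  have hσ : σ = μ + 2 * d / ε ^ 2 := rfl
  refine ⟨q, q.continuous, fun x => ?_, fun x => ?_⟩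
  · have n1 : ‖q‖ ≤ σ⁻¹ * m + σ⁻¹ * (2 * d / ε ^ 2) * ‖q‖ := by
      refine (BoundedContinuousFunction.norm_le (by positivity)).2 fun x => ?_
      have h1 := kb q 0 ‖q‖ (fun y => by simpa using q.norm_coe_le_norm y) x
      have h2 : |T 0 x| ≤ σ⁻¹ * m := by
        rw [Tap]; simp [abs_mul, abs_of_pos σ0]; gcongr; exact hm x
      rw [hq] at h1
      rw [Real.norm_eq_abs]
      have := abs_sub_abs_le_abs_sub (q x) (T 0 x)
      linarith
    refine (q.norm_coe_le_norm x).trans ?_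
    rw [le_div_iff₀ hμ]
    have h3 := mul_le_mul_of_nonneg_left n1 σ0.le
    rw [mul_add, ← mul_assoc, ← mul_assoc, ← mul_assoc, mul_inv_cancel₀ σ0.ne', hσ] at h3
    linarith
  · have h1 := Tap q x
    rw [hq] at h1
    rw [← Finset.sum_div, Finset.sum_sub_distrib]
    have h2 : σ * q x = f x + (ε ^ 2)⁻¹ * ∑ i, (q (x + ε • eb i) + q (x - ε • eb i)) := by
      rw [h1]; field_simp
    rw [hσ] at h2
    simp only [Finset.sum_const, Finset.card_univ, Fintype.card_fin, nsmul_eq_mul]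
    rw [sub_div, ← inv_mul_eq_div]
    linear_combination h2
end

open Metric Set MeasureTheory
noncomputable section
variable {d : ℕ}

lemma ell_one {L : ℝ} (hL : 1 ≤ L) : Ell L (1 : Matrix (Fin d) (Fin d) ℝ) := by
  have hq : ∀ z : Eu d, quadForm (1 : Matrix (Fin d) (Fin d) ℝ) z = ‖z‖ ^ 2 := fun z => by
    rw [EuclideanSpace.real_norm_sq_eq]
    simp [quadForm, Matrix.one_apply, pow_two]
  refine ⟨Matrix.isSymm_one, fun z => ?_⟩
  rw [hq]
  have := inv_le_one_of_one_le₀ hL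
  constructor <;> nlinarith [sq_nonneg ‖z‖]

lemma trM_one (B : Bil d) : trM 1 B = ∑ i, B (eb i) (eb i) := by
  simp [trM, Matrix.one_apply]

lemma sqrt_nn_add (x y : Eu d) : 0 ≤ √‖x - y‖ := Real.sqrt_nonneg _

lemma GB_lip {u : Eu d → ℝ} {M : ℝ} (h : GB M u) (x y : Eu d) : |u x - u y| ≤ M * ‖x - y‖ :=
  lipU h.1 fun z _ => (h.2 z).2.1

lemma GB_absorb {u : Eu d → ℝ} {Q : ℝ} (hQ : 0 ≤ Q) (h0 : ∃ N, GB N u)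
    (step : ∀ N, GB N u → GB (N / 2 + Q) u) : GB (2 * Q) u := by
  obtain ⟨N, hN⟩ := h0
  refine absorb (P := fun N => GB N u) (fun N N' h h1 => GB_mono h h1) ?_ hQ ⟨N, GB_nn hN, hN⟩ (fun N _ => step N)
  intro N h
  have key : ∀ {X c : ℝ}, (∀ ε > 0, X ≤ (N + ε) * c) → X ≤ N * c := fun {X c} H => by
    have t : Filter.Tendsto (fun ε : ℝ => (N + ε) * c) (nhdsWithin 0 (Ioi 0)) (nhds ((N + 0) * c)) :=
      ((continuous_const.add continuous_id).mul continuous_const).continuousWithinAt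
    rw [add_zero] at t
    exact ge_of_tendsto t (eventually_mem_nhdsWithin.mono fun ε hε => H ε hε)
  refine ⟨(h 1 one_pos).1, fun x => ⟨?_, ?_, ?_, fun y => key fun ε hε => ((h ε hε).2 x).2.2.2 y⟩⟩
  · rw [← mul_one N]; exact key fun ε hε => by rw [mul_one]; exact ((h ε hε).2 x).1
  · rw [← mul_one N]; exact key fun ε hε => by rw [mul_one]; exact ((h ε hε).2 x).2.1
  · rw [← mul_one N]; exact key fun ε hε => by rw [mul_one]; exact ((h ε hε).2 x).2.2.1

theorem lin_est (d : ℕ) {L K μ : ℝ} (hL : 1 ≤ L) (hK : 1 ≤ K) (hμ : 0 < μ) : ∃ C ≥ 0,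
    ∀ a : Eu d → Matrix (Fin d) (Fin d) ℝ, Coef L K a → ∀ (u f : Eu d → ℝ) (F m : ℝ),
    (∃ M, GB M u) → (∀ x, μ * u x - trM (a x) (Hs u x) = f x) → (∀ x, |f x| ≤ m) → 
    (∀ x y, |f x - f y| ≤ F * √‖x - y‖) → 0 ≤ F → GB (C * (F + m)) u := by
  obtain ⟨C, C0, H⟩ := global_est d hL hK
  obtain ⟨Cη, Cη0, H⟩ := H (1 / (2 * μ)) (by positivity)
  refine ⟨2 * (C + Cη / μ), by positivity, fun a ha u f F m hGB he hm hF F0 => ?_⟩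
  have m0 : 0 ≤ m := (abs_nonneg _).trans (hm 0)
  have hum : ∀ x, |u x| ≤ m / μ := fun x => by
    obtain ⟨M, hM⟩ := hGB
    rw [le_div_iff₀' hμ]
    exact maxP_abs hL ha.1 hM.1 (fun x => (hM.2 x).1) hμ (fun x => by rw [he]; exact hm x) x
  have := GB_absorb (u := u) (Q := (C + Cη / μ) * (F + m)) (by positivity) hGB fun N hN => by
    have N0 := GB_nn hN
    have h1 := H a ha u F (μ * N) (m / μ) ⟨N, hN⟩ hum F0 (by positivity) (fun x y => by
      have h2 := GB_lip hN x y
      have h3 := hF x y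
      have h5 := mul_le_mul_of_nonneg_left h2 hμ.le
      rw [← he, ← he] at h3
      rw [← abs_of_pos hμ, ← abs_mul, abs_of_pos hμ] at h5
      rw [abs_le] at *
      constructor <;> linarith [h3.1, h3.2, h5.1, h5.2])
    refine GB_mono ?_ h1
    have : 1 / (2 * μ) * (μ * N) = N / 2 := by field_simp
    rw [this]
    have : 0 ≤ C * m + Cη / μ * F := by positivity
    have e : Cη * (m / μ) = Cη / μ * m := by ring
    rw [e]
    linarith
  rwa [← mul_assoc] at this

lemma mo_avg {g : Eu d → ℝ} (hg : Continuous g) (hc : HasCompactSupport g) (g0 : ∀ w, 0 ≤ g w)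
    (gi : ∫ w, g w = 1) {h : Eu d → ℝ} {c : ℝ} (hh : ∀ w, g w ≠ 0 → |h w| ≤ c) : |∫ w, h w * g w| ≤ c := by
  have hi : Integrable g := hg.integrable_of_hasCompactSupport hc
  have := norm_integral_le_of_norm_le (f := fun t => h t * g t) (hi.const_mul c)
    (Filter.Eventually.of_forall fun t => by
      by_cases ht : g t = 0
      · simp [ht]
      · rw [norm_mul, Real.norm_of_nonneg (g0 t)]; exact mul_le_mul_of_nonneg_right (hh t ht) (g0 t))
  rw [integral_const_mul, gi, mul_one] at this
  exact this

lemma mo_int {g h : Eu d → ℝ} (hg : Continuous g) (hc : HasCompactSupport g) (hh : Continuous h) (x : Eu d) :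
    Integrable (fun w => h (x - w) * g w) :=
  Continuous.integrable_of_hasCompactSupport (by fun_prop) hc.mul_left

lemma mo_disc {g q f : Eu d → ℝ} (hg : Continuous g) (hc : HasCompactSupport g) (hq : Continuous q) {ε μ : ℝ}
    (h : ∀ x, μ * q x - ∑ i : Fin d, (q (x + ε • eb i) + q (x - ε • eb i) - 2 * q x) / ε ^ 2 = f x) (x : Eu d) :
    μ * (∫ w, q (x - w) * g w) - ∑ i : Fin d, ((∫ w, q (x + ε • eb i - w) * g w) + (∫ w, q (x - ε • eb i - w) * g w)
      - 2 * ∫ w, q (x - w) * g w) / ε ^ 2 = ∫ w, f (x - w) * g w := by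
  have e : ∀ w, f (x - w) * g w = μ * (q (x - w) * g w) - ∑ i : Fin d, (q (x + ε • eb i - w) * g w + 
      q (x - ε • eb i - w) * g w - 2 * (q (x - w) * g w)) / ε ^ 2 := by
    intro w
    rw [← h, sub_mul, Finset.sum_mul, mul_assoc]
    congr 1
    refine Finset.sum_congr rfl fun i _ => ?_
    rw [show x - w + ε • eb i = x + ε • eb i - w by abel, show x - w - ε • eb i = x - ε • eb i - w by abel]
    ring
  simp_rw [e]
  have hi := fun y => mo_int hg hc hq y
  have hi2 : ∀ i : Fin d, Integrable fun w => (q (x + ε • eb i - w) * g w + 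
      q (x - ε • eb i - w) * g w - 2 * (q (x - w) * g w)) / ε ^ 2 := fun i =>
    (((hi _).add (hi _)).sub ((hi _).const_mul 2)).div_const _
  rw [integral_sub ((hi x).const_mul μ) (integrable_finsetSum _ fun i _ => hi2 i), integral_const_mul,
    integral_finsetSum _ fun i _ => hi2 i]
  congr 1
  refine Finset.sum_congr rfl fun i _ => ?_
  have h1 : Integrable fun w => q (x + ε • eb i - w) * g w + q (x - ε • eb i - w) * g w := (hi _).add (hi _)
  rw [integral_div, integral_sub h1 ((hi _).const_mul 2), integral_add (hi _) (hi _), integral_const_mul]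

lemma disc_err {u : Eu d → ℝ} {M : ℝ} (hu : GB M u) {ε : ℝ} (hε : 0 < ε) (x : Eu d) (i : Fin d) :
    |(u (x + ε • eb i) + u (x - ε • eb i) - 2 * u x) / ε ^ 2 - Hs u x (eb i) (eb i)| ≤ M * √ε := by
  have M0 := GB_nn hu
  have := taylor2 hu.1 x (ε • eb i) (B := Hs u x) (M := ε ^ 2 * (M * √ε)) (fun t ht => by
    rw [← sub_apply, ← sub_apply]
    have h1 := (Hs u (x + t • ε • eb i) - Hs u x).le_opNorm₂ (ε • eb i) (ε • eb i)
    have h2 := (hu.2 x).2.2.2 (x + t • ε • eb i)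
    have h3 : ‖ε • eb i‖ = ε := by rw [norm_smul, Real.norm_of_nonneg hε.le]; simp
    have h4 : √‖x + t • ε • eb i - x‖ ≤ √ε := by
      apply Real.sqrt_le_sqrt
      rw [add_sub_cancel_left, norm_smul, h3, Real.norm_eq_abs]
      have : |t| ≤ 1 := abs_le.2 ht
      nlinarith
    rw [h3] at h1
    refine h1.trans ?_
    have h5 := h2.trans (mul_le_mul_of_nonneg_left h4 M0)
    have h6 := mul_le_mul_of_nonneg_right h5 (sq_nonneg ε)
    linarith)
  have e2 : 0 < ε ^ 2 := by positivity
  rw [map_smul (Hs u x), smul_apply, map_smul] at this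
  rw [div_sub' e2.ne', abs_div, abs_of_pos e2, div_le_iff₀ e2, mul_comm (M * √ε)]
  simp only [smul_eq_mul] at this
  rwa [show ε ^ 2 * Hs u x (eb i) (eb i) = ε * (ε * Hs u x (eb i) (eb i)) by ring]

lemma base_step {μ : ℝ} (hμ : 0 < μ) {f : Eu d → ℝ} {m : ℝ} (hf : Continuous f) (hm : ∀ x, |f x| ≤ m)
    {g : Eu d → ℝ} (hg : Continuous g) (hc : HasCompactSupport g) {M : ℝ}
    (hM : ∀ (q : Eu d → ℝ) (m : ℝ), Continuous q → (∀ x, |q x| ≤ m) → GB (M * m) (fun x => ∫ w, q (x - w) * g w)) :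
    ∃ u, (∃ M, GB M u) ∧ ∀ x, μ * u x - trM 1 (Hs u x) = ∫ w, f (x - w) * g w := by
  let ε (n : ℕ) : ℝ := 1 / ((n : ℝ) + 1)
  have e0 : ∀ n, 0 < ε n := fun n => by positivity
  choose q hq hqm hqe using fun n => disc_solve (d := d) (e0 n) hμ hf hm
  let u (n : ℕ) (x : Eu d) : ℝ := ∫ w, q n (x - w) * g w
  have hu : ∀ n, GB (M * (m / μ)) (u n) := fun n => hM _ _ (hq n) (hqm n)
  obtain ⟨v, hv, hl⟩ := compact_GB (U := Filter.hyperfilter ℕ) hu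
  refine ⟨v, ⟨_, hv⟩, fun x => ?_⟩
  have ee : ∀ n, μ * u n x - ∑ i : Fin d, (u n (x + ε n • eb i) + u n (x - ε n • eb i) - 2 * u n x) / ε n ^ 2 =
      ∫ w, f (x - w) * g w := fun n => mo_disc hg hc (hq n) (hqe n) x
  have te : Filter.Tendsto (fun n => M * (m / μ) * √(ε n)) (Filter.hyperfilter ℕ) (nhds 0) := by
    have : Filter.Tendsto (fun n => M * (m / μ) * √(ε n)) Filter.atTop (nhds (M * (m / μ) * √0)) :=
      ((Real.continuous_sqrt.tendsto 0).comp tendsto_one_div_add_atTop_nhds_zero_nat).const_mul _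
    simpa using this.mono_left Nat.hyperfilter_le_atTop
  have t1 : ∀ i : Fin d, Filter.Tendsto (fun n => (u n (x + ε n • eb i) + u n (x - ε n • eb i) - 2 * u n x) / ε n ^ 2)
      (Filter.hyperfilter ℕ) (nhds (Hs v x (eb i) (eb i))) := by
    intro i
    have h1 : Filter.Tendsto (fun n => Hs (u n) x (eb i) (eb i)) (Filter.hyperfilter ℕ) (nhds (Hs v x (eb i) (eb i))) := by
      have h2 := ((ContinuousLinearMap.apply ℝ (Eu d →L[ℝ] ℝ) (eb i)).continuous.tendsto _).comp (hl x).2.2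
      exact ((ContinuousLinearMap.apply ℝ ℝ (eb i)).continuous.tendsto _).comp h2
    have h3 := squeeze_zero_norm (f := fun n => (u n (x + ε n • eb i) + u n (x - ε n • eb i) - 2 * u n x) / ε n ^ 2 - Hs (u n) x (eb i) (eb i)) (fun n => disc_err (hu n) (e0 n) x i) te
    simpa using h3.add h1
  have t2 := ((hl x).1.const_mul μ).sub (tendsto_finsetSum Finset.univ fun i _ => t1 i)
  rw [trM_one]
  refine tendsto_nhds_unique t2 ?_
  simp_rw [ee]
  exact tendsto_const_nhds

theorem base_solve {μ : ℝ} (hμ : 0 < μ) {f : Eu d → ℝ} {m F : ℝ} (hm : ∀ x, |f x| ≤ m)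
    (hF : ∀ x y, |f x - f y| ≤ F * √‖x - y‖) (F0 : 0 ≤ F) :
    ∃ u, (∃ M, GB M u) ∧ ∀ x, μ * u x - trM 1 (Hs u x) = f x := by
  have hf : Continuous f := by
    rw [continuous_iff_continuousAt]; intro x
    rw [ContinuousAt, tendsto_iff_dist_tendsto_zero]
    have : Filter.Tendsto (fun y => F * √‖y - x‖) (nhds x) (nhds 0) := by
      have : Continuous fun y => F * √‖y - x‖ := by fun_prop
      simpa using this.tendsto x
    exact squeeze_zero (fun _ => dist_nonneg) (fun y => hF y x) this
  have e0 : ∀ n : ℕ, (0:ℝ) < 1 / ((n : ℝ) + 1) := fun n => by positivity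
  choose g hg hc g0 gi gs M M0 hM using fun n => mol_exists d (e0 n)
  choose u hGB hu using fun n => base_step hμ hf hm (hg n) (hc n) (hM n)
  obtain ⟨C, C0, H⟩ := lin_est d (L := 1) (K := 1) le_rfl le_rfl hμ
  have hu2 : ∀ n, GB (C * (F + m)) (u n) := fun n => by
    refine H (fun _ => 1) ⟨fun _ => ell_one le_rfl, fun x y i j => by simp⟩ (u n) _ F m (hGB n) (hu n) (fun x => ?_) (fun x y => ?_) F0
    · exact mo_avg (hg n) (hc n) (g0 n) (gi n) fun w _ => hm _
    · rw [← integral_sub (mo_int (hg n) (hc n) hf x) (mo_int (hg n) (hc n) hf y)]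
      simp_rw [← sub_mul]
      refine mo_avg (hg n) (hc n) (g0 n) (gi n) fun w _ => ?_
      simpa using hF (x - w) (y - w)
  obtain ⟨v, hv, hl⟩ := compact_GB (U := Filter.hyperfilter ℕ) hu2
  refine ⟨v, ⟨_, hv⟩, fun x => ?_⟩
  have te : Filter.Tendsto (fun n : ℕ => F * √(1 / ((n : ℝ) + 1))) (Filter.hyperfilter ℕ) (nhds 0) := by
    have : Filter.Tendsto (fun n : ℕ => F * √(1 / ((n : ℝ) + 1))) Filter.atTop (nhds (F * √0)) :=
      ((Real.continuous_sqrt.tendsto 0).comp tendsto_one_div_add_atTop_nhds_zero_nat).const_mul _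
    simpa using this.mono_left Nat.hyperfilter_le_atTop
  have t1 : ∀ i : Fin d, Filter.Tendsto (fun n => Hs (u n) x (eb i) (eb i)) (Filter.hyperfilter ℕ) (nhds (Hs v x (eb i) (eb i))) := by
    intro i
    have h2 := ((ContinuousLinearMap.apply ℝ (Eu d →L[ℝ] ℝ) (eb i)).continuous.tendsto _).comp (hl x).2.2
    exact ((ContinuousLinearMap.apply ℝ ℝ (eb i)).continuous.tendsto _).comp h2
  have t2 := ((hl x).1.const_mul μ).sub (tendsto_finsetSum Finset.univ fun i _ => t1 i)
  have t3 : Filter.Tendsto (fun n => ∫ w, f (x - w) * g n w) (Filter.hyperfilter ℕ) (nhds (f x)) := by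
    have h3 := squeeze_zero_norm (f := fun n => (∫ w, f (x - w) * g n w) - f x) (fun n => ?_) te
    · simpa using h3.add_const (f x)
    · have e : f x = ∫ w, f x * g n w := by rw [integral_const_mul, gi]; ring
      have hi : Integrable (g n) := (hg n).integrable_of_hasCompactSupport (hc n)
      rw [e, ← integral_sub (mo_int (hg n) (hc n) hf x) (hi.const_mul _)]
      simp_rw [← sub_mul]
      refine mo_avg (hg n) (hc n) (g0 n) (gi n) fun w hw => (hF _ _).trans ?_
      gcongr
      simpa using (gs n w hw).le
  rw [trM_one]
  refine tendsto_nhds_unique t2 ?_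
  simp_rw [← trM_one, hu]
  exact t3
end

open Metric Set MeasureTheory
noncomputable section
variable {d : ℕ}

lemma trM_lin (A A' : Matrix (Fin d) (Fin d) ℝ) (s t : ℝ) (B : Bil d) :
    trM (s • A + t • A') B = s * trM A B + t * trM A' B := by
  simp only [trM, Finset.mul_sum, ← Finset.sum_add_distrib]
  exact Finset.sum_congr rfl fun i _ => Finset.sum_congr rfl fun j _ => by simp; ring

lemma trM_tend {ι : Type*} {l : Filter ι} {B : ι → Bil d} {B0 : Bil d} (A : Matrix (Fin d) (Fin d) ℝ)
    (h : Filter.Tendsto B l (nhds B0)) : Filter.Tendsto (fun n => trM A (B n)) l (nhds (trM A B0)) := by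
  refine tendsto_finsetSum _ fun i _ => tendsto_finsetSum _ fun j _ => Filter.Tendsto.const_mul _ ?_
  have h2 := ((ContinuousLinearMap.apply ℝ (Eu d →L[ℝ] ℝ) (eb i)).continuous.tendsto _).comp h
  exact ((ContinuousLinearMap.apply ℝ ℝ (eb j)).continuous.tendsto _).comp h2

lemma ell_entry {L : ℝ} (hL : 1 ≤ L) {A : Matrix (Fin d) (Fin d) ℝ} (hA : Ell L A) (i j : Fin d) : |A i j| ≤ L := by
  have L0 : 0 < L := by linarith
  have hp : ∀ z, 0 ≤ quadForm A z := fun z => le_trans (by positivity) (hA.2 z).1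
  obtain ⟨C, hC, rfl⟩ := sqA hA.1 hp
  have hs : ∀ k, C k j = C j k := fun k => hC.apply j k
  have hd : ∀ i, ∑ k, C i k ^ 2 ≤ L := fun i => by
    have := ell_diag hA i
    rw [Matrix.mul_apply] at this
    refine le_trans (le_of_eq (Finset.sum_congr rfl fun k _ => ?_)) this
    have : C k i = C i k := hC.apply i k
    rw [this]; ring
  rw [Matrix.mul_apply]
  have h1 : |∑ k, C i k * C k j| ≤ ∑ k, (C i k ^ 2 + C j k ^ 2) / 2 := by
    refine (Finset.abs_sum_le_sum_abs _ _).trans (Finset.sum_le_sum fun k _ => ?_)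
    rw [hs, abs_le]
    constructor <;> nlinarith [sq_nonneg (C i k + C j k), sq_nonneg (C i k - C j k)]
  refine h1.trans ?_
  rw [← Finset.sum_div, Finset.sum_add_distrib]
  linarith [hd i, hd j]

lemma coef_half {L K : ℝ} (hL : 1 ≤ L) (hK : 1 ≤ K) {a : Eu d → Matrix (Fin d) (Fin d) ℝ} (ha : Coef L K a)
    (x y : Eu d) (i j : Fin d) : |(a x - a y) i j| ≤ 2 * K * L * √‖x - y‖ := by
  have h1 := ha.2 x y i j
  have h2 := ell_entry hL (ha.1 x) i j
  have h3 := ell_entry hL (ha.1 y) i j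
  have h4 := abs_sub (a x i j) (a y i j)
  have hKL : 1 ≤ K * L := by nlinarith
  rw [Matrix.sub_apply]
  rcases le_total ‖x - y‖ 1 with h | h
  · have h5 : ‖x - y‖ ≤ √‖x - y‖ := Real.le_sqrt_of_sq_le (by nlinarith [norm_nonneg (x - y)])
    refine h1.trans (mul_le_mul ?_ h5 (norm_nonneg _) (by positivity))
    nlinarith
  · have h5 : 1 ≤ √‖x - y‖ := Real.one_le_sqrt.2 h
    have : 2 * K * L * 1 ≤ 2 * K * L * √‖x - y‖ := mul_le_mul_of_nonneg_left h5 (by positivity)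
    nlinarith

lemma GB_sub {u v : Eu d → ℝ} {M N : ℝ} (hu : GB M u) (hv : GB N v) : GB (M + N) (fun z => u z - v z) := by
  refine ⟨hu.1.sub hv.1, fun x => ⟨?_, ?_, ?_, fun y => ?_⟩⟩
  · exact (abs_sub _ _).trans (add_le_add (hu.2 x).1 (hv.2 x).1)
  · rw [D_sub hu.1 hv.1]; exact (norm_sub_le _ _).trans (add_le_add (hu.2 x).2.1 (hv.2 x).2.1)
  · rw [Hs_sub hu.1 hv.1]; exact (bil_sub_le _ _).trans (add_le_add (hu.2 x).2.2.1 (hv.2 x).2.2.1)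
  · rw [Hs_sub hu.1 hv.1, Hs_sub hu.1 hv.1, show Hs u y - Hs v y - (Hs u x - Hs v x) =
      (Hs u y - Hs u x) - (Hs v y - Hs v x) by abel, add_mul]
    exact (bil_sub_le _ _).trans (add_le_add ((hu.2 x).2.2.2 y) ((hv.2 x).2.2.2 y))

def TA (d : ℕ) (L K : ℝ) : ℝ := d ^ 2 * (L + 1) + d ^ 2 * (2 * K * L)

lemma TA_nn {L K : ℝ} (hL : 1 ≤ L) (hK : 1 ≤ K) : 0 ≤ TA d L K := by
  unfold TA; positivity

lemma T_bd {L K : ℝ} (hL : 1 ≤ L) (hK : 1 ≤ K) {a : Eu d → Matrix (Fin d) (Fin d) ℝ} (ha : Coef L K a)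
    {w : Eu d → ℝ} {N : ℝ} (hw : GB N w) : (∀ x, |trM (a x - 1) (Hs w x)| ≤ TA d L K * N) ∧
    ∀ x y, |trM (a x - 1) (Hs w x) - trM (a y - 1) (Hs w y)| ≤ TA d L K * N * √‖x - y‖ := by
  have N0 := GB_nn hw
  have h1 : ∀ x i j, |(a x - 1) i j| ≤ L + 1 := fun x i j => by
    have h2 : |(1 : Matrix (Fin d) (Fin d) ℝ) i j| ≤ 1 := by
      rw [Matrix.one_apply]; split_ifs <;> simp
    exact (abs_sub _ _).trans (add_le_add (ell_entry hL (ha.1 x) i j) h2)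
  have p1 : 0 ≤ (d : ℝ) ^ 2 * (2 * K * L) := by positivity
  constructor
  · intro x
    refine (trM_bd (h1 x) _).trans ?_
    unfold TA
    exact mul_le_mul (by linarith) (hw.2 x).2.2.1 (norm_nonneg _) (by positivity)
  · intro x y
    have e : trM (a x - 1) (Hs w x) - trM (a y - 1) (Hs w y) = trM (a x - 1) (Hs w x - Hs w y) + trM (a x - a y) (Hs w y) := by
      rw [trM_sub_right, trM_sub_left, trM_sub_left, trM_sub_left, trM_sub_left]; ring
    rw [e]
    have b1 := (trM_bd (h1 x) (Hs w x - Hs w y)).trans (mul_le_mul_of_nonneg_left ((hw.2 y).2.2.2 x) (by positivity))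
    have b2 := trM_bd (coef_half hL hK ha x y) (Hs w y)
    have b3 := mul_le_mul_of_nonneg_left (hw.2 y).2.2.1 (show 0 ≤ (d : ℝ) ^ 2 * (2 * K * L * √‖x - y‖) by positivity)
    refine (abs_add_le _ _).trans ?_
    unfold TA
    linarith

lemma coef_s {L K s : ℝ} (hL : 1 ≤ L) (hs : 0 ≤ s) (hs1 : s ≤ 1) {a : Eu d → Matrix (Fin d) (Fin d) ℝ} (ha : Coef L K a) :
    Coef L K (fun x => (1 - s) • (1 : Matrix (Fin d) (Fin d) ℝ) + s • a x) := by
  have hq : ∀ (A B : Matrix (Fin d) (Fin d) ℝ) (t : ℝ) z, quadForm ((1 - s) • A + s • B) z = (1 - s) * quadForm A z + s * quadForm B z := by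
    intro A B t z
    simp only [quadForm, Finset.mul_sum, ← Finset.sum_add_distrib]
    exact Finset.sum_congr rfl fun i _ => Finset.sum_congr rfl fun j _ => by simp; ring
  refine ⟨fun x => ⟨?_, fun z => ?_⟩, fun x y i j => ?_⟩
  · exact (Matrix.isSymm_one.smul _).add ((ha.1 x).1.smul _)
  · rw [hq _ _ 0]
    have h1 := (ell_one (d := d) hL).2 z
    have h2 := (ha.1 x).2 z
    constructor
    · have a1 := mul_le_mul_of_nonneg_left h1.1 (by linarith : 0 ≤ 1 - s)
      have a2 := mul_le_mul_of_nonneg_left h2.1 hs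
      linarith
    · have a1 := mul_le_mul_of_nonneg_left h1.2 (by linarith : 0 ≤ 1 - s)
      have a2 := mul_le_mul_of_nonneg_left h2.2 hs
      linarith
  · have := ha.2 x y i j
    simp only [Matrix.add_apply, Matrix.smul_apply, smul_eq_mul, add_sub_add_left_eq_sub, ← mul_sub]
    rw [abs_mul, abs_of_nonneg hs]
    nlinarith [abs_nonneg (a x i j - a y i j)]

def Solv (μ : ℝ) (a : Eu d → Matrix (Fin d) (Fin d) ℝ) : Prop := ∀ (f : Eu d → ℝ) (m F : ℝ), (∀ x, |f x| ≤ m) →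
    (∀ x y, |f x - f y| ≤ F * √‖x - y‖) → 0 ≤ F → ∃ u, (∃ M, GB M u) ∧ ∀ x, μ * u x - trM (a x) (Hs u x) = f x

lemma GB_zero : GB 0 (fun _ : Eu d => (0:ℝ)) := by
  refine ⟨contDiff_const, fun x => ?_⟩
  have : ∀ x, Hs (fun _ : Eu d => (0:ℝ)) x = 0 := fun x => by
    unfold Hs; simp
  simp [this]

lemma cont_step {L K μ C σ : ℝ} (hL : 1 ≤ L) (hK : 1 ≤ K)
    {a A : Eu d → Matrix (Fin d) (Fin d) ℝ} (ha : Coef L K a)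
    (H : ∀ (u f : Eu d → ℝ) (F m : ℝ), (∃ M, GB M u) → (∀ x, μ * u x - trM (A x) (Hs u x) = f x) →
      (∀ x, |f x| ≤ m) → (∀ x y, |f x - f y| ≤ F * √‖x - y‖) → 0 ≤ F → GB (C * (F + m)) u)
    (hσ : 4 * C * |σ| * TA d L K ≤ 1) (hS : Solv μ A) : Solv μ (fun x => A x + σ • (a x - 1)) := by
  intro f m F hm hF F0
  have A0 := TA_nn (d := d) hL hK
  have ex : ∀ w : {w : Eu d → ℝ // ∃ M, GB M w}, ∃ u : {w : Eu d → ℝ // ∃ M, GB M w},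
      ∀ x, μ * u.1 x - trM (A x) (Hs u.1 x) = f x + σ * trM (a x - 1) (Hs w.1 x) := by
    rintro ⟨w, M, hw⟩
    obtain ⟨b1, b2⟩ := T_bd hL hK ha hw
    have M0 := GB_nn hw
    obtain ⟨u, hu, he⟩ := hS (fun x => f x + σ * trM (a x - 1) (Hs w x)) (m + |σ| * (TA d L K * M)) (F + |σ| * (TA d L K * M))
      (fun x => (abs_add_le _ _).trans (add_le_add (hm x) (by rw [abs_mul]; gcongr; exact b1 x))) (fun x y => by
        rw [add_sub_add_comm, ← mul_sub, add_mul, mul_assoc |σ|]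
        exact (abs_add_le _ _).trans (add_le_add (hF x y) (by rw [abs_mul]; gcongr; exact b2 x y))) (by positivity)
    exact ⟨⟨u, hu⟩, he⟩
  choose S hS using ex
  let u (k : ℕ) : {w : Eu d → ℝ // ∃ M, GB M w} := S^[k] ⟨fun _ => 0, 0, GB_zero⟩
  have us : ∀ k, u (k + 1) = S (u k) := fun k => Function.iterate_succ_apply' _ _ _
  have ue : ∀ k x, μ * (u (k + 1)).1 x - trM (A x) (Hs (u (k + 1)).1 x) = f x + σ * trM (a x - 1) (Hs (u k).1 x) := by
    intro k; rw [us]; exact hS (u k)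
  have c2 : ∀ k, ContDiff ℝ 2 (u k).1 := fun k => (u k).2.choose_spec.1
  have gs : ∀ k, ∃ M, GB M (fun z => (u k).1 z - (u (k + 1)).1 z) := fun k => by
    obtain ⟨M, hM⟩ := (u k).2
    obtain ⟨N, hN⟩ := (u (k + 1)).2
    exact ⟨_, GB_sub hM hN⟩
  obtain ⟨N0, hN0⟩ := gs 0
  have n0 := GB_nn hN0
  have dk : ∀ k : ℕ, GB (N0 / 2 ^ k) (fun z => (u k).1 z - (u (k + 1)).1 z) := by
    intro k
    induction k with
    | zero => simpa using hN0
    | succ k ih =>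
      obtain ⟨b1, b2⟩ := T_bd hL hK ha ih
      have hp : 0 ≤ N0 / 2 ^ k := by positivity
      refine GB_mono ?_ (H _ (fun x => σ * trM (a x - 1) (Hs (fun z => (u k).1 z - (u (k + 1)).1 z) x)) (|σ| * (TA d L K * (N0 / 2 ^ k))) (|σ| * (TA d L K * (N0 / 2 ^ k))) (gs (k + 1))
        (fun x => ?_) (fun x => by rw [abs_mul]; gcongr; exact b1 x) (fun x y => by
          rw [← mul_sub, abs_mul, mul_assoc]; gcongr; exact b2 x y) (by positivity))
      · have := mul_le_mul_of_nonneg_right hσ hp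
        rw [pow_succ, ← div_div]
        linarith
      · have h1 := ue k x
        have h2 := ue (k + 1) x
        rw [Hs_sub (c2 _) (c2 _), Hs_sub (c2 _) (c2 _), trM_sub_right, trM_sub_right]
        linear_combination h1 - h2
  have uk : ∀ k : ℕ, GB (2 * N0 - N0 / 2 ^ k * 2) (u k).1 := by
    intro k
    induction k with
    | zero => 
      rw [show 2 * N0 - N0 / 2 ^ 0 * 2 = 0 by ring]; exact GB_zero
    | succ k ih =>
      have := GB_sub ih (dk k)
      rw [show (fun z => (u k).1 z - ((u k).1 z - (u (k + 1)).1 z)) = (u (k + 1)).1 by funext z; ring] at this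
      refine GB_mono (le_of_eq ?_) this
      rw [pow_succ]; field_simp; ring
  have uk2 : ∀ k : ℕ, GB (2 * N0) (u k).1 := fun k => by
    have : 0 ≤ N0 / 2 ^ k := by positivity
    exact GB_mono (by linarith) (uk k)
  obtain ⟨v, hv, hl⟩ := compact_GB (U := Filter.hyperfilter ℕ) uk2
  refine ⟨v, ⟨_, hv⟩, fun x => ?_⟩
  have te : Filter.Tendsto (fun k : ℕ => N0 / 2 ^ k) (Filter.hyperfilter ℕ) (nhds 0) := by
    have := (tendsto_pow_atTop_nhds_zero_of_lt_one (r := (1/2 : ℝ)) (by norm_num) (by norm_num)).const_mul N0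
    refine Filter.Tendsto.mono_left ?_ Nat.hyperfilter_le_atTop
    simpa [div_eq_mul_inv] using this
  have t1 := squeeze_zero_norm (f := fun k => (u k).1 x - (u (k + 1)).1 x) (fun k => ((dk k).2 x).1) te
  have t2 := squeeze_zero_norm (f := fun k => Hs (u k).1 x - Hs (u (k + 1)).1 x) (fun k => by
    rw [← Hs_sub (c2 _) (c2 _)]; exact ((dk k).2 x).2.2.1) te
  have t3 := (hl x).1.sub t1
  have t4 := (hl x).2.2.sub t2
  simp only [sub_sub_cancel, sub_zero] at t3 t4
  have t5 := (t3.const_mul μ).sub (trM_tend (A x) t4)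
  simp_rw [ue] at t5
  have t6 := ((trM_tend (a x - 1) (hl x).2.2).const_mul σ).const_add (f x)
  have := tendsto_nhds_unique t5 t6
  have e := trM_lin (A x) (a x - 1) 1 σ (Hs v x)
  simp only [one_smul, one_mul] at e
  rw [e]
  linarith

theorem lin_solve {L K μ : ℝ} (hL : 1 ≤ L) (hK : 1 ≤ K) (hμ : 0 < μ) {a : Eu d → Matrix (Fin d) (Fin d) ℝ}
    (ha : Coef L K a) : Solv μ a := by
  obtain ⟨C, C0, H⟩ := lin_est d hL hK hμ
  have A0 := TA_nn (d := d) hL hK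
  obtain ⟨n, hn⟩ := exists_nat_gt (4 * C * TA d L K)
  have n0 : (0:ℝ) < n := lt_of_le_of_lt (by positivity) hn
  have key : ∀ k : ℕ, k ≤ n → Solv μ (fun x => (1 - (k:ℝ) / n) • (1 : Matrix (Fin d) (Fin d) ℝ) + ((k:ℝ) / n) • a x) := by
    intro k
    induction k with
    | zero =>
      intro _ f m F hm hF F0
      simpa using base_solve hμ hm hF F0
    | succ k ih =>
      intro hk
      have hk' : ((k:ℝ)) + 1 ≤ n := by exact_mod_cast hk
      have := cont_step (σ := 1 / (n:ℝ)) hL hK ha (H _ (coef_s hL (s := (k:ℝ) / n) (by positivity) (by rw [div_le_one n0]; linarith) ha)) (by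
        rw [abs_of_pos (by positivity)]
        rw [show 4 * C * (1 / (n:ℝ)) * TA d L K = (4 * C * TA d L K) / n by ring, div_le_one n0]; exact hn.le) (ih (by omega))
      convert this using 2 with x
      push_cast
      module
  have := key n le_rfl
  rw [div_self n0.ne'] at this
  simpa using this
end

open Metric Set MeasureTheory
noncomputable section
variable {d : ℕ} {U : Type*}

def Dat (B M K : ℝ) (b : Eu d → U → Eu d) (r : Eu d → U → ℝ) : Prop :=
  (∀ x u, ‖b x u‖ ≤ B) ∧ (∀ x u, |r x u| ≤ M) ∧ (∀ x y u, ‖b x u - b y u‖ ≤ K * ‖x - y‖) ∧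
    ∀ x y u, |r x u - r y u| ≤ K * ‖x - y‖

lemma bdB {g : U → ℝ} {c : ℝ} (h : ∀ u, c ≤ g u) : BddBelow (range g) :=
  ⟨c, by rintro _ ⟨u, rfl⟩; exact h u⟩

lemma inf_lip [Nonempty U] {g h : U → ℝ} {c c' c'' : ℝ} (hg : ∀ u, c' ≤ g u) (hh : ∀ u, c'' ≤ h u)
    (H : ∀ u, |g u - h u| ≤ c) : |(⨅ u, g u) - ⨅ u, h u| ≤ c := by
  rw [abs_le]
  constructor
  · have : (⨅ u, h u) - c ≤ ⨅ u, g u := le_ciInf fun u => by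
      have := ciInf_le (bdB hh) u
      linarith [(abs_le.1 (H u)).1]
    linarith
  · have : (⨅ u, g u) - c ≤ ⨅ u, h u := le_ciInf fun u => by
      have := ciInf_le (bdB hg) u
      linarith [(abs_le.1 (H u)).2]
    linarith

lemma inf_dec [Nonempty U] {l : Filter ℕ} [l.NeBot] {g : ℕ → U → ℝ} {h : U → ℝ} {c ℓ : ℝ} (hh : ∀ u, c ≤ h u)
    (hd : ∀ k u, h u ≤ g k u) (ht : ∀ u, Filter.Tendsto (fun k => g k u) l (nhds (h u)))
    (hi : Filter.Tendsto (fun k => ⨅ u, g k u) l (nhds ℓ)) : ℓ = ⨅ u, h u := by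
  refine le_antisymm (le_ciInf fun u => ?_) ?_
  · exact le_of_tendsto_of_tendsto' hi (ht u) fun k => ciInf_le (bdB fun u => (hh u).trans (hd k u)) u
  · exact ge_of_tendsto' hi fun k => ciInf_mono (bdB hh) (hd k)

lemma ent_up {s t : ℝ} (hs : 0 < s) (ht : 0 < t) :
    t * Real.log t - s * Real.log s ≤ (t - s) * (Real.log t + 1) := by
  have := Real.log_le_sub_one_of_pos (div_pos ht hs)
  rw [Real.log_div ht.ne' hs.ne'] at this
  have h2 := mul_le_mul_of_nonneg_left this hs.le
  rw [mul_sub s (t / s), mul_div_cancel₀ _ hs.ne'] at h2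
  linarith

lemma ent_lip {E s t : ℝ} (hs : s ∈ Icc (Real.exp (-E)) (Real.exp E)) (ht : t ∈ Icc (Real.exp (-E)) (Real.exp E)) :
    |s * Real.log s - t * Real.log t| ≤ (E + 1) * |s - t| := by
  have s0 : 0 < s := (Real.exp_pos _).trans_le hs.1
  have t0 : 0 < t := (Real.exp_pos _).trans_le ht.1
  have ls := (Real.le_log_iff_exp_le s0).2 hs.1
  have ls' := (Real.log_le_iff_le_exp s0).2 hs.2
  have lt := (Real.le_log_iff_exp_le t0).2 ht.1
  have lt' := (Real.log_le_iff_le_exp t0).2 ht.2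
  have h1 := ent_up s0 t0
  have h2 := ent_up t0 s0
  rw [abs_le]
  rcases abs_cases (s - t) with ⟨e, h⟩ | ⟨e, h⟩ <;> rw [e] <;> constructor <;> nlinarith

lemma ent_mono {E M δ s t : ℝ} (hδ : 0 < δ) (hE : δ * E = M) (hs : 0 < s) (hst : s ≤ t) (ht : t ≤ Real.exp E) :
    (M + δ) * s - δ * (s * Real.log s) ≤ (M + δ) * t - δ * (t * Real.log t) := by
  have t0 := hs.trans_le hst
  have lt' := (Real.log_le_iff_le_exp t0).2 ht
  have h1 := (ent_up hs t0).trans (mul_le_mul_of_nonneg_left (add_le_add_left lt' 1) (by linarith))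
  have := mul_le_mul_of_nonneg_left h1 hδ.le
  rw [← hE]
  linarith

lemma lip_half {f : Eu d → ℝ} {m Λ : ℝ} (hm : ∀ x, |f x| ≤ m) (h : ∀ x y, |f x - f y| ≤ Λ * ‖x - y‖) (L0 : 0 ≤ Λ)
    (x y : Eu d) : |f x - f y| ≤ (Λ + 2 * m) * √‖x - y‖ := by
  have m0 : 0 ≤ m := (abs_nonneg _).trans (hm 0)
  rcases le_total ‖x - y‖ 1 with h1 | h1
  · have h2 : ‖x - y‖ ≤ √‖x - y‖ := Real.le_sqrt_of_sq_le (by nlinarith [norm_nonneg (x - y)])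
    exact (h x y).trans (mul_le_mul (by linarith) h2 (norm_nonneg _) (by linarith))
  · have h2 : 1 ≤ √‖x - y‖ := Real.one_le_sqrt.2 h1
    have h3 := abs_sub (f x) (f y)
    have := mul_le_mul_of_nonneg_left h2 (by linarith : 0 ≤ Λ + 2 * m)
    linarith [hm x, hm y]

def hh (M δ ε : ℝ) (b : Eu d → U → Eu d) (r : Eu d → U → ℝ) (ψ : Eu d → ℝ) (x : Eu d) : ℝ :=
  (⨅ u, (ψ (x + ε • b x u) / ε + (r x u + M) * ψ x)) + ((M + δ) * ψ x - δ * (ψ x * Real.log (ψ x)))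

section eps
variable {B M K δ ε E : ℝ} {b : Eu d → U → Eu d} {r : Eu d → U → ℝ}

lemma hh_mono [Nonempty U] (hD : Dat B M K b r) (hδ : 0 < δ) (hε : 0 < ε) (hE : δ * E = M) {ψ φ : Eu d → ℝ}
    (h0 : ∀ x, 0 < ψ x) (h1 : ∀ x, ψ x ≤ φ x) (h2 : ∀ x, φ x ≤ Real.exp E) (x : Eu d) :
    hh M δ ε b r ψ x ≤ hh M δ ε b r φ x := by
  have p : ∀ u, 0 ≤ r x u + M := fun u => by linarith [(abs_le.1 (hD.2.1 x u)).1]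
  refine add_le_add (ciInf_mono (bdB (c := 0) fun u => ?_) fun u => ?_) (ent_mono hδ hE (h0 x) (h1 x) (h2 x))
  · have := p u; have := h0 x; have := h0 (x + ε • b x u); positivity
  · refine add_le_add ?_ (mul_le_mul_of_nonneg_left (h1 x) (p u))
    gcongr; exact h1 _

lemma hh_top [Nonempty U] (hD : Dat B M K b r) (hε : 0 < ε) (hE : δ * E = M) (x : Eu d) :
    hh M δ ε b r (fun _ => Real.exp E) x ≤ (1 / ε + 2 * M + δ) * Real.exp E := by
  have u0 := Classical.arbitrary U
  have h1 := ciInf_le (bdB (g := fun u => Real.exp E / ε + (r x u + M) * Real.exp E) (c := 0) fun u => by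
    have p : 0 ≤ r x u + M := by linarith [(abs_le.1 (hD.2.1 x u)).1]
    positivity) u0
  have h2 := mul_le_mul_of_nonneg_right (abs_le.1 (hD.2.1 x u0)).2 (Real.exp_pos E).le
  unfold hh
  rw [Real.log_exp]
  have : δ * (Real.exp E * E) = M * Real.exp E := by rw [← hE]; ring
  rw [this]
  have e : (1 / ε + 2 * M + δ) * Real.exp E = Real.exp E / ε + 2 * M * Real.exp E + δ * Real.exp E := by ring
  rw [e]
  linarith

lemma hh_bot [Nonempty U] (hD : Dat B M K b r) (hE : δ * E = M) (x : Eu d) :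
    (1 / ε + 2 * M + δ) * Real.exp (-E) ≤ hh M δ ε b r (fun _ => Real.exp (-E)) x := by
  have h1 : Real.exp (-E) / ε ≤ ⨅ u, (Real.exp (-E) / ε + (r x u + M) * Real.exp (-E)) := le_ciInf fun u => by
    have p : 0 ≤ r x u + M := by linarith [(abs_le.1 (hD.2.1 x u)).1]
    have : 0 ≤ (r x u + M) * Real.exp (-E) := by positivity
    linarith
  unfold hh
  rw [Real.log_exp]
  have : δ * (Real.exp (-E) * -E) = - (M * Real.exp (-E)) := by rw [← hE]; ring
  rw [this]
  have e : (1 / ε + 2 * M + δ) * Real.exp (-E) = Real.exp (-E) / ε + 2 * M * Real.exp (-E) + δ * Real.exp (-E) := by ring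
  rw [e]
  linarith

lemma shift_lip (hD : Dat B M K b r) (hε : 0 ≤ ε) (hε1 : ε ≤ 1) (hK : 0 ≤ K) (x y : Eu d) (u : U) :
    ‖x + ε • b x u - (y + ε • b y u)‖ ≤ (1 + K) * ‖x - y‖ := by
  rw [show x + ε • b x u - (y + ε • b y u) = (x - y) + ε • (b x u - b y u) by rw [smul_sub]; abel]
  refine (norm_add_le _ _).trans ?_
  rw [norm_smul, Real.norm_of_nonneg hε]
  have h1 := mul_le_mul hε1 (hD.2.2.1 x y u) (norm_nonneg _) zero_le_one
  linarith

lemma mulsub_bd {p q s t P S k l : ℝ} (h1 : |p - q| ≤ k) (h2 : |s - t| ≤ l) (hp : |p| ≤ P) (ht : |t| ≤ S) (l0 : 0 ≤ l) (k0 : 0 ≤ k) :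
    |p * s - q * t| ≤ P * l + k * S := by
  rw [show p * s - q * t = p * (s - t) + (p - q) * t by ring]
  refine (abs_add_le _ _).trans (add_le_add ?_ ?_)
  · rw [abs_mul]; exact mul_le_mul hp h2 (abs_nonneg _) ((abs_nonneg _).trans hp)
  · rw [abs_mul]; exact mul_le_mul h1 ht (abs_nonneg _) k0

lemma hh_lip [Nonempty U] (hD : Dat B M K b r) (hδ : 0 < δ) (hε : 0 < ε) (hε1 : ε ≤ 1) (hK : 0 ≤ K) (hM : 0 ≤ M)
    (hE : δ * E = M) {ψ : Eu d → ℝ} {N : ℝ} (hN : GB N ψ) (hb : ∀ x, ψ x ∈ Icc (Real.exp (-E)) (Real.exp E)) (x y : Eu d) :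
    |hh M δ ε b r ψ x - hh M δ ε b r ψ y| ≤ (((1 + K) / ε + 2 * M + 2 * (M + δ)) * N + K * Real.exp E) * ‖x - y‖ := by
  have N0 := GB_nn hN
  have ps : ∀ x, 0 < ψ x := fun x => (Real.exp_pos _).trans_le (hb x).1
  have p : ∀ x u, 0 ≤ r x u + M := fun x u => by linarith [(abs_le.1 (hD.2.1 x u)).1]
  have nn := norm_nonneg (x - y)
  have b0 : ∀ x u, 0 ≤ ψ (x + ε • b x u) / ε + (r x u + M) * ψ x := fun x u => by
    have := p x u; have := ps x; have := ps (x + ε • b x u); positivity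
  have h1 := inf_lip (c := ((1 + K) / ε * N + 2 * M * N + K * Real.exp E) * ‖x - y‖) (b0 x) (b0 y) (fun u => by
    have a1 : |ψ (x + ε • b x u) / ε - ψ (y + ε • b y u) / ε| ≤ (1 + K) / ε * N * ‖x - y‖ := by
      rw [← sub_div, abs_div, abs_of_pos hε, div_le_iff₀ hε]
      refine (GB_lip hN _ _).trans ((mul_le_mul_of_nonneg_left (shift_lip hD hε.le hε1 hK x y u) N0).trans (le_of_eq ?_))
      field_simp
    have a2 := mulsub_bd (p := r x u + M) (q := r y u + M) (s := ψ x) (t := ψ y) (P := 2 * M) (S := Real.exp E)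
      (k := K * ‖x - y‖) (l := N * ‖x - y‖)
      ((congrArg abs (add_sub_add_right_eq_sub _ _ _)).le.trans (hD.2.2.2 x y u)) (GB_lip hN x y)
      (by rw [abs_of_nonneg (p x u)]; linarith [(abs_le.1 (hD.2.1 x u)).2]) (by rw [abs_of_pos (ps y)]; exact (hb y).2)
      (by positivity) (by positivity)
    rw [abs_le] at *
    constructor <;> linarith [a1.1, a1.2, a2.1, a2.2])
  have h2 := ent_lip (hb x) (hb y)
  have h3 := GB_lip hN x y
  have E0 : 0 ≤ E + 1 := by
    have : 0 ≤ E := by by_contra! h; nlinarith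
    linarith
  have h4 := mul_le_mul_of_nonneg_left (h2.trans (mul_le_mul_of_nonneg_left h3 E0)) hδ.le
  have h5 := mul_le_mul_of_nonneg_left h3 (by positivity : 0 ≤ M + δ)
  rw [← abs_of_pos hδ, ← abs_mul, abs_of_pos hδ] at h4
  rw [← abs_of_nonneg (by positivity : 0 ≤ M + δ), ← abs_mul, abs_of_nonneg (by positivity : 0 ≤ M + δ)] at h5
  have e : δ * ((E + 1) * (N * ‖x - y‖)) = (M + δ) * (N * ‖x - y‖) := by rw [← hE]; ring
  rw [e] at h4
  unfold hh
  rw [abs_le] at *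
  constructor <;> linarith [h1.1, h1.2, h4.1, h4.2, h5.1, h5.2]

lemma const_c2 (c : ℝ) : ContDiff ℝ 2 (fun _ : Eu d => c) := contDiff_const

lemma Hs_const (c : ℝ) (x : Eu d) : Hs (fun _ : Eu d => c) x = 0 := by unfold Hs; simp

lemma GB_const {c : ℝ} (hc : 0 ≤ c) : GB c (fun _ : Eu d => c) := by
  refine ⟨contDiff_const, fun x => ?_⟩
  simp [Hs_const, abs_of_nonneg hc, hc]
  intro y; positivity

lemma cmpP {L μ : ℝ} (hL : 1 ≤ L) (hμ : 0 < μ) {a : Eu d → Matrix (Fin d) (Fin d) ℝ} (hE : ∀ x, Ell L (a x))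
    {u v : Eu d → ℝ} (hu : ∃ N, GB N u) (hv : ∃ N, GB N v) 
    (h : ∀ x, μ * u x - trM (a x) (Hs u x) ≤ μ * v x - trM (a x) (Hs v x)) (x : Eu d) : u x ≤ v x := by
  obtain ⟨N, hN⟩ := hu
  obtain ⟨N', hN'⟩ := hv
  have hs := GB_sub hN hN'
  have := maxP hL hE hs.1 (fun x => (hs.2 x).1) hμ (c := 0) (fun x => by
    rw [Hs_sub hN.1 hN'.1, trM_sub_right]; linarith [h x]) x
  by_contra! hc
  have := mul_pos hμ (sub_pos.2 hc)
  linarith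
end eps
end

open Metric Set MeasureTheory
noncomputable section
variable {d : ℕ} {U : Type*}
section eps
variable {L B M K δ ε E : ℝ} {b : Eu d → U → Eu d} {r : Eu d → U → ℝ} {a : Eu d → Matrix (Fin d) (Fin d) ℝ}

lemma eps_step [Nonempty U] (hL : 1 ≤ L) (hK : 1 ≤ K) (ha : Coef L K a) (hD : Dat B M K b r) (hδ : 0 < δ)
    (hε : 0 < ε) (hε1 : ε ≤ 1) (hM : 0 ≤ M) (hE : δ * E = M) (hE0 : 0 ≤ E) {ψ : Eu d → ℝ} (hN : ∃ N, GB N ψ)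
    (hb : ∀ x, ψ x ∈ Icc (Real.exp (-E)) (Real.exp E)) :
    ∃ φ : Eu d → ℝ, ((∃ N, GB N φ) ∧ ∀ x, φ x ∈ Icc (Real.exp (-E)) (Real.exp E)) ∧
      ∀ x, (1 / ε + 2 * M + δ) * φ x - trM (a x) (Hs φ x) = hh M δ ε b r ψ x := by
  obtain ⟨N, hN⟩ := hN
  have hμ : 0 < 1 / ε + 2 * M + δ := by positivity
  have N0 := GB_nn hN
  have ps : ∀ x, 0 < ψ x := fun x => (Real.exp_pos _).trans_le (hb x).1
  have up : ∀ x, hh M δ ε b r ψ x ≤ (1 / ε + 2 * M + δ) * Real.exp E := fun x =>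
    (hh_mono hD hδ hε hE ps (fun x => (hb x).2) (fun _ => le_rfl) x).trans (hh_top hD hε hE x)
  have dn : ∀ x, (1 / ε + 2 * M + δ) * Real.exp (-E) ≤ hh M δ ε b r ψ x := fun x =>
    (hh_bot hD hE x).trans (hh_mono hD hδ hε hE (fun _ => Real.exp_pos _) (fun x => (hb x).1) (fun x => (hb x).2) x)
  have ab : ∀ x, |hh M δ ε b r ψ x| ≤ (1 / ε + 2 * M + δ) * Real.exp E := fun x => by
    rw [abs_of_nonneg (le_trans (by positivity) (dn x))]; exact up x
  obtain ⟨φ, hφ, hq⟩ := lin_solve hL hK hμ ha _ _ _ ab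
    (lip_half ab (hh_lip hD hδ hε hε1 (by linarith) hM hE hN hb) (by positivity)) (by positivity)
  have cc : ∀ c : ℝ, 0 ≤ c → ∃ N, GB N (fun _ : Eu d => c) := fun c h => ⟨c, GB_const h⟩
  have ct : ∀ (c : ℝ) (x : Eu d), trM (a x) (Hs (fun _ : Eu d => c) x) = 0 := fun c x => by
    rw [Hs_const]; simp [trM]
  refine ⟨φ, ⟨hφ, fun x => ⟨?_, ?_⟩⟩, hq⟩
  · exact cmpP hL hμ ha.1 (cc _ (Real.exp_pos (-E)).le) hφ (fun x => by rw [ct, hq]; linarith [dn x]) x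
  · exact cmpP hL hμ ha.1 hφ (cc _ (Real.exp_pos E).le) (fun x => by rw [ct, hq]; linarith [up x]) x

lemma eps_bd [Nonempty U] (hL : 1 ≤ L) (hK : 1 ≤ K) (ha : Coef L K a) (hD : Dat B M K b r) (hδ : 0 < δ)
    (hε : 0 < ε) (hε1 : ε ≤ 1) (hM : 0 ≤ M) (hE : δ * E = M) : ∃ N, Real.exp E ≤ N ∧ ∀ ψ φ : Eu d → ℝ,
    GB N ψ → (∀ x, ψ x ∈ Icc (Real.exp (-E)) (Real.exp E)) → (∃ N, GB N φ) →
    (∀ x, φ x ∈ Icc (Real.exp (-E)) (Real.exp E)) →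
    (∀ x, (1 / ε + 2 * M + δ) * φ x - trM (a x) (Hs φ x) = hh M δ ε b r ψ x) → GB N φ := by
  obtain ⟨C, C0, hC⟩ := global_est d hL hK
  have K0 : 0 ≤ K := by linarith
  obtain ⟨μ, hμd⟩ : ∃ μ, μ = 1 / ε + 2 * M + δ := ⟨_, rfl⟩
  obtain ⟨A, hAd⟩ : ∃ A, A = (1 + K) / ε + 2 * M + 2 * (M + δ) := ⟨_, rfl⟩
  have hμ : 0 ≤ μ := by rw [hμd]; positivity
  have hA : 0 ≤ A := by rw [hAd]; positivity
  have pη : 0 < 1 / (4 * (μ + A + 1)) := by positivity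
  obtain ⟨Cη, Cη0, hη⟩ := hC _ pη
  obtain ⟨η, hηd⟩ : ∃ η, η = 1 / (4 * (μ + A + 1)) := ⟨_, rfl⟩
  rw [← hηd] at pη hη
  have eμ : η * μ ≤ 1 / 4 := by rw [hηd, div_mul_eq_mul_div, div_le_iff₀ (by positivity)]; linarith
  have eA : η * A ≤ 1 / 4 := by rw [hηd, div_mul_eq_mul_div, div_le_iff₀ (by positivity)]; linarith
  have ex := Real.exp_pos E
  obtain ⟨Q, hQ⟩ : ∃ Q, Q = Cη * Real.exp E + η * (K * Real.exp E) := ⟨_, rfl⟩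
  have Q0 : 0 ≤ Q := by rw [hQ]; positivity
  refine ⟨4 * Q + Real.exp E, by linarith, fun ψ φ hψ hψb hφ hφb hq => ?_⟩
  rw [← hμd] at hq
  have e1 : 2 * ((4 * Q + Real.exp E) / 4 + Q) ≤ 4 * Q + Real.exp E := by linarith
  refine GB_mono e1 (GB_absorb (by positivity) hφ fun N hN => ?_)
  have N0 := GB_nn hN
  have L0 : 0 ≤ μ * N + (A * (4 * Q + Real.exp E) + K * Real.exp E) := by positivity
  have := hη a ha φ 0 (μ * N + (A * (4 * Q + Real.exp E) + K * Real.exp E)) (Real.exp E) ⟨N, hN⟩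
    (fun x => by rw [abs_of_pos ((Real.exp_pos _).trans_le (hφb x).1)]; exact (hφb x).2) le_rfl L0 (fun x y => by
      have h1 := hh_lip hD hδ hε hε1 K0 hM hE hψ hψb x y
      rw [← hAd] at h1
      have h2 := mul_le_mul_of_nonneg_left (GB_lip hN x y) hμ
      rw [← abs_of_nonneg hμ, ← abs_mul, abs_of_nonneg hμ] at h2
      have h3 := hq x
      have h4 := hq y
      rw [abs_le] at *
      constructor <;> linarith [h1.1, h1.2, h2.1, h2.2])
  refine GB_mono ?_ this
  have p1 := mul_le_mul_of_nonneg_right eμ N0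
  have p2 := mul_le_mul_of_nonneg_right eA (by positivity : 0 ≤ 4 * Q + Real.exp E)
  have e2 : η * (μ * N + (A * (4 * Q + Real.exp E) + K * Real.exp E)) =
    η * μ * N + η * A * (4 * Q + Real.exp E) + η * (K * Real.exp E) := by ring
  rw [e2]
  linarith

lemma eps_solve [Nonempty U] (hL : 1 ≤ L) (hK : 1 ≤ K) (ha : Coef L K a) (hD : Dat B M K b r) (hδ : 0 < δ)
    (hε : 0 < ε) (hε1 : ε ≤ 1) (hM : 0 ≤ M) (hE : δ * E = M) (hE0 : 0 ≤ E) :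
    ∃ ψ : Eu d → ℝ, (∃ N, GB N ψ) ∧ (∀ x, ψ x ∈ Icc (Real.exp (-E)) (Real.exp E)) ∧
      ∀ x, trM (a x) (Hs ψ x) + (⨅ u, ((ψ (x + ε • b x u) - ψ x) / ε + r x u * ψ x)) =
        δ * (ψ x * Real.log (ψ x)) := by
  have hμ : 0 < 1 / ε + 2 * M + δ := by positivity
  have st := fun ψ : {ψ : Eu d → ℝ // (∃ N, GB N ψ) ∧ ∀ x, ψ x ∈ Icc (Real.exp (-E)) (Real.exp E)} =>
    eps_step hL hK ha hD hδ hε hε1 hM hE hE0 ψ.2.1 ψ.2.2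
  choose S hS hS2 using st
  obtain ⟨N, eN, hN⟩ := eps_bd hL hK ha hD hδ hε hε1 hM hE
  have tb : ∀ x : Eu d, Real.exp E ∈ Icc (Real.exp (-E)) (Real.exp E) := fun _ =>
    ⟨Real.exp_le_exp.2 (by linarith), le_rfl⟩
  obtain ⟨s, s0, s1⟩ : ∃ s : ℕ → {ψ : Eu d → ℝ // (∃ N, GB N ψ) ∧ ∀ x, ψ x ∈ Icc (Real.exp (-E)) (Real.exp E)},
      (s 0).1 = (fun _ => Real.exp E) ∧ ∀ k, (s (k + 1)).1 = S (s k) :=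
    ⟨fun k => Nat.rec ⟨fun _ => Real.exp E, ⟨_, GB_const (Real.exp_pos E).le⟩, tb⟩ (fun _ ψ => ⟨S ψ, hS ψ⟩) k,
      rfl, fun _ => rfl⟩
  have sq : ∀ k x, (1 / ε + 2 * M + δ) * (s (k + 1)).1 x - trM (a x) (Hs (s (k + 1)).1 x) = hh M δ ε b r (s k).1 x :=
    fun k x => by rw [s1]; exact hS2 (s k) x
  have sp : ∀ k x, 0 < (s k).1 x := fun k x => (Real.exp_pos _).trans_le ((s k).2.2 x).1
  have dec : ∀ k x, (s (k + 1)).1 x ≤ (s k).1 x := by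
    intro k
    induction k with
    | zero => exact fun x => by rw [s0]; exact ((s (0 + 1)).2.2 x).2
    | succ k ih =>
      refine cmpP hL hμ ha.1 (s (k + 1 + 1)).2.1 (s (k + 1)).2.1 fun x =>
        (sq (k + 1) x).le.trans (le_trans ?_ (sq k x).ge)
      exact hh_mono hD hδ hε hE (sp (k + 1)) ih (fun x => ((s k).2.2 x).2) x
  have gb : ∀ k, GB N (s k).1 := by
    intro k
    induction k with
    | zero => rw [s0]; exact GB_mono eN (GB_const (Real.exp_pos E).le)
    | succ k ih => exact hN _ _ ih (s k).2.2 (s (k + 1)).2.1 (s (k + 1)).2.2 (sq k)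
  have anti : ∀ x, Antitone fun k => (s k).1 x := fun x => antitone_nat_of_succ_le fun k => dec k x
  obtain ⟨v, hv, hl⟩ := compact_GB fun k => gb (k + 1)
  have lim : ∀ x, Filter.Tendsto (fun k => (s k).1 x) Filter.atTop (nhds (v x)) := fun x => by
    have h1 := tendsto_atTop_ciInf (anti x) (bdB fun k => ((s k).2.2 x).1)
    have h2 := (h1.comp (Filter.tendsto_add_atTop_nat 1)).mono_left Nat.hyperfilter_le_atTop
    rw [tendsto_nhds_unique (hl x).1 h2]; exact h1
  have vle : ∀ k x, v x ≤ (s k).1 x := fun k x => (anti x).le_of_tendsto (lim x) k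
  have vb : ∀ x, v x ∈ Icc (Real.exp (-E)) (Real.exp E) := fun x =>
    isClosed_Icc.mem_of_tendsto (lim x) (Filter.Eventually.of_forall fun k => (s k).2.2 x)
  refine ⟨v, ⟨N, hv⟩, vb, fun x => ?_⟩
  have vp : ∀ x, 0 < v x := fun x => (Real.exp_pos _).trans_le (vb x).1
  have p : ∀ u, 0 ≤ r x u + M := fun u => by linarith [(abs_le.1 (hD.2.1 x u)).1]
  have lim' := fun x => (lim x).mono_left Nat.hyperfilter_le_atTop
  have t1 := ((hl x).1.const_mul (1 / ε + 2 * M + δ)).sub (trM_tend (a x) (hl x).2.2)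
  have t2 : Filter.Tendsto (fun k => (M + δ) * (s k).1 x - δ * ((s k).1 x * Real.log ((s k).1 x)))
      (Filter.hyperfilter ℕ) (nhds ((M + δ) * v x - δ * (v x * Real.log (v x)))) :=
    ((lim' x).const_mul _).sub (((Real.continuous_mul_log.tendsto (v x)).comp (lim' x)).const_mul δ)
  have t3 : Filter.Tendsto (fun k => ⨅ u, ((s k).1 (x + ε • b x u) / ε + (r x u + M) * (s k).1 x))
      (Filter.hyperfilter ℕ) (nhds _) := (t1.sub t2).congr fun k => by
    rw [sq k x]; unfold hh; ring
  have key := inf_dec (c := 0) (h := fun u => v (x + ε • b x u) / ε + (r x u + M) * v x)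
    (fun u => by have := p u; have := vp x; have := vp (x + ε • b x u); positivity)
    (fun k u => add_le_add (div_le_div_of_nonneg_right (vle k _) hε.le) (mul_le_mul_of_nonneg_left (vle k x) (p u)))
    (fun u => ((lim' _).div_const ε).add ((lim' x).const_mul _)) t3
  have e : ∀ u, (v (x + ε • b x u) - v x) / ε + r x u * v x =
      (v (x + ε • b x u) / ε + (r x u + M) * v x) + - ((1 / ε + M) * v x) := fun u => by ring
  simp_rw [e]
  rw [← ciInf_add (bdB (c := 0) fun u => by
    have := p u; have := vp x; have := vp (x + ε • b x u); positivity), ← key]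
  ring
end eps
end

open Metric Set MeasureTheory
noncomputable section
variable {d : ℕ} {U : Type*}
section eps
variable {L B M K δ ε E : ℝ} {b : Eu d → U → Eu d} {r : Eu d → U → ℝ} {a : Eu d → Matrix (Fin d) (Fin d) ℝ}

lemma quot_lip (hD : Dat B M K b r) (hε : 0 < ε) (hε1 : ε ≤ 1) (hK : 0 ≤ K) (hB : 0 ≤ B) {ψ : Eu d → ℝ} {N : ℝ}
    (hN : GB N ψ) (x y : Eu d) (u : U) :
    |(ψ (x + ε • b x u) - ψ x) / ε - (ψ (y + ε • b y u) - ψ y) / ε| ≤ N * ((1 + K) * B + K) * ‖x - y‖ := by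
  have N0 := GB_nn hN
  have hd : ∀ t ∈ Icc (0 : ℝ) ε, HasDerivWithinAt (fun t => ψ (x + t • b x u) - ψ (y + t • b y u))
      (fderiv ℝ ψ (x + t • b x u) (b x u) - fderiv ℝ ψ (y + t • b y u) (b y u)) (Icc 0 ε) t := fun t _ =>
    ((line1 hN.1 x (b x u) t).sub (line1 hN.1 y (b y u) t)).hasDerivWithinAt
  have bd : ∀ t ∈ Icc (0 : ℝ) ε, ‖fderiv ℝ ψ (x + t • b x u) (b x u) - fderiv ℝ ψ (y + t • b y u) (b y u)‖ ≤
      N * ((1 + K) * B + K) * ‖x - y‖ := fun t ht => by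
    have e : fderiv ℝ ψ (x + t • b x u) (b x u) - fderiv ℝ ψ (y + t • b y u) (b y u) =
      (fderiv ℝ ψ (x + t • b x u) - fderiv ℝ ψ (y + t • b y u)) (b x u) + fderiv ℝ ψ (y + t • b y u) (b x u - b y u) := by
      rw [sub_apply, map_sub]; ring
    rw [e]
    have h1 := lipDu hN.1 (x := y + t • b y u) (y := x + t • b x u) fun z _ => (hN.2 z).2.2.1
    have h2 := shift_lip hD ht.1 (ht.2.trans hε1) hK x y u
    have h3 := h1.trans (mul_le_mul_of_nonneg_left h2 N0)
    have h4 := (ContinuousLinearMap.le_opNorm (fderiv ℝ ψ (x + t • b x u) - fderiv ℝ ψ (y + t • b y u)) (b x u)).trans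
      (mul_le_mul h3 (hD.1 x u) (norm_nonneg _) (by positivity))
    have h5 := (ContinuousLinearMap.le_opNorm (fderiv ℝ ψ (y + t • b y u)) (b x u - b y u)).trans
      (mul_le_mul (hN.2 _).2.1 (hD.2.2.1 x y u) (norm_nonneg _) N0)
    refine (norm_add_le _ _).trans ((add_le_add h4 h5).trans (le_of_eq (by ring)))
  have := (convex_Icc (0 : ℝ) ε).norm_image_sub_le_of_norm_hasDerivWithin_le hd bd (left_mem_Icc.2 hε.le) (right_mem_Icc.2 hε.le)
  simp only [zero_smul, add_zero, Real.norm_eq_abs, sub_zero, abs_of_pos hε] at this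
  rw [← sub_div, abs_div, abs_of_pos hε, div_le_iff₀ hε]
  refine le_trans (le_of_eq ?_) this
  congr 1; ring

lemma quot_bd (hD : Dat B M K b r) (hε : 0 < ε) {ψ : Eu d → ℝ} {N : ℝ}
    (hN : GB N ψ) (x : Eu d) (u : U) : |(ψ (x + ε • b x u) - ψ x) / ε - fderiv ℝ ψ x (b x u)| ≤ ε * (N * B * B) := by
  have N0 := GB_nn hN
  have h := tayU hN.1 (x := x) (y := x + ε • b x u) fun z _ => (hN.2 z).2.2.1
  rw [add_sub_cancel_left, norm_smul, Real.norm_of_nonneg hε.le, map_smul, smul_eq_mul, Real.norm_eq_abs] at h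
  have e : (ψ (x + ε • b x u) - ψ x) / ε - fderiv ℝ ψ x (b x u) =
    (ψ (x + ε • b x u) - ψ x - ε * fderiv ℝ ψ x (b x u)) / ε := by field_simp
  rw [e, abs_div, abs_of_pos hε, div_le_iff₀ hε]
  refine h.trans ?_
  have := mul_le_mul (hD.1 x u) (hD.1 x u) (norm_nonneg _) ((norm_nonneg _).trans (hD.1 x u))
  have := mul_le_mul_of_nonneg_left this (by positivity : 0 ≤ ε * ε * N)
  linarith

lemma quot_ge (hD : Dat B M K b r) (hε : 0 < ε) {ψ : Eu d → ℝ} {N : ℝ} (hM : 0 ≤ M)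
    (hN : GB N ψ) (x : Eu d) (u : U) : -(N * B + M * N) ≤ (ψ (x + ε • b x u) - ψ x) / ε + r x u * ψ x := by
  have N0 := GB_nn hN
  have h := GB_lip hN (x + ε • b x u) x
  rw [add_sub_cancel_left, norm_smul, Real.norm_of_nonneg hε.le] at h
  have h1 : |(ψ (x + ε • b x u) - ψ x) / ε| ≤ N * B := by
    rw [abs_div, abs_of_pos hε, div_le_iff₀ hε]
    have := mul_le_mul_of_nonneg_left (hD.1 x u) (by positivity : 0 ≤ N * ε)
    linarith
  have h2 : |r x u * ψ x| ≤ M * N := by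
    rw [abs_mul]; exact mul_le_mul (hD.2.1 x u) (hN.2 x).1 (abs_nonneg _) hM
  linarith [(abs_le.1 h1).1, (abs_le.1 h2).1]

lemma lin_ge (hD : Dat B M K b r) {ψ : Eu d → ℝ} (x : Eu d) (u : U) :
    -(‖fderiv ℝ ψ x‖ * B + M * |ψ x|) ≤ fderiv ℝ ψ x (b x u) + r x u * ψ x := by
  have h1 := (ContinuousLinearMap.le_opNorm (fderiv ℝ ψ x) (b x u)).trans
    (mul_le_mul_of_nonneg_left (hD.1 x u) (norm_nonneg _))
  have h2 : |r x u * ψ x| ≤ M * |ψ x| := by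
    rw [abs_mul]; exact mul_le_mul_of_nonneg_right (hD.2.1 x u) (abs_nonneg _)
  rw [Real.norm_eq_abs] at h1
  linarith [(abs_le.1 h1).1, (abs_le.1 h2).1]

lemma delta_bd [Nonempty U] (hL : 1 ≤ L) (hK : 1 ≤ K) (ha : Coef L K a) (hD : Dat B M K b r) (hδ : 0 < δ)
    (hM : 0 ≤ M) (hB : 0 ≤ B) (hE : δ * E = M) (hE0 : 0 ≤ E) : ∃ N, ∀ ε, 0 < ε → ε ≤ 1 → ∀ ψ : Eu d → ℝ,
    (∃ N, GB N ψ) → (∀ x, ψ x ∈ Icc (Real.exp (-E)) (Real.exp E)) →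
    (∀ x, trM (a x) (Hs ψ x) + (⨅ u, ((ψ (x + ε • b x u) - ψ x) / ε + r x u * ψ x)) =
        δ * (ψ x * Real.log (ψ x))) → GB N ψ := by
  obtain ⟨C, C0, hC⟩ := global_est d hL hK
  have K0 : 0 ≤ K := by linarith
  obtain ⟨Θ, hΘ⟩ : ∃ Θ, Θ = ((1 + K) * B + K) + M + (M + δ) := ⟨_, rfl⟩
  have Θ0 : 0 < Θ := by rw [hΘ]; positivity
  obtain ⟨Cη, Cη0, hη⟩ := hC (1 / (2 * Θ)) (by positivity)
  have ex := Real.exp_pos E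
  refine ⟨2 * (Cη * Real.exp E + 1 / (2 * Θ) * (K * Real.exp E)), fun ε hε hε1 ψ hψ hb hq => ?_⟩
  refine GB_absorb (by positivity) hψ fun N hN => ?_
  have N0 := GB_nn hN
  have ps : ∀ x, 0 < ψ x := fun x => (Real.exp_pos _).trans_le (hb x).1
  have := hη a ha ψ 0 (Θ * N + K * Real.exp E) (Real.exp E) hψ
    (fun x => by rw [abs_of_pos (ps x)]; exact (hb x).2) le_rfl (by positivity) (fun x y => by
      have h1 := inf_lip (c := (N * ((1 + K) * B + K) + M * N + K * Real.exp E) * ‖x - y‖)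
        (quot_ge hD hε hM hN x) (quot_ge hD hε hM hN y) (fun u => by
          have a1 := quot_lip hD hε hε1 K0 hB hN x y u
          have a2 := mulsub_bd (hD.2.2.2 x y u) (GB_lip hN x y) (hD.2.1 x u)
            (by rw [abs_of_pos (ps y)]; exact (hb y).2 : |ψ y| ≤ Real.exp E) (by positivity) (by positivity)
          rw [abs_le] at *
          constructor <;> linarith [a1.1, a1.2, a2.1, a2.2])
      have h2 := ent_lip (hb x) (hb y)
      have h4 := mul_le_mul_of_nonneg_left (h2.trans (mul_le_mul_of_nonneg_left (GB_lip hN x y) (by linarith))) hδ.le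
      rw [← abs_of_pos hδ, ← abs_mul, abs_of_pos hδ] at h4
      have e : δ * ((E + 1) * (N * ‖x - y‖)) = (M + δ) * (N * ‖x - y‖) := by rw [← hE]; ring
      rw [e] at h4
      have h5 := hq x
      have h6 := hq y
      have e2 : (Θ * N + K * Real.exp E) * ‖x - y‖ = (N * ((1 + K) * B + K) + M * N + K * Real.exp E) * ‖x - y‖ +
        (M + δ) * (N * ‖x - y‖) := by rw [hΘ]; ring
      rw [e2]
      rw [abs_le] at *
      constructor <;> linarith [h1.1, h1.2, h4.1, h4.2])
  refine GB_mono (le_of_eq ?_) this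
  field_simp
  ring

theorem delta_solve [Nonempty U] (hL : 1 ≤ L) (hK : 1 ≤ K) (ha : Coef L K a) (hD : Dat B M K b r) (hδ : 0 < δ)
    (hM : 0 ≤ M) (hB : 0 ≤ B) (hE : δ * E = M) (hE0 : 0 ≤ E) :
    ∃ ψ : Eu d → ℝ, (∃ N, GB N ψ) ∧ (∀ x, ψ x ∈ Icc (Real.exp (-E)) (Real.exp E)) ∧
      ∀ x, trM (a x) (Hs ψ x) + (⨅ u, (fderiv ℝ ψ x (b x u) + r x u * ψ x)) =
        δ * (ψ x * Real.log (ψ x)) := by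
  obtain ⟨N, hN⟩ := delta_bd hL hK ha hD hδ hM hB hE hE0
  have en : ∀ n : ℕ, (0 : ℝ) < 1 / ((n : ℝ) + 1) ∧ 1 / ((n : ℝ) + 1) ≤ 1 := fun n =>
    ⟨by positivity, by rw [div_le_one (by positivity)]; linarith [Nat.cast_nonneg (α := ℝ) n]⟩
  have := fun n => eps_solve hL hK ha hD hδ (en n).1 (en n).2 hM hE hE0
  choose s s1 s2 s3 using this
  have gb := fun n => hN _ (en n).1 (en n).2 _ (s1 n) (s2 n) (s3 n)
  obtain ⟨v, hv, hl⟩ := compact_GB (U := Filter.hyperfilter ℕ) gb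
  refine ⟨v, ⟨N, hv⟩, fun x => isClosed_Icc.mem_of_tendsto (hl x).1 (Filter.Eventually.of_forall fun k => s2 k x), fun x => ?_⟩
  have t1 := trM_tend (a x) (hl x).2.2
  have t2 := ((Real.continuous_mul_log.tendsto (v x)).comp (hl x).1).const_mul δ
  have t0 : Filter.Tendsto (fun n : ℕ => 1 / ((n : ℝ) + 1) * (N * B * B) + ‖fderiv ℝ (s n) x - fderiv ℝ v x‖ * B +
      M * |s n x - v x|) (Filter.hyperfilter ℕ) (nhds 0) := by
    have c1 := ((tendsto_one_div_add_atTop_nhds_zero_nat (𝕜 := ℝ)).mono_left Nat.hyperfilter_le_atTop).mul_const (N * B * B)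
    have c2 := (tendsto_iff_norm_sub_tendsto_zero.1 (hl x).2.1).mul_const B
    have c3 := (tendsto_iff_norm_sub_tendsto_zero.1 (hl x).1).const_mul M
    simpa using (c1.add c2).add c3
  have t3 : Filter.Tendsto (fun n => ⨅ u, ((s n (x + (1 / ((n : ℝ) + 1)) • b x u) - s n x) / (1 / ((n : ℝ) + 1)) + r x u * s n x))
      (Filter.hyperfilter ℕ) (nhds (⨅ u, (fderiv ℝ v x (b x u) + r x u * v x))) := by
    rw [tendsto_iff_norm_sub_tendsto_zero]
    refine squeeze_zero (fun n => norm_nonneg _) (fun n => ?_) t0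
    refine inf_lip (quot_ge hD (en n).1 hM (gb n) x) (lin_ge hD x) fun u => ?_
    have h1 := quot_bd hD (en n).1 (gb n) x u
    have h2 := (ContinuousLinearMap.le_opNorm (fderiv ℝ (s n) x - fderiv ℝ v x) (b x u)).trans
      (mul_le_mul_of_nonneg_left (hD.1 x u) (norm_nonneg _))
    rw [sub_apply, Real.norm_eq_abs] at h2
    have h3 := mul_le_mul_of_nonneg_right (hD.2.1 x u) (abs_nonneg (s n x - v x))
    rw [← abs_mul, mul_sub] at h3
    rw [abs_le] at *
    constructor <;> linarith [h1.1, h1.2, h2.1, h2.2, h3.1, h3.2]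
  exact tendsto_nhds_unique ((t1.add t3).congr fun n => s3 n x) t2
end eps
end

open Metric Set MeasureTheory
noncomputable section
variable {d : ℕ} {U : Type*}

structure LocD (D : Set (Eu d)) (L K B M : ℝ) (a : Eu d → Matrix (Fin d) (Fin d) ℝ)
    (b : Eu d → U → Eu d) (r : Eu d → U → ℝ) : Prop where
  ell : ∀ x ∈ D, Ell L (a x)
  al : ∀ x ∈ D, ∀ y ∈ D, ∀ i j, |a x i j - a y i j| ≤ K * ‖x - y‖
  bb : ∀ x ∈ D, ∀ u, ‖b x u‖ ≤ B
  rb : ∀ x ∈ D, ∀ u, |r x u| ≤ M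
  bl : ∀ x ∈ D, ∀ y ∈ D, ∀ u, ‖b x u - b y u‖ ≤ K * ‖x - y‖
  rl : ∀ x ∈ D, ∀ y ∈ D, ∀ u, |r x u - r y u| ≤ K * ‖x - y‖

lemma LocD.mono {D D' : Set (Eu d)} {L K B M : ℝ} {a : Eu d → Matrix (Fin d) (Fin d) ℝ}
    {b : Eu d → U → Eu d} {r : Eu d → U → ℝ} (h : LocD D L K B M a b r) (s : D' ⊆ D) : LocD D' L K B M a b r :=
  ⟨fun x hx => h.ell x (s hx), fun x hx y hy => h.al x (s hx) y (s hy), fun x hx => h.bb x (s hx),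
    fun x hx => h.rb x (s hx), fun x hx y hy => h.bl x (s hx) y (s hy), fun x hx y hy => h.rl x (s hx) y (s hy)⟩

def Gt (a : Eu d → Matrix (Fin d) (Fin d) ℝ) (b : Eu d → U → Eu d) (r : Eu d → U → ℝ) (ψ : Eu d → ℝ) (x : Eu d) : ℝ :=
  trM (a x) (Hs ψ x) + ⨅ u, (fderiv ℝ ψ x (b x u) + r x u * ψ x)

lemma ent_lip2 {δ C s t : ℝ} (d0 : 0 ≤ δ) (d1 : δ ≤ 1) (hs : 0 < s) (ht : 0 < t) (h1 : |δ * Real.log s| ≤ C)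
    (h2 : |δ * Real.log t| ≤ C) : |δ * (s * Real.log s) - δ * (t * Real.log t)| ≤ (C + 1) * |s - t| := by
  have e1 := mul_le_mul_of_nonneg_left (ent_up hs ht) d0
  have e2 := mul_le_mul_of_nonneg_left (ent_up ht hs) d0
  have f : ∀ l, |δ * l| ≤ C → |(s - t) * (δ * l + δ)| ≤ (C + 1) * |s - t| := fun l hl => by
    rw [abs_mul, mul_comm]
    refine mul_le_mul_of_nonneg_right ((abs_add_le _ _).trans ?_) (abs_nonneg _)
    rw [abs_of_nonneg d0]; linarith
  have f1 := f _ h1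
  have f2 := f _ h2
  rw [abs_le] at *
  constructor <;> linarith [f1.1, f1.2, f2.1, f2.2]

lemma lin_ge2 {B M q : ℝ} {β : U → Eu d} {ρ : U → ℝ} (hb : ∀ u, ‖β u‖ ≤ B) (hr : ∀ u, |ρ u| ≤ M) (l : Eu d →L[ℝ] ℝ) 
    (u : U) : -(‖l‖ * B + M * |q|) ≤ l (β u) + ρ u * q := by
  have h1 := (ContinuousLinearMap.le_opNorm l (β u)).trans (mul_le_mul_of_nonneg_left (hb u) (norm_nonneg _))
  have h2 : |ρ u * q| ≤ M * |q| := by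
    rw [abs_mul]; exact mul_le_mul_of_nonneg_right (hr u) (abs_nonneg _)
  rw [Real.norm_eq_abs] at h1
  linarith [(abs_le.1 h1).1, (abs_le.1 h2).1]

section loc
variable {L K B M Cc : ℝ} {a : Eu d → Matrix (Fin d) (Fin d) ℝ} {b : Eu d → U → Eu d} {r : Eu d → U → ℝ}

/-- Lipschitz bound of the right side on a convex set. -/
lemma rhs_lip [Nonempty U] {D : Set (Eu d)} (hD : LocD D L K B M a b r) {δ m Γ H : ℝ} {ψ : Eu d → ℝ} (hψ : ContDiff ℝ 2 ψ)
    (ps : ∀ x, 0 < ψ x) (hm : ∀ x ∈ D, ψ x ≤ m) (hΓ : ∀ x ∈ D, ‖fderiv ℝ ψ x‖ ≤ Γ)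
    (d0 : 0 ≤ δ) (d1 : δ ≤ 1) (hc : ∀ x ∈ D, |δ * Real.log (ψ x)| ≤ Cc) (hK : 0 ≤ K) (hM : 0 ≤ M) (hC : 0 ≤ Cc)
    (hq : ∀ x ∈ D, Gt a b r ψ x = δ * (ψ x * Real.log (ψ x))) {p q : Eu d} (hp : p ∈ D) (hqq : q ∈ D)
    (hs : segment ℝ q p ⊆ D) (hH : ∀ z ∈ segment ℝ q p, ‖Hs ψ z‖ ≤ H) :
    |trM (a p) (Hs ψ p) - trM (a q) (Hs ψ q)| ≤ (B * H + (Cc + 1 + K + M) * Γ + K * m) * ‖p - q‖ := by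
  have nn := norm_nonneg (p - q)
  have l1 : |ψ p - ψ q| ≤ Γ * ‖p - q‖ := lipU hψ fun z hz => hΓ z (hs hz)
  have l2 : ‖fderiv ℝ ψ p - fderiv ℝ ψ q‖ ≤ H * ‖p - q‖ := lipDu hψ hH
  have Γ0 : 0 ≤ Γ := (norm_nonneg _).trans (hΓ p hp)
  have H0 : 0 ≤ H := (norm_nonneg _).trans (hH q (left_mem_segment _ _ _))
  have h1 := inf_lip (c := (B * H + (K + M) * Γ + K * m) * ‖p - q‖) (lin_ge2 (q := ψ p) (hD.bb p hp) (hD.rb p hp) (fderiv ℝ ψ p))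
    (lin_ge2 (q := ψ q) (hD.bb q hqq) (hD.rb q hqq) (fderiv ℝ ψ q)) (fun u => by
      have a2 := mulsub_bd (hD.rl p hp q hqq u) l1 (hD.rb p hp u)
            (by rw [abs_of_pos (ps q)]; exact hm q hqq : |ψ q| ≤ m) (by positivity) (by positivity)
      have e : fderiv ℝ ψ p (b p u) - fderiv ℝ ψ q (b q u) =
        (fderiv ℝ ψ p - fderiv ℝ ψ q) (b p u) + fderiv ℝ ψ q (b p u - b q u) := by
        rw [sub_apply, map_sub]; ring
      have h4 := (ContinuousLinearMap.le_opNorm (fderiv ℝ ψ p - fderiv ℝ ψ q) (b p u)).trans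
        (mul_le_mul l2 (hD.bb p hp u) (norm_nonneg _) (by positivity))
      have h5 := (ContinuousLinearMap.le_opNorm (fderiv ℝ ψ q) (b p u - b q u)).trans
        (mul_le_mul (hΓ q hqq) (hD.bl p hp q hqq u) (norm_nonneg _) Γ0)
      rw [Real.norm_eq_abs] at h4 h5
      rw [abs_le] at *
      constructor <;> linarith [h4.1, h4.2, h5.1, h5.2, a2.1, a2.2])
  have h2 := (ent_lip2 d0 d1 (ps p) (ps q) (hc p hp) (hc q hqq)).trans (mul_le_mul_of_nonneg_left l1 (by positivity))
  have h3 := hq p hp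
  have h4 := hq q hqq
  unfold Gt at h3 h4
  rw [abs_le] at *
  constructor <;> linarith [h1.1, h1.2, h2.1, h2.2]

lemma gc_k (G B : ℝ) (hG : 0 ≤ G) (hB : 0 ≤ B) (d : ℕ) : ∃ k, 0 < k ∧ k ≤ 1 / 3 ∧ 16 * d ^ 2 * G * k ≤ 1 ∧ 16 * G * B * k ≤ 1 := by
  have h1 : 0 ≤ 16 * (d : ℝ) ^ 2 * G := by positivity
  have h2 : 0 ≤ 16 * G * B := by positivity
  refine ⟨1 / (3 + 16 * d ^ 2 * G + 16 * G * B), by positivity, ?_, ?_, ?_⟩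
  · exact one_div_le_one_div_of_le (by norm_num) (by linarith)
  · rw [mul_one_div, div_le_one (by positivity)]; linarith
  · rw [mul_one_div, div_le_one (by positivity)]; linarith

theorem loc_sch [Nonempty U] (d : ℕ) (hL : 1 ≤ L) (hK : 0 ≤ K) (hB : 0 ≤ B) (hM : 0 ≤ M) (hC : 0 ≤ Cc) :
    ∃ C, 0 ≤ C ∧ ∀ (a : Eu d → Matrix (Fin d) (Fin d) ℝ) (b : Eu d → U → Eu d) (r : Eu d → U → ℝ) (x0 : Eu d)
      (t g m δ : ℝ) (ψ : Eu d → ℝ), 0 < t → t ≤ 1 → K * t ≤ 1 → LocD (ball x0 t) L K B M a b r → (∃ N, GB N ψ) →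
      (∀ x, 0 < ψ x) → (∀ x ∈ ball x0 t, ψ x ≤ m) → (∀ x ∈ ball x0 t, ‖fderiv ℝ ψ x‖ ≤ m * g / t) → 1 ≤ g → 0 ≤ δ → δ ≤ 1 →
      (∀ x ∈ ball x0 t, |δ * Real.log (ψ x)| ≤ Cc) → (∀ x ∈ ball x0 t, Gt a b r ψ x = δ * (ψ x * Real.log (ψ x))) →
      PN ψ x0 t (C * (g * m)) := by
  obtain ⟨G, hGd⟩ : ∃ G, G = GC d L := ⟨_, rfl⟩
  have hG : 0 ≤ G := by rw [hGd]; exact GC_nn d L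
  obtain ⟨k, k0, k1, k2, k3⟩ := gc_k G B hG hB d
  refine ⟨2 * (2 * G * (1 / k ^ 5 + 2 * k * (Cc + 1 + 2 * K + M))), by positivity,
    fun a b r x0 t g m δ ψ ht ht1 hKt hD hN ps hm hΓ hg d0 d1 hc hq => ?_⟩
  obtain ⟨N0, hN0⟩ := hN
  have cen : x0 ∈ ball x0 t := mem_ball_self ht
  have m0 : 0 ≤ m := (ps x0).le.trans (hm x0 cen)
  have gm : m ≤ g * m := by have := mul_le_mul_of_nonneg_right hg m0; linarith
  rw [show 2 * (2 * G * (1 / k ^ 5 + 2 * k * (Cc + 1 + 2 * K + M))) * (g * m) =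
    2 * (2 * G * (1 / k ^ 5 + 2 * k * (Cc + 1 + 2 * K + M)) * (g * m)) by ring]
  refine absorb (P := PN ψ x0 t) (fun _ _ h => PN_mono h) (fun _ => PN_cl) (by positivity)
    ⟨N0, GB_nn hN0, PN_of_GB hN0 ht1 x0⟩ fun N hN hPN => ?_
  have S := schauder hN0.1 (m := m) (F0 := 0) (L1 := 2 * B * N + (Cc + 1 + 2 * K + M) * (g * m)) hL hKt hD.ell hD.al
    (fun x hx y hy => by
      have := hm x hx; have := hm y hy; have := ps x; have := ps y
      rw [abs_le]; constructor <;> linarith) m0 le_rfl (by positivity) (fun x s hs hsx p q hp hq' => ?_)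
    ⟨N0, GB_nn hN0, PN_of_GB hN0 ht1 x0⟩ k0 k1 (by rw [← hGd]; exact k2)
  · refine PN_mono ?_ S
    rw [← hGd]
    have e1 := mul_le_mul_of_nonneg_right k3 hN
    have e2 : G * (m / k ^ 5) ≤ G * (1 / k ^ 5 * (g * m)) := by
      refine mul_le_mul_of_nonneg_left ?_ hG
      rw [div_eq_mul_one_div, mul_comm]
      exact mul_le_mul_of_nonneg_left gm (by positivity)
    linarith
  · have st : s ^ 2 ≤ t := by linarith [norm_nonneg (x - x0)]
    have s2 : 0 < s ^ 2 := by positivity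
    have inb : ∀ z, ‖z - x‖ ≤ s ^ 2 / 4 → 3 / 4 * s ^ 2 ≤ t - ‖z - x0‖ := fun z hz => by
      have := norm_sub_le_norm_sub_add_norm_sub z x x0
      linarith
    have inB : ∀ z, ‖z - x‖ ≤ s ^ 2 / 4 → z ∈ ball x0 t := fun z hz => by
      rw [mem_ball_iff_norm]; linarith [inb z hz]
    have seg : ∀ z ∈ segment ℝ q p, ‖z - x‖ ≤ s ^ 2 / 4 := fun z hz => by
      have := (convex_closedBall x (s ^ 2 / 4)).segment_subset (mem_closedBall_iff_norm.2 hq') (mem_closedBall_iff_norm.2 hp) hz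
      exact mem_closedBall_iff_norm.1 this
    have s1 : s ^ 2 ≤ 1 := st.trans ht1
    have main := rhs_lip hD (H := 2 * N / s ^ 4) hN0.1 ps hm hΓ d0 d1 hc hK hM hC hq (inB p hp) (inB q hq')
      (fun z hz => inB z (seg z hz)) (fun z hz => by
        have h1 := inb z (seg z hz)
        have h2 := (hPN z (√(t - ‖z - x0‖)) (Real.sqrt_pos.2 (by linarith)) (Real.sq_sqrt (by linarith))).1
        rw [show √(t - ‖z - x0‖) ^ 4 = (√(t - ‖z - x0‖) ^ 2) ^ 2 by ring, Real.sq_sqrt (by linarith)] at h2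
        rw [le_div_iff₀ (by positivity)]
        have h3 := mul_le_mul h1 h1 (by positivity) (by linarith)
        have h4 := mul_le_mul_of_nonneg_right h3 (norm_nonneg (Hs ψ z))
        have h5 : 0 ≤ ‖Hs ψ z‖ * s ^ 4 := by positivity
        nlinarith)
    refine main.trans ?_
    rw [zero_div, zero_mul, zero_add]
    refine mul_le_mul_of_nonneg_right ?_ (norm_nonneg _)
    have i4 : 1 / s ^ 4 ≤ 1 / s ^ 6 := one_div_le_one_div_of_le (by positivity) (by nlinarith [pow_pos s2 2])
    have i2 : 1 / t ≤ 1 / s ^ 6 := one_div_le_one_div_of_le (by positivity) (by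
      have : (s ^ 2) ^ 2 ≤ 1 := by nlinarith
      nlinarith)
    have i0 : 1 ≤ 1 / s ^ 6 := by
      rw [le_one_div (by norm_num) (by positivity)]
      have : (s ^ 2) ^ 3 ≤ 1 := pow_le_one₀ (by positivity) s1
      linarith
    have j1 := mul_le_mul_of_nonneg_left i4 (by positivity : 0 ≤ 2 * B * N)
    have j2 := mul_le_mul_of_nonneg_left i2 (by positivity : 0 ≤ (Cc + 1 + K + M) * (g * m))
    have j3 := mul_le_mul_of_nonneg_left (mul_le_mul gm i0 zero_le_one (by positivity)) hK
    have e : (2 * B * N + (Cc + 1 + 2 * K + M) * (g * m)) / s ^ 6 = 2 * B * N * (1 / s ^ 6) +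
      (Cc + 1 + K + M) * (g * m) * (1 / s ^ 6) + K * (g * m * (1 / s ^ 6)) := by ring
    have e' : B * (2 * N / s ^ 4) + (Cc + 1 + K + M) * (m * g / t) + K * m = 2 * B * N * (1 / s ^ 4) +
      (Cc + 1 + K + M) * (g * m) * (1 / t) + K * (m * 1) := by ring
    rw [e, e']
    linarith
end loc
end

open Metric Set MeasureTheory
noncomputable section
variable {d : ℕ} {U : Type*}

/-- Scaled gradient bound for a frozen operator. -/
lemma lg_lin (d : ℕ) {L : ℝ} (hL : 1 ≤ L) : ∃ ρ θ : ℝ, 1 ≤ ρ ∧ 0 < θ ∧ ∀ (A : Matrix (Fin d) (Fin d) ℝ), Ell L A →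
    ∀ (ψ : Eu d → ℝ) (x : Eu d) (r : ℝ), ContDiff ℝ 2 ψ → (∀ x, 0 < ψ x) → 0 < r →
    (∀ y, ‖y - x‖ ≤ ρ * r / 2 → r ^ 2 * |trM A (Hs ψ y)| ≤ θ * ψ x) → r * ‖fderiv ℝ ψ x‖ ≤ ψ x / 2 := by
  have kv := KV_nn (d := d)
  obtain ⟨S, hS⟩ : ∃ S, S = √L := ⟨_, rfl⟩
  have S1 : 1 ≤ S := by rw [hS]; exact Real.one_le_sqrt.2 hL
  obtain ⟨Q, hQ⟩ : ∃ Q, Q = 3 * KV d * S := ⟨_, rfl⟩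
  have Q0 : 0 ≤ Q := by rw [hQ]; positivity
  obtain ⟨q, hq⟩ : ∃ q, q = 4 * Q * (2 ^ d + 1) + 1 := ⟨_, rfl⟩
  have q0 : 1 ≤ q := by rw [hq]; have : 0 ≤ 4 * Q * (2 ^ d + 1) := by positivity
                        linarith
  obtain ⟨θ, hθ⟩ : ∃ θ, θ = 1 / (4 * Q * q + (2 ^ d + 1) * KV d * (2 * q) ^ 2 + 1) := ⟨_, rfl⟩
  have θ0 : 0 < θ := by rw [hθ]; positivity
  have z1 : 0 ≤ 4 * Q * q := by positivity
  have z2 : 0 ≤ (2 ^ d + 1) * KV d * (2 * q) ^ 2 := by positivity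
  have t1 : 4 * Q * q * θ ≤ 1 := by rw [hθ, mul_one_div, div_le_one (by positivity)]; linarith
  have t2 : (2 ^ d + 1) * KV d * (2 * q) ^ 2 * θ ≤ 1 := by rw [hθ, mul_one_div, div_le_one (by positivity)]; linarith
  refine ⟨8 * S * q, θ, by nlinarith, θ0, fun A hA ψ x r hψ ps hr h => ?_⟩
  obtain ⟨T, T1, T2, T3⟩ := sqrtM hL hA
  rw [← hS] at T1 T2
  have c2 : ContDiff ℝ 2 fun y => ψ (x + (r • (T : Eu d →L[ℝ] Eu d)) y) :=
    hψ.comp (contDiff_const.add (r • (T : Eu d →L[ℝ] Eu d)).contDiff)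
  have vL : ∀ y, Lap (fun y => ψ (x + (r • (T : Eu d →L[ℝ] Eu d)) y)) y = r ^ 2 * trM A (Hs ψ (x + r • T y)) := fun y => by
    rw [← T3, Finset.mul_sum]
    refine Finset.sum_congr rfl fun i _ => (Hs_comp hψ (r • (T : Eu d →L[ℝ] Eu d)) x y (eb i) (eb i)).trans ?_
    simp only [smul_apply, ContinuousLinearEquiv.coe_coe, map_smul, smul_eq_mul]
    ring
  have v0 : ψ (x + (r • (T : Eu d →L[ℝ] Eu d)) 0) = ψ x := by simp
  have bL : ∀ y, ‖y‖ ≤ 2 * (2 * q) → |Lap (fun y => ψ (x + (r • (T : Eu d →L[ℝ] Eu d)) y)) y| ≤ θ * ψ x := fun y hy => by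
    rw [vL, abs_mul, abs_of_pos (by positivity : 0 < r ^ 2)]
    refine h _ ?_
    rw [add_sub_cancel_left, norm_smul, Real.norm_of_nonneg hr.le]
    have := mul_le_mul_of_nonneg_left ((T1 y).trans (mul_le_mul_of_nonneg_left hy (by linarith))) hr.le
    linarith
  have px := ps x
  have up : ∀ y, ‖y‖ ≤ q → ψ (x + (r • (T : Eu d →L[ℝ] Eu d)) y) ≤ (2 ^ d + 1) * ψ x := fun y hy => by
    have := Hk c2 (fun y => (ps _).le) (t := 2 * q) (by linarith) bL y (by linarith)
    simp only [v0] at this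
    have h2 := mul_le_mul_of_nonneg_right t2 px.le
    linarith
  have pd : (0 : ℝ) < 2 ^ d := by positivity
  have g := E1 c2 (r := q) (ω := (2 ^ d + 1) * ψ x) (θ := θ * ψ x) (by linarith) (fun y hy => by
    have h1 := up y hy
    have h2 := ps (x + (r • (T : Eu d →L[ℝ] Eu d)) y)
    have h3 : 0 < 2 ^ d * ψ x := by positivity
    simp only [v0]
    rw [abs_le]; constructor <;> linarith) (fun y hy => bL y (by linarith))
  have f1 : Q * ((2 ^ d + 1) * ψ x / q + q * (θ * ψ x)) ≤ ψ x / 2 := by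
    have e1 : Q * ((2 ^ d + 1) * ψ x / q) ≤ ψ x / 4 := by
      rw [← mul_div_assoc, div_le_iff₀ (by linarith), hq]
      linarith
    have e2 := mul_le_mul_of_nonneg_right t1 px.le
    linarith
  have : ‖fderiv ℝ ψ x‖ ≤ ψ x / 2 / r := by
    refine ContinuousLinearMap.opNorm_le_bound _ (by positivity) fun e => ?_
    have g2 := g (T.symm e)
    rw [D_comp hψ] at g2
    simp only [map_zero, add_zero, smul_apply, ContinuousLinearEquiv.coe_coe, ContinuousLinearEquiv.apply_symm_apply,
      map_smul, smul_eq_mul, abs_mul, abs_of_pos hr] at g2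
    rw [Real.norm_eq_abs, div_mul_eq_mul_div, le_div_iff₀ hr]
    have w0 : 0 ≤ 3 * KV d * ((2 ^ d + 1) * ψ x / q + q * (θ * ψ x)) := by positivity
    have g3 := mul_le_mul_of_nonneg_left (T2 e) w0
    have g4 := mul_le_mul_of_nonneg_right f1 (norm_nonneg e)
    rw [hQ] at g4
    linarith
  rw [le_div_iff₀ hr] at this
  linarith

lemma harn {D : Set (Eu d)} (hD : Convex ℝ D) {ψ : Eu d → ℝ} (hψ : ContDiff ℝ 2 ψ) (ps : ∀ x, 0 < ψ x) {c : ℝ}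
    (h : ∀ x ∈ D, ‖fderiv ℝ ψ x‖ ≤ c * ψ x) {x y : Eu d} (hx : x ∈ D) (hy : y ∈ D) :
    ψ y ≤ Real.exp (c * ‖y - x‖) * ψ x := by
  have := hD.norm_image_sub_le_of_norm_hasFDerivWithin_le (f := fun x => Real.log (ψ x)) (C := c)
    (fun z _ => ((c2_d1 hψ z).log (ps z).ne').hasFDerivWithinAt) (fun z hz => by
      rw [norm_smul, norm_inv, Real.norm_of_nonneg (ps z).le, inv_mul_le_iff₀ (ps z)]
      linarith [h z hz]) hx hy
  rw [← Real.log_le_log_iff (ps y) (mul_pos (Real.exp_pos _) (ps x)), Real.log_mul (Real.exp_pos _).ne' (ps x).ne', Real.log_exp]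
  linarith [(abs_le.1 this).2]

lemma inf_abs [Nonempty U] {g : U → ℝ} {c : ℝ} (h : ∀ u, |g u| ≤ c) : |⨅ u, g u| ≤ c := by
  have := inf_lip (g := g) (h := fun _ => 0) (c := c) (c'' := 0) (fun u => (abs_le.1 (h u)).1) (fun _ => le_rfl)
    (by simpa using h)
  simpa using this

lemma lin_abs {B M q : ℝ} {β : Eu d} {ρ : ℝ} (hb : ‖β‖ ≤ B) (hr : |ρ| ≤ M) (l : Eu d →L[ℝ] ℝ) :
    |l β + ρ * q| ≤ ‖l‖ * B + M * |q| := by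
  have h1 := (ContinuousLinearMap.le_opNorm l β).trans (mul_le_mul_of_nonneg_left hb (norm_nonneg _))
  refine (abs_add_le _ _).trans (add_le_add h1 ?_)
  rw [abs_mul]; exact mul_le_mul_of_nonneg_right hr (abs_nonneg _)

theorem lg_core [Nonempty U] (d : ℕ) {L K B M Cc : ℝ} (hL : 1 ≤ L) (hK : 0 ≤ K) (hB : 0 ≤ B) (hM : 0 ≤ M) (hC : 0 ≤ Cc) :
    ∃ ρ r0 : ℝ, 1 ≤ ρ ∧ 0 < r0 ∧ ∀ (a : Eu d → Matrix (Fin d) (Fin d) ℝ) (b : Eu d → U → Eu d) (r : Eu d → U → ℝ) (x : Eu d)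
      (t δ : ℝ) (ψ : Eu d → ℝ), 0 < t → t ≤ r0 → LocD (ball x (ρ * t)) L K B M a b r → (∃ N, GB N ψ) →
      (∀ x, 0 < ψ x) → (∀ y ∈ ball x (ρ * t), ‖fderiv ℝ ψ y‖ ≤ 2 / t * ψ y) → 0 ≤ δ → δ ≤ 1 →
      (∀ y ∈ ball x (ρ * t), |δ * Real.log (ψ y)| ≤ Cc) →
      (∀ y ∈ ball x (ρ * t), Gt a b r ψ y = δ * (ψ y * Real.log (ψ y))) → t * ‖fderiv ℝ ψ x‖ ≤ ψ x / 2 := by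
  obtain ⟨ρ, θ, ρ1, θ0, H⟩ := lg_lin d hL
  obtain ⟨C, C0, HC⟩ := loc_sch (U := U) d hL hK hB hM hC
  have ex := Real.exp_pos (2 * ρ)
  have ρ0 : 0 < ρ := by linarith
  obtain ⟨Z, hZ⟩ : ∃ Z, Z = d ^ 2 * K * (8 * C) + Cc + M + 2 * B := ⟨_, rfl⟩
  have Z0 : 0 ≤ Z := by rw [hZ]; positivity
  have y1 : 0 ≤ (1 + K) * ρ := by positivity
  have y2 : 0 ≤ Real.exp (2 * ρ) * Z / θ := by positivity
  refine ⟨ρ, 1 / ((1 + K) * ρ + Real.exp (2 * ρ) * Z / θ + 1), ρ1, by positivity,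
    fun a b r x t δ ψ ht ht0 hD hN ps hg d0 d1 hc hq => ?_⟩
  rw [le_div_iff₀ (by positivity)] at ht0
  have u1 := mul_nonneg ht.le y1
  have u2 := mul_nonneg ht.le y2
  have u3 : 0 ≤ t * K * ρ := by positivity
  have u4 : 0 < t * ρ := by positivity
  have t1 : t ≤ 1 := by linarith
  have tρ : ρ * t ≤ 1 := by linarith
  have Kt : K * (ρ * t) ≤ 1 := by linarith
  have tz : t * (Real.exp (2 * ρ) * Z) ≤ θ := by
    have : t * (Real.exp (2 * ρ) * Z / θ) ≤ 1 := by linarith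
    rw [← mul_div_assoc, div_le_one θ0] at this; exact this
  have p0 : 0 < ρ * t := by positivity
  have px := ps x
  have cen : x ∈ ball x (ρ * t) := mem_ball_self p0
  obtain ⟨m, hm⟩ : ∃ m, m = Real.exp (2 * ρ) * ψ x := ⟨_, rfl⟩
  have m0 : 0 < m := by rw [hm]; positivity
  have ub : ∀ y ∈ ball x (ρ * t), ψ y ≤ m := fun y hy => by
    rw [hm]
    refine (harn (convex_ball x (ρ * t)) hN.choose_spec.1 ps hg cen hy).trans (mul_le_mul_of_nonneg_right (Real.exp_le_exp.2 ?_) px.le)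
    rw [div_mul_eq_mul_div, div_le_iff₀ ht]
    linarith [mem_ball_iff_norm.1 hy]
  have gb : ∀ y ∈ ball x (ρ * t), ‖fderiv ℝ ψ y‖ ≤ 2 / t * m := fun y hy =>
    (hg y hy).trans (mul_le_mul_of_nonneg_left (ub y hy) (by positivity))
  have PNN := HC a b r x (ρ * t) (2 * ρ) m δ ψ p0 tρ Kt hD hN ps ub (fun y hy => (gb y hy).trans (le_of_eq (by field_simp)))
    (by linarith) d0 d1 hc hq
  refine H (a x) (hD.ell x cen) ψ x t hN.choose_spec.1 ps ht fun y hy => ?_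
  have yb : y ∈ ball x (ρ * t) := by rw [mem_ball_iff_norm]; linarith
  have hs := (PNN y (√(ρ * t - ‖y - x‖)) (Real.sqrt_pos.2 (by linarith)) (Real.sq_sqrt (by linarith))).1
  rw [show √(ρ * t - ‖y - x‖) ^ 4 = (√(ρ * t - ‖y - x‖) ^ 2) ^ 2 by ring, Real.sq_sqrt (by linarith)] at hs
  have h1 : (ρ * t / 2) ^ 2 * ‖Hs ψ y‖ ≤ C * (2 * ρ * m) := by
    refine le_trans (mul_le_mul_of_nonneg_right ?_ (norm_nonneg _)) hs
    exact pow_le_pow_left₀ (by positivity) (by linarith) 2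
  have e1 := trM_sub_left (a x) (a y) (Hs ψ y)
  have e2 := trM_bd (A := a x - a y) (c := K * (ρ * t)) (fun i j => by
    rw [Matrix.sub_apply]
    refine (hD.al x cen y yb i j).trans (mul_le_mul_of_nonneg_left ?_ hK)
    rw [norm_sub_rev]; linarith) (Hs ψ y)
  have e3 : t * ((ρ * t) * ‖Hs ψ y‖) ≤ 8 * C * m := by
    have : ρ * (t * ((ρ * t) * ‖Hs ψ y‖)) ≤ ρ * (8 * C * m) := by linarith
    exact le_of_mul_le_mul_left this ρ0
  have e4 := mul_le_mul_of_nonneg_left e3 (by positivity : 0 ≤ (d : ℝ) ^ 2 * K)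
  have e5 := inf_abs (fun u => lin_abs (q := ψ y) (hD.bb y yb u) (hD.rb y yb u) (fderiv ℝ ψ y))
  have e6 := hq y yb
  unfold Gt at e6
  have e7 : |δ * (ψ y * Real.log (ψ y))| ≤ Cc * m := by
    rw [show δ * (ψ y * Real.log (ψ y)) = (δ * Real.log (ψ y)) * ψ y by ring, abs_mul, abs_of_pos (ps y)]
    exact mul_le_mul (hc y yb) (ub y yb) (ps y).le hC
  have e8 := mul_le_mul_of_nonneg_right (gb y yb) hB
  have e9 := mul_le_mul_of_nonneg_left (ub y yb) hM
  rw [abs_of_pos (ps y)] at e5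
  have tot : |trM (a x) (Hs ψ y)| ≤ d ^ 2 * (K * (ρ * t)) * ‖Hs ψ y‖ + (2 / t * m * B + M * m) + Cc * m := by
    rw [abs_le] at *
    constructor <;> linarith [e2.1, e2.2, e5.1, e5.2, e7.1, e7.2]
  have tot2 := mul_le_mul_of_nonneg_left tot ht.le
  have e10 : t * (d ^ 2 * (K * (ρ * t)) * ‖Hs ψ y‖ + (2 / t * m * B + M * m) + Cc * m) =
    d ^ 2 * K * (t * (ρ * t * ‖Hs ψ y‖)) + 2 * m * B + t * ((M + Cc) * m) := by field_simp; ring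
  have e11 := mul_le_mul_of_nonneg_right t1 (by positivity : 0 ≤ (M + Cc) * m)
  have tot3 : t * |trM (a x) (Hs ψ y)| ≤ Z * m := by rw [hZ]; linarith
  have tot4 := mul_le_mul_of_nonneg_left tot3 ht.le
  have tz2 := mul_le_mul_of_nonneg_right tz px.le
  rw [hm] at tot4
  linarith

theorem loggrad [Nonempty U] (d : ℕ) {L K B M Cc R : ℝ} (hL : 1 ≤ L) (hK : 0 ≤ K) (hB : 0 ≤ B) (hM : 0 ≤ M) (hC : 0 ≤ Cc)
    (hR : 0 < R) : ∃ N0 : ℝ, 0 ≤ N0 ∧ ∀ (a : Eu d → Matrix (Fin d) (Fin d) ℝ) (b : Eu d → U → Eu d) (r : Eu d → U → ℝ)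
      (δ : ℝ) (ψ : Eu d → ℝ), LocD (ball 0 R) L K B M a b r → (∃ N, GB N ψ) → (∀ x, 0 < ψ x) →
      (∃ c > 0, ∀ x, c ≤ ψ x) → 0 ≤ δ → δ ≤ 1 → (∀ y ∈ ball 0 R, |δ * Real.log (ψ y)| ≤ Cc) →
      (∀ y ∈ ball 0 R, Gt a b r ψ y = δ * (ψ y * Real.log (ψ y))) →
      ∀ x ∈ ball (0 : Eu d) R, (R - ‖x‖) * ‖fderiv ℝ ψ x‖ ≤ N0 * ψ x := by
  obtain ⟨ρ, r0, ρ1, r00, H⟩ := lg_core (U := U) d hL hK hB hM hC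
  refine ⟨2 * (2 * ρ + R / r0), by positivity, fun a b r δ ψ hD hN ps hlb d0 d1 hc hq => ?_⟩
  refine absorb (P := fun N => ∀ x ∈ ball (0 : Eu d) R, (R - ‖x‖) * ‖fderiv ℝ ψ x‖ ≤ N * ψ x)
    (fun N N' h hp x hx => (hp x hx).trans (mul_le_mul_of_nonneg_right h (ps x).le)) (fun N h x hx => ?_) (by positivity) ?_ ?_
  · refine le_of_forall_pos_le_add fun ε hε => ?_
    have := h (ε / ψ x) (div_pos hε (ps x)) x hx
    rw [add_mul, div_mul_cancel₀ _ (ps x).ne'] at this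
    exact this
  · obtain ⟨N, hN⟩ := hN
    obtain ⟨c, c0, hlb⟩ := hlb
    have N0 := GB_nn hN
    refine ⟨R * N / c, by positivity, fun x hx => ?_⟩
    have hx' := mem_ball_zero_iff.1 hx
    have h1 := mul_le_mul (by linarith [norm_nonneg x] : R - ‖x‖ ≤ R) (hN.2 x).2.1 (norm_nonneg _) hR.le
    refine h1.trans ?_
    rw [div_mul_eq_mul_div, le_div_iff₀ c0]
    exact mul_le_mul_of_nonneg_left (hlb x) (by positivity)
  · intro N N0 hP
    rcases le_total N (2 * ρ + R / r0) with hs | hs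
    · exact fun x hx => (hP x hx).trans (mul_le_mul_of_nonneg_right (by linarith) (ps x).le)
    intro x hx
    have hx' := mem_ball_zero_iff.1 hx
    have q0 : 0 < R / r0 := by positivity
    have Np : 0 < N := by linarith
    obtain ⟨t, ht⟩ : ∃ t, t = (R - ‖x‖) / N := ⟨_, rfl⟩
    have tN : t * N = R - ‖x‖ := by rw [ht, div_mul_cancel₀ _ Np.ne']
    have t0 : 0 < t := by rw [ht]; exact div_pos (by linarith) Np
    have tr : t ≤ r0 := by
      rw [ht, div_le_iff₀ Np]
      have : R / r0 ≤ N := by linarith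
      rw [div_le_iff₀ r00] at this
      linarith [norm_nonneg x]
    have tρ : ρ * t ≤ (R - ‖x‖) / 2 := by
      have := mul_le_mul_of_nonneg_left (by linarith : 2 * ρ ≤ N) t0.le
      linarith
    have far : ∀ y ∈ ball x (ρ * t), t * N / 2 ≤ R - ‖y‖ := fun y hy => by
      have h1 := mem_ball_iff_norm.1 hy
      have h2 := norm_sub_norm_le y x
      linarith
    have sub : ball x (ρ * t) ⊆ ball 0 R := fun y hy => by
      have := far y hy
      have := mul_pos t0 Np
      rw [mem_ball_zero_iff]; linarith
    have := H a b r x t δ ψ t0 tr (hD.mono sub) hN ps (fun y hy => by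
      have h1 := (mul_le_mul_of_nonneg_right (far y hy) (norm_nonneg (fderiv ℝ ψ y))).trans (hP y (sub hy))
      rw [div_mul_eq_mul_div, le_div_iff₀ t0]
      have : N * (‖fderiv ℝ ψ y‖ * t) ≤ N * (2 * ψ y) := by linarith
      exact le_of_mul_le_mul_left this Np) d0 d1 (fun y hy => hc y (sub hy)) (fun y hy => hq y (sub hy))
    have h2 := mul_le_mul_of_nonneg_left this Np.le
    have h3 : 0 ≤ (2 * ρ + R / r0) * ψ x := mul_nonneg (by positivity) (ps x).le
    rw [← tN]
    linarith
end

open Metric Set MeasureTheory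
noncomputable section
variable {d : ℕ} {U : Type*}

section basics
variable {a : Eu d → Matrix (Fin d) (Fin d) ℝ} {b : Eu d → U → Eu d} {r : Eu d → U → ℝ}

lemma Gt_smul {ψ : Eu d → ℝ} (hψ : ContDiff ℝ 2 ψ) {c : ℝ} (hc : 0 ≤ c) (x : Eu d) :
    Gt a b r (fun z => c * ψ z) x = c * Gt a b r ψ x := by
  simp only [Gt]
  rw [D_smul hψ, Hs_smul hψ, trM_smul, mul_add, Real.mul_iInf_of_nonneg hc]
  congr 2
  funext u
  simp only [smul_apply, smul_eq_mul]
  ring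

lemma Gt_touch {L : ℝ} (hL : 1 ≤ L) {u v : Eu d → ℝ} {x : Eu d} (hA : Ell L (a x))
    (hu : ContDiff ℝ 2 u) (hv : ContDiff ℝ 2 v) (h : IsLocalMax (fun y => u y - v y) x) (e : u x = v x) :
    Gt a b r u x ≤ Gt a b r v x := by
  obtain ⟨h1, h2⟩ := trM_max hL hA hu hv h
  simp only [Gt]
  rw [h1, e]
  linarith

lemma Gt_congr {u v : Eu d → ℝ} {x : Eu d} (h : u =ᶠ[nhds x] v) : Gt a b r u x = Gt a b r v x := by
  simp only [Gt, Hs]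
  rw [h.fderiv.fderiv_eq, h.fderiv_eq, h.eq_of_nhds]

lemma eta_D (z x : Eu d) : HasFDerivAt (fun x : Eu d => (1 - ‖x - z‖ ^ 2) ^ 2)
    ((-4 * (1 - ‖x - z‖ ^ 2)) • innerSL ℝ (x - z)) x := by
  have h := ((((hasFDerivAt_id x).sub_const z).norm_sq).const_sub 1).pow 2
  refine h.congr_fderiv ?_
  ext k
  simp
  ring

lemma eta_Hs (z x h k : Eu d) : Hs (fun x : Eu d => (1 - ‖x - z‖ ^ 2) ^ 2) x h k =
    8 * (inner ℝ (x - z) h * inner ℝ (x - z) k) - 4 * (1 - ‖x - z‖ ^ 2) * inner ℝ h k := by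
  have e : fderiv ℝ (fun x : Eu d => (1 - ‖x - z‖ ^ 2) ^ 2) = fun x => (-4 * (1 - ‖x - z‖ ^ 2)) • innerSL ℝ (x - z) :=
    funext fun x => (eta_D z x).fderiv
  have h1 := ((((hasFDerivAt_id x).sub_const z).norm_sq).const_sub 1).const_mul (-4)
  have h2 : HasFDerivAt (fun x : Eu d => innerSL ℝ (x - z)) (innerSL ℝ : Eu d →L[ℝ] Eu d →L[ℝ] ℝ) x := 
    ((innerSL ℝ : Eu d →L[ℝ] Eu d →L[ℝ] ℝ).hasFDerivAt.comp x ((hasFDerivAt_id x).sub_const z)).congr_fderiv (by ext; simp)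
  have h3 := (h1.smul h2).fderiv
  rw [Hs, e]
  refine (congrArg (fun T : Bil d => T h k) h3).trans ?_
  have e2 : ∀ v w : Eu d, (innerSL ℝ : Eu d →L[ℝ] Eu d →L[ℝ] ℝ) v w = inner ℝ v w := fun _ _ => rfl
  simp only [id, add_apply, smul_apply, smul_eq_mul, ContinuousLinearMap.smulRight_apply, neg_apply,
    ContinuousLinearMap.comp_apply, ContinuousLinearMap.id_apply, e2, nsmul_eq_mul]
  push_cast
  ring

lemma eta_tr {L : ℝ} {A : Matrix (Fin d) (Fin d) ℝ} (hA : Ell L A) (z x : Eu d) (hw : 0 ≤ 1 - ‖x - z‖ ^ 2) :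
    8 * (L⁻¹ * ‖x - z‖ ^ 2) - 4 * (1 - ‖x - z‖ ^ 2) * (d * L) ≤ trM A (Hs (fun x : Eu d => (1 - ‖x - z‖ ^ 2) ^ 2) x) := by
  have e : trM A (Hs (fun x : Eu d => (1 - ‖x - z‖ ^ 2) ^ 2) x) = 8 * quadForm A (x - z) -
      4 * (1 - ‖x - z‖ ^ 2) * ∑ i, A i i := by
    simp only [trM, eta_Hs, quadForm, mul_sub, Finset.sum_sub_distrib]
    congr 1
    · simp only [Finset.mul_sum]
      refine Finset.sum_congr rfl fun i _ => Finset.sum_congr rfl fun j _ => ?_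
      simp [eb, EuclideanSpace.inner_single_right]
      ring
    · simp only [Finset.mul_sum]
      refine Finset.sum_congr rfl fun i _ => ?_
      simp [eb, EuclideanSpace.inner_single_left]
      ring
  rw [e]
  have h1 : ∑ i, A i i ≤ d * L := by
    calc _ ≤ ∑ i : Fin d, L := Finset.sum_le_sum fun i _ => ell_diag hA i
      _ = _ := by simp
  have h2 := (hA.2 (x - z)).1
  have h3 := mul_le_mul_of_nonneg_left h1 hw
  linarith

theorem lower [Nonempty U] {L K B M : ℝ} (hL : 1 ≤ L) (hB : 0 ≤ B) {z : Eu d} {ψ c : Eu d → ℝ}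
    (hD : LocD (ball z 1) L K B M a b r) (hψ : ContDiff ℝ 2 ψ) (ps : ∀ x, 0 < ψ x)
    (h : ∀ x ∈ ball z 1, Gt a b r ψ x ≤ c x * ψ x) : ∃ x ∈ ball z 1, ψ x ≤ ψ z ∧
      -(M + (8 / L + 4 * (d * L) + 4 * B) ^ 2 / (4 * (8 / L))) ≤ c x := by
  have L0 : 0 < L := by linarith
  have hc : ContDiff ℝ 2 (fun x : Eu d => (1 - ‖x - z‖ ^ 2) ^ 2) :=
    (contDiff_const.sub ((contDiff_id.sub contDiff_const).norm_sq ℝ)).pow 2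
  obtain ⟨x, hx, hm⟩ := (isCompact_closedBall z (1:ℝ)).exists_isMaxOn ⟨z, mem_closedBall_self zero_le_one⟩
    (f := fun x => (1 - ‖x - z‖ ^ 2) ^ 2 / ψ x) (hc.continuous.div₀ hψ.continuous fun x => (ps x).ne').continuousOn
  obtain ⟨κ, hκ⟩ : ∃ κ, κ = (1 - ‖x - z‖ ^ 2) ^ 2 / ψ x := ⟨_, rfl⟩
  have hm' : ∀ y ∈ closedBall z 1, (1 - ‖y - z‖ ^ 2) ^ 2 / ψ y ≤ κ := fun y hy => by rw [hκ]; exact hm hy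
  have k1 : 1 / ψ z ≤ κ := by simpa using hm' z (mem_closedBall_self zero_le_one)
  have k0 : 0 < κ := lt_of_lt_of_le (by have := ps z; positivity) k1
  have px := ps x
  have ek : (1 - ‖x - z‖ ^ 2) ^ 2 = κ * ψ x := by rw [hκ]; field_simp
  rw [mem_closedBall_iff_norm] at hx
  have w0 : 0 ≤ 1 - ‖x - z‖ ^ 2 := by nlinarith [norm_nonneg (x - z)]
  have wp : 0 < 1 - ‖x - z‖ ^ 2 := by
    rcases w0.eq_or_lt with e | e
    · rw [← e] at ek; nlinarith [mul_pos k0 px]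
    · exact e
  have xb : x ∈ ball z 1 := by
    rw [mem_ball_iff_norm]; nlinarith [norm_nonneg (x - z)]
  have lm : IsLocalMax (fun y => (1 - ‖y - z‖ ^ 2) ^ 2 - κ * ψ y) x := by
    filter_upwards [isOpen_ball.mem_nhds xb] with y hy
    have := (div_le_iff₀ (ps y)).1 (hm' y (ball_subset_closedBall hy))
    linarith
  have T := Gt_touch (b := b) (r := r) hL (hD.ell x xb) hc (contDiff_const.mul hψ) lm ek
  rw [Gt_smul hψ k0.le] at T
  have T2 := mul_le_mul_of_nonneg_left (h x xb) k0.le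
  have et := eta_tr (hD.ell x xb) z x w0
  refine ⟨x, xb, ?_, ?_⟩
  · rw [div_le_iff₀ (ps z)] at k1
    have : κ * ψ x ≤ κ * ψ z := by rw [← ek]; nlinarith [sq_nonneg ‖x - z‖, sq_nonneg (‖x-z‖^2)]
    exact le_of_mul_le_mul_left this k0
  · have g1 : ‖fderiv ℝ (fun x : Eu d => (1 - ‖x - z‖ ^ 2) ^ 2) x‖ ≤ 4 * (1 - ‖x - z‖ ^ 2) := by
      rw [(eta_D z x).fderiv, norm_smul, innerSL_apply_norm, Real.norm_eq_abs, abs_mul, abs_of_nonneg w0]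
      norm_num
      nlinarith
    have g2 := le_ciInf (lin_ge2 (q := (1 - ‖x - z‖ ^ 2) ^ 2) (hD.bb x xb) (hD.rb x xb)
      (fderiv ℝ (fun x : Eu d => (1 - ‖x - z‖ ^ 2) ^ 2) x))
    have g3 := mul_le_mul_of_nonneg_right g1 hB
    rw [abs_of_nonneg (sq_nonneg _)] at g2
    simp only [Gt] at T T2
    obtain ⟨w, hw⟩ : ∃ w, w = 1 - ‖x - z‖ ^ 2 := ⟨_, rfl⟩
    have s : ‖x - z‖ ^ 2 = 1 - w := by rw [hw]; ring
    rw [← hw] at ek et g3 g2 wp T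
    have q1 : 8 * (L⁻¹ * (1 - w)) = 8 / L - 8 / L * w := by ring
    have main : 8 / L - (8 / L + 4 * (d * L) + 4 * B) * w - M * w ^ 2 ≤ c x * w ^ 2 := by
      rw [ek]
      rw [s, q1] at et
      rw [ek] at g2 T
      linarith
    obtain ⟨A1, hA1⟩ : ∃ A1, A1 = 8 / L := ⟨_, rfl⟩
    obtain ⟨A2, hA2⟩ : ∃ A2, A2 = 8 / L + 4 * (d * L) + 4 * B := ⟨_, rfl⟩
    rw [← hA2, ← hA1] at main
    rw [← hA2, ← hA1]
    have a1 : 0 < A1 := by rw [hA1]; positivity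
    have q2 : 0 ≤ A1 - A2 * w + A2 ^ 2 / (4 * A1) * w ^ 2 := by
      have : A1 - A2 * w + A2 ^ 2 / (4 * A1) * w ^ 2 = (2 * A1 - A2 * w) ^ 2 / (4 * A1) := by field_simp; ring
      rw [this]; positivity
    have q3 : -(M + A2 ^ 2 / (4 * A1)) * w ^ 2 ≤ c x * w ^ 2 := by linarith
    exact le_of_mul_le_mul_right q3 (by positivity)
end basics
end

open Metric Set MeasureTheory
noncomputable section
variable {d : ℕ} {U : Type*}

lemma cutE (d : ℕ) {ρ : ℝ} (hρ : 0 < ρ) : ∃ χ : Eu d → ℝ, ContDiff ℝ 2 χ ∧ HasCompactSupport χ ∧ (∀ x, 0 ≤ χ x ∧ χ x ≤ 1) ∧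
    (∀ x, ‖x‖ ≤ ρ → χ x = 1) ∧ ∀ x, ρ + 1 ≤ ‖x‖ → χ x = 0 := by
  let f : ContDiffBump (0 : Eu d) := ⟨ρ, ρ + 1, hρ, by linarith⟩
  exact ⟨f, f.contDiff, f.hasCompactSupport, fun x => ⟨f.nonneg, f.le_one⟩,
    fun x hx => f.one_of_mem_closedBall (by simpa [f] using hx), fun x hx => f.zero_of_le_dist (by simpa [f] using hx)⟩

lemma lipE {F : Type*} [NormedAddCommGroup F] [NormedSpace ℝ F] {f : Eu d → F} (h : HasCompactSupport f) (hf : ContDiff ℝ 2 f) :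
    ∃ k, 0 ≤ k ∧ ∀ x y, ‖f x - f y‖ ≤ k * ‖x - y‖ := by
  obtain ⟨C, hC⟩ := hf.lipschitzWith_of_hasCompactSupport h (by norm_num)
  exact ⟨C, C.2, fun x y => by simpa [dist_eq_norm] using hC.dist_le_mul x y⟩

lemma projE (d : ℕ) {ρ : ℝ} (hρ : 0 < ρ) : ∃ (π : Eu d → Eu d) (k : ℝ), 0 ≤ k ∧ (∀ x y, ‖π x - π y‖ ≤ k * ‖x - y‖) ∧
    (∀ x, ‖π x‖ ≤ ρ + 1) ∧ ∀ x, ‖x‖ ≤ ρ → π x = x := by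
  obtain ⟨χ, c1, c2, c3, c4, c5⟩ := cutE d hρ
  obtain ⟨k, k0, hk⟩ := lipE (f := fun x => χ x • x) c2.smul_right (c1.smul contDiff_id)
  refine ⟨fun x => χ x • x, k, k0, hk, fun x => ?_, fun x hx => by simp [c4 x hx]⟩
  rcases le_total (ρ + 1) ‖x‖ with h | h
  · simp [c5 x h]; linarith
  · rw [norm_smul, Real.norm_of_nonneg (c3 x).1]
    have := mul_le_mul_of_nonneg_right (c3 x).2 (norm_nonneg x)
    linarith

lemma tildeE {φ : Eu d → ℝ} (hφ : ContDiff ℝ 2 φ) (ps : ∀ x, 0 < φ x) {ρ : ℝ} (hρ : 0 < ρ) :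
    ∃ (f : Eu d → ℝ) (C c : ℝ), ContDiff ℝ 2 f ∧ (∀ x, ‖x‖ ≤ ρ → f x = φ x) ∧ (∀ x, ρ + 1 ≤ ‖x‖ → f x = 1 + ‖x‖ ^ 2) ∧
      0 < c ∧ (∀ x, c ≤ f x) ∧ 0 ≤ C ∧ ∀ x, ‖Hs f x‖ ≤ C * f x ∧ ‖fderiv ℝ f x‖ ≤ C * f x := by
  obtain ⟨χ, c1, c2, c3, c4, c5⟩ := cutE d hρ
  obtain ⟨f, hf⟩ : ∃ f : Eu d → ℝ, f = fun x => χ x * φ x + (1 - χ x) * (1 + ‖x‖ ^ 2) := ⟨_, rfl⟩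
  have f2 : ContDiff ℝ 2 f := by
    rw [hf]; exact (c1.mul hφ).add ((contDiff_const.sub c1).mul (contDiff_const.add sq_c2))
  have f0 : ∀ x, 0 < f x := fun x => by
    rw [hf]
    have h1 : 0 < 1 + ‖x‖ ^ 2 := by positivity
    rcases (c3 x).1.eq_or_lt with e | e
    · simp [← e]; exact h1
    · have := mul_pos e (ps x)
      have := mul_nonneg (sub_nonneg.2 (c3 x).2) h1.le
      simp only; linarith
  have f3 : ∀ x, ρ + 1 ≤ ‖x‖ → f x = 1 + ‖x‖ ^ 2 := fun x hx => by rw [hf]; simp [c5 x hx]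
  have K := isCompact_closedBall (0 : Eu d) (ρ + 1)
  obtain ⟨x0, hx0, hm⟩ := K.exists_isMinOn ⟨0, by simp; linarith⟩ f2.continuous.continuousOn
  obtain ⟨C1, hC1⟩ := K.exists_bound_of_continuousOn (f := fun x => ‖Hs f x‖ / f x)
    (((c2_Hs f2).norm.div₀ f2.continuous fun x => (f0 x).ne').continuousOn)
  obtain ⟨C2, hC2⟩ := K.exists_bound_of_continuousOn (f := fun x => ‖fderiv ℝ f x‖ / f x)
    (((c2_D f2).continuous.norm.div₀ f2.continuous fun x => (f0 x).ne').continuousOn)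
  refine ⟨f, max 2 (max C1 C2), min 1 (f x0), f2, fun x hx => by rw [hf]; simp [c4 x hx], f3, lt_min one_pos (f0 x0), fun x => ?_,
    le_max_of_le_left (by norm_num), fun x => ?_⟩
  · rcases le_total (ρ + 1) ‖x‖ with h | h
    · rw [f3 x h]; exact (min_le_left _ _).trans (by nlinarith [sq_nonneg ‖x‖])
    · exact (min_le_right _ _).trans (hm (by simpa using h))
  · rcases le_or_gt ‖x‖ (ρ + 1) with h | h
    · have h1 := hC1 x (by simpa using h)
      have h2 := hC2 x (by simpa using h)
      rw [Real.norm_of_nonneg (div_nonneg (norm_nonneg _) (f0 x).le), div_le_iff₀ (f0 x)] at h1 h2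
      exact ⟨h1.trans (mul_le_mul_of_nonneg_right ((le_max_left _ _).trans (le_max_right _ _)) (f0 x).le),
        h2.trans (mul_le_mul_of_nonneg_right ((le_max_right _ _).trans (le_max_right _ _)) (f0 x).le)⟩
    · have ev : f =ᶠ[nhds x] fun y => 1 + ‖y‖ ^ 2 := by
        filter_upwards [(isOpen_lt continuous_const continuous_norm).mem_nhds h] with y hy
        exact f3 y (le_of_lt hy)
      have e0 : fderiv ℝ (fun y : Eu d => 1 + ‖y‖ ^ 2) = fderiv ℝ (fun y : Eu d => ‖y‖ ^ 2) := by
        funext y; rw [fderiv_const_add]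
      have e1 : fderiv ℝ f x = fderiv ℝ (fun y : Eu d => ‖y‖ ^ 2) x := by rw [ev.fderiv_eq, e0]
      have e2 : Hs f x = Hs (fun y : Eu d => ‖y‖ ^ 2) x := by rw [Hs, ev.fderiv.fderiv_eq, e0, Hs]
      have g1 : ‖Hs f x‖ ≤ 2 := by
        rw [e2]
        refine ContinuousLinearMap.opNorm_le_bound₂ _ (by norm_num) fun h k => ?_
        rw [sq_Hs, norm_mul, Real.norm_ofNat, mul_assoc]
        exact mul_le_mul_of_nonneg_left (norm_inner_le_norm _ _) (by norm_num)
      have g2 : ‖fderiv ℝ f x‖ ≤ 2 * ‖x‖ := by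
        rw [e1]
        refine ContinuousLinearMap.opNorm_le_bound _ (by positivity) fun h => ?_
        rw [sq_D, norm_mul, Real.norm_ofNat, mul_assoc]
        exact mul_le_mul_of_nonneg_left (norm_inner_le_norm _ _) (by norm_num)
      have g3 : 2 * (1 + ‖x‖ ^ 2) ≤ max 2 (max C1 C2) * (1 + ‖x‖ ^ 2) := 
        mul_le_mul_of_nonneg_right (le_max_left _ _) (by positivity)
      rw [f3 x h.le]
      constructor <;> nlinarith [sq_nonneg (‖x‖ - 1), sq_nonneg ‖x‖]

theorem trunc [Nonempty U] {a : Eu d → Matrix (Fin d) (Fin d) ℝ} {b : Eu d → U → Eu d} {r : Eu d → U → ℝ}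
    (hLoc : ∀ R > 0, ∃ L K B M, 1 ≤ L ∧ 1 ≤ K ∧ 0 ≤ B ∧ 0 ≤ M ∧ LocD (closedBall 0 R) L K B M a b r)
    {lam : ℝ} {φ : Eu d → ℝ} (hφ : ContDiff ℝ 2 φ) (pφ : ∀ x, 0 < φ x) (hs : ∀ x, Gt a b r φ x ≤ lam * φ x)
    {R ε : ℝ} (hR : 0 < R) (hε : 0 < ε) : ∃ (δ : ℝ) (ψ : Eu d → ℝ), 0 < δ ∧ δ ≤ ε ∧ (∃ N, GB N ψ) ∧ (∃ c > 0, ∀ x, c ≤ ψ x) ∧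
      ∀ x ∈ ball (0 : Eu d) R, Gt a b r ψ x = δ * (ψ x * Real.log (ψ x)) ∧ δ * Real.log (ψ x) ≤ lam + ε := by
  obtain ⟨L, K, B, M, hL, hK, hB, hM, hD⟩ := hLoc (R + 2 + 1) (by linarith)
  obtain ⟨π, k, k0, p1, p2, p3⟩ := projE d (show 0 < R + 2 by linarith)
  obtain ⟨χ, c1, c2, c3, c4, c5⟩ := cutE d hR
  obtain ⟨k', k0', q1⟩ := lipE c2 c1
  obtain ⟨f, C, c, f2, f3, f4, c0, f5, C0, f6⟩ := tildeE hφ pφ (show 0 < R + 2 by linarith)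
  have f0 : ∀ x, 0 < f x := fun x => c0.trans_le (f5 x)
  have πm : ∀ x, π x ∈ closedBall (0 : Eu d) (R + 2 + 1) := fun x => by simpa using p2 x
  obtain ⟨Kn, hKn⟩ : ∃ Kn, Kn = |lam| + M + (d ^ 2 * L + B) * C := ⟨_, rfl⟩
  have Kn0 : 0 ≤ Kn := by rw [hKn]; positivity
  obtain ⟨rn, hrn⟩ : ∃ rn : Eu d → U → ℝ, rn = fun x u => r (π x) u - Kn * (1 - χ x) := ⟨_, rfl⟩
  have rb : ∀ x u, |rn x u| ≤ M + Kn := fun x u => by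
    have h1 := abs_le.1 (hD.rb _ (πm x) u)
    have h2 := mul_le_mul_of_nonneg_left (c3 x).1 Kn0
    have h3 := mul_le_mul_of_nonneg_left (c3 x).2 Kn0
    rw [hrn, abs_le]; constructor <;> linarith [h1.1, h1.2]
  obtain ⟨W, hW⟩ := (isCompact_closedBall (0 : Eu d) R).exists_bound_of_continuousOn (f := fun x => Real.log (f x) - Real.log c)
    (((f2.continuous.log fun x => (f0 x).ne').sub continuous_const).continuousOn)
  have W0 : 0 ≤ W := (norm_nonneg _).trans (hW 0 (by simpa using hR.le))
  obtain ⟨δ, hδ⟩ : ∃ δ, δ = ε / (1 + W) := ⟨_, rfl⟩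
  have δ0 : 0 < δ := by rw [hδ]; positivity
  have δe : δ * (1 + W) = ε := by rw [hδ]; field_simp
  obtain ⟨K', hK'⟩ : ∃ K', K' = 1 + K * k + Kn * k' := ⟨_, rfl⟩
  have z1 : 0 ≤ K * k := by positivity
  have z2 : 0 ≤ Kn * k' := by positivity
  have kl : ∀ x y, K * ‖π x - π y‖ ≤ K * k * ‖x - y‖ := fun x y => by
    rw [mul_assoc]; exact mul_le_mul_of_nonneg_left (p1 x y) (by linarith)
  have kk : ∀ x y : Eu d, K * k * ‖x - y‖ + Kn * k' * ‖x - y‖ ≤ K' * ‖x - y‖ := fun x y => by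
    rw [hK']; linarith [norm_nonneg (x - y)]
  have kp : ∀ x y : Eu d, 0 ≤ Kn * k' * ‖x - y‖ := fun x y => by positivity
  obtain ⟨ψ, gb, pI, eq⟩ := delta_solve (a := fun x => a (π x)) (b := fun x => b (π x)) (r := rn) (L := L) (K := K') (B := B) (M := M + Kn)
    (δ := δ) (E := (M + Kn) / δ) hL (by rw [hK']; linarith)
    ⟨fun x => hD.ell _ (πm x), fun x y i j => by
      have := hD.al _ (πm x) _ (πm y) i j
      linarith [kl x y, kk x y, kp x y]⟩
    ⟨fun x u => hD.bb _ (πm x) u, rb, fun x y u => by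
      have := hD.bl _ (πm x) _ (πm y) u
      linarith [kl x y, kk x y, kp x y], fun x y u => by
      have h1 := abs_le.1 (hD.rl _ (πm x) _ (πm y) u)
      have h2 := q1 x y
      rw [Real.norm_eq_abs, abs_le] at h2
      have h3 := mul_le_mul_of_nonneg_left h2.1 Kn0
      have h4 := mul_le_mul_of_nonneg_left h2.2 Kn0
      rw [hrn, abs_le]; constructor <;> linarith [h1.1, h1.2, kl x y, kk x y]⟩ δ0 (by positivity) hB (by field_simp) (by positivity)
  obtain ⟨E, hE⟩ : ∃ E, E = (M + Kn) / δ := ⟨_, rfl⟩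
  rw [← hE] at pI
  have ψ0 : ∀ x, 0 < ψ x := fun x => (Real.exp_pos _).trans_le (pI x).1
  have ψ2 : ContDiff ℝ 2 ψ := gb.choose_spec.1
  obtain ⟨xs, hxs⟩ := (ψ2.continuous.div₀ f2.continuous fun x => (f0 x).ne').exists_forall_ge' (0 : Eu d) (by
    have g0 : 0 < ψ 0 / f 0 := div_pos (ψ0 0) (f0 0)
    have t1 : Filter.Tendsto (fun y : Eu d => ‖y‖) (Filter.cocompact _) Filter.atTop := tendsto_norm_cocompact_atTop
    have t2 : Filter.Tendsto (fun y : Eu d => ‖y‖ ^ 2) (Filter.cocompact _) Filter.atTop :=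
      (Filter.tendsto_pow_atTop two_ne_zero).comp t1
    filter_upwards [t1.eventually_ge_atTop (R + 2 + 1), t2.eventually_ge_atTop (Real.exp E / (ψ 0 / f 0))] with y h1 h2
    show ψ y / f y ≤ ψ 0 / f 0
    rw [div_le_iff₀ g0] at h2
    rw [div_le_iff₀ (f0 y), f4 y h1]
    linarith [(pI y).2])
  obtain ⟨κ, hκ⟩ : ∃ κ, κ = ψ xs / f xs := ⟨_, rfl⟩
  have κ0 : 0 < κ := by rw [hκ]; exact div_pos (ψ0 _) (f0 _)
  have hx' : ∀ y, ψ y ≤ κ * f y := fun y => by rw [hκ]; exact (div_le_iff₀ (f0 y)).1 (hxs y)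
  have ek : ψ xs = κ * f xs := by rw [hκ]; field_simp [(f0 xs).ne']
  have T := Gt_touch (a := fun x => a (π x)) (b := fun x => b (π x)) (r := rn) hL (hD.ell _ (πm xs)) ψ2 (contDiff_const.mul f2) (x := xs)
    (Filter.Eventually.of_forall fun y => by linarith [hx' y]) ek
  rw [Gt_smul f2 κ0.le] at T
  have sup : Gt (fun x => a (π x)) (fun x => b (π x)) rn f xs ≤ lam * f xs := by
    rcases le_or_gt ‖xs‖ (R + 1) with h | h
    · have ev : f =ᶠ[nhds xs] φ := by
        filter_upwards [(isOpen_lt continuous_norm continuous_const).mem_nhds (show ‖xs‖ < R + 2 by linarith)] with y hy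
        exact f3 y (le_of_lt hy)
      rw [Gt_congr ev, ev.eq_of_nhds]
      refine le_trans ?_ (hs xs)
      have px := p3 xs (by linarith)
      simp only [Gt, px]
      refine add_le_add_right (ciInf_mono (bdB (lin_ge2 (B := B) (M := M + Kn) (fun u => ?_) (fun u => rb xs u) _)) fun u => ?_) _
      · have := hD.bb _ (πm xs) u
        rwa [px] at this
      · rw [hrn]
        simp only [px]
        have := mul_nonneg (mul_nonneg Kn0 (sub_nonneg.2 (c3 xs).2)) (pφ xs).le
        linarith
    · have e1 : ∀ u, rn xs u = r (π xs) u - Kn := fun u => by rw [hrn]; simp [c5 xs h.le]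
      simp only [Gt]
      have u0 := Classical.arbitrary U
      have i1 := ciInf_le (bdB (lin_ge2 (q := f xs) (fun u => hD.bb _ (πm xs) u) (rb xs) (fderiv ℝ f xs))) u0
      rw [e1] at i1
      have i2 := (abs_le.1 (lin_abs (q := f xs) (hD.bb _ (πm xs) u0) (hD.rb _ (πm xs) u0) (fderiv ℝ f xs))).2
      rw [abs_of_pos (f0 xs)] at i2
      have i3 := (abs_le.1 (trM_bd (fun i j => ell_entry hL (hD.ell _ (πm xs)) i j) (Hs f xs))).2
      have i4 := mul_le_mul_of_nonneg_left (f6 xs).1 (show 0 ≤ d ^ 2 * L by positivity)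
      have i5 := mul_le_mul_of_nonneg_right (f6 xs).2 hB
      have i6 := mul_le_mul_of_nonneg_right (neg_abs_le lam) (f0 xs).le
      have i7 : Kn * f xs = |lam| * f xs + M * f xs + (d ^ 2 * L + B) * C * f xs := by rw [hKn]; ring
      linarith
  have T2 := mul_le_mul_of_nonneg_left sup κ0.le
  have T3 : δ * (ψ xs * Real.log (ψ xs)) ≤ lam * ψ xs := by
    rw [← eq xs]
    have ek2 : lam * ψ xs = κ * (lam * f xs) := by rw [ek]; ring
    rw [ek2]
    exact T.trans T2
  have T4 : δ * Real.log (ψ xs) ≤ lam := le_of_mul_le_mul_right (by linarith) (ψ0 xs)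
  refine ⟨δ, ψ, δ0, by nlinarith, gb, ⟨Real.exp (-E), Real.exp_pos _, fun x => (pI x).1⟩, fun x hx => ⟨?_, ?_⟩⟩
  · rw [mem_ball_zero_iff] at hx
    rw [← eq x]
    have e1 : ∀ u, rn x u = r x u := fun u => by rw [hrn]; simp [c4 x hx.le, p3 x (by linarith)]
    simp only [Gt, p3 x (by linarith), e1]
  · rw [mem_ball_zero_iff] at hx
    have w := (abs_le.1 (hW x (by simpa using hx.le))).2
    have l1 := Real.log_le_log (ψ0 x) (hx' x)
    have l2 : Real.log (ψ xs) = Real.log κ + Real.log (f xs) := by rw [ek, Real.log_mul κ0.ne' (f0 xs).ne']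
    rw [Real.log_mul κ0.ne' (f0 x).ne'] at l1
    have l3 := Real.log_le_log c0 (f5 xs)
    have l4 : Real.log (ψ x) ≤ Real.log (ψ xs) + W := by linarith
    have l5 := mul_le_mul_of_nonneg_left l4 δ0.le
    linarith
end

open Metric Set MeasureTheory
noncomputable section
variable {d : ℕ} {U : Type*}

lemma gen_nsm {E : Type*} [NormedAddCommGroup E] [NormedSpace ℝ E] {c : ℝ} (hc : 0 ≤ c) (B : E) : ‖c • B‖ = c * ‖B‖ := by
  rw [norm_smul c B, Real.norm_of_nonneg hc]

lemma bil_nsm {c : ℝ} (hc : 0 ≤ c) (B : Bil d) : ‖c • B‖ = c * ‖B‖ := gen_nsm hc B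

lemma bil_ss (c : ℝ) (A B : Bil d) : c • A - c • B = c • (A - B) := (smul_sub c A B).symm

section fin
variable [Nonempty U] {a : Eu d → Matrix (Fin d) (Fin d) ℝ} {b : Eu d → U → Eu d} {r : Eu d → U → ℝ}

theorem loc_LB (hLoc : ∀ R > 0, ∃ L K B M, 1 ≤ L ∧ 1 ≤ K ∧ 0 ≤ B ∧ 0 ≤ M ∧ LocD (closedBall 0 R) L K B M a b r)
    {R : ℝ} (hR : 0 < R) (Λ : ℝ) : ∃ Q, 0 ≤ Q ∧ ∀ (δ : ℝ) (ψ : Eu d → ℝ), 0 ≤ δ → δ ≤ 1 → (∃ N, GB N ψ) → (∃ c > 0, ∀ x, c ≤ ψ x) →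
      (∀ x ∈ ball (0 : Eu d) (R + 4), Gt a b r ψ x = δ * (ψ x * Real.log (ψ x)) ∧ δ * Real.log (ψ x) ≤ Λ) →
      LB R Q (fun z => (ψ 0)⁻¹ * ψ z) ∧ (∀ x, ‖x‖ < R → 1 ≤ Q * ((ψ 0)⁻¹ * ψ x)) ∧ |δ * Real.log (ψ 0)| ≤ Q := by
  obtain ⟨L, K, B, M, hL, hK, hB, hM, hD0⟩ := hLoc (R + 4) (by linarith)
  have hD := hD0.mono ball_subset_closedBall
  have L0 : 0 < L := by linarith
  obtain ⟨C, hC⟩ : ∃ C, C = M + (8 / L + 4 * (d * L) + 4 * B) ^ 2 / (4 * (8 / L)) := ⟨_, rfl⟩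
  have C0 : 0 ≤ C := by rw [hC]; positivity
  obtain ⟨Cc, hCc⟩ : ∃ Cc, Cc = |Λ| + C := ⟨_, rfl⟩
  have Cc0 : 0 ≤ Cc := by rw [hCc]; positivity
  obtain ⟨N0, N00, HN⟩ := loggrad (U := U) (R := R + 3) d hL (by linarith : 0 ≤ K) hB hM Cc0 (by linarith)
  obtain ⟨C1, C10, HS⟩ := loc_sch (U := U) d hL (by linarith : 0 ≤ K) hB hM Cc0
  obtain ⟨H, hH⟩ : ∃ H, H = Real.exp (N0 * (2 * (R + 2))) := ⟨_, rfl⟩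
  have H0 : 0 < H := by rw [hH]; positivity
  obtain ⟨t, ht⟩ : ∃ t, t = 1 / K := ⟨_, rfl⟩
  have t0 : 0 < t := by rw [ht]; positivity
  have t1 : t ≤ 1 := by rw [ht]; exact div_le_one_of_le₀ hK (by linarith)
  have Kt : K * t ≤ 1 := by rw [ht]; field_simp; rfl
  obtain ⟨s, hs⟩ : ∃ s, s = √t := ⟨_, rfl⟩
  have s0 : 0 < s := by rw [hs]; exact Real.sqrt_pos.2 t0
  have st : s ^ 2 = t := by rw [hs]; exact Real.sq_sqrt t0.le
  have s1 : s ≤ 1 := by nlinarith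
  obtain ⟨N1, hN1⟩ : ∃ N1, N1 = C1 * ((1 + N0) * H) / s ^ 5 := ⟨_, rfl⟩
  have N10 : 0 ≤ N1 := by rw [hN1]; positivity
  have z1 : 0 ≤ N0 * H := by positivity
  have z2 : 0 ≤ 4 / t * N1 := by positivity
  refine ⟨H + N0 * H + N1 + 4 / t * N1 + Cc, by positivity, fun δ ψ d0 d1 gb lb hq => ?_⟩
  have ps : ∀ x, 0 < ψ x := fun x => by
    obtain ⟨c, c0, hc⟩ := lb
    exact c0.trans_le (hc x)
  have ψ2 : ContDiff ℝ 2 ψ := gb.choose_spec.1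
  have hc : ∀ y ∈ ball (0 : Eu d) (R + 3), |δ * Real.log (ψ y)| ≤ Cc := fun y hy => by
    rw [mem_ball_zero_iff] at hy
    have sub : ball y 1 ⊆ ball (0 : Eu d) (R + 4) := ball_subset_ball' (by rw [dist_zero_right]; linarith)
    obtain ⟨x, hx, h1, h2⟩ := lower (c := fun x => δ * Real.log (ψ x)) hL hB (hD.mono sub) ψ2 ps (fun x hx => by
      rw [(hq x (sub hx)).1]; linarith)
    rw [← hC] at h2
    have h3 := mul_le_mul_of_nonneg_left (Real.log_le_log (ps x) h1) d0
    have h4 := (hq y (by rw [mem_ball_zero_iff]; linarith)).2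
    rw [hCc, abs_le]
    constructor <;> linarith [le_abs_self Λ, abs_nonneg Λ]
  have s3 : ball (0 : Eu d) (R + 3) ⊆ ball (0 : Eu d) (R + 4) := ball_subset_ball (by linarith)
  have g1 := HN a b r δ ψ (hD.mono s3) gb ps lb d0 d1 hc (fun y hy => (hq y (s3 hy)).1)
  have g2 : ∀ x ∈ ball (0 : Eu d) (R + 2), ‖fderiv ℝ ψ x‖ ≤ N0 * ψ x := fun x hx => by
    rw [mem_ball_zero_iff] at hx
    have h1 := g1 x (by rw [mem_ball_zero_iff]; linarith)
    have h2 := mul_le_mul_of_nonneg_right (show 1 ≤ R + 3 - ‖x‖ by linarith) (norm_nonneg (fderiv ℝ ψ x))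
    linarith
  have hk : ∀ x y, ‖x‖ < R + 2 → ‖y‖ < R + 2 → ψ y ≤ H * ψ x := fun x y hx hy => by
    refine (harn (convex_ball 0 (R + 2)) ψ2 ps g2 (mem_ball_zero_iff.2 hx) (mem_ball_zero_iff.2 hy)).trans
      (mul_le_mul_of_nonneg_right ?_ (ps x).le)
    rw [hH, Real.exp_le_exp]
    exact mul_le_mul_of_nonneg_left ((norm_sub_le _ _).trans (by linarith)) N00
  have n0 : ‖(0 : Eu d)‖ < R + 2 := by rw [norm_zero]; linarith
  have q0 := ps 0
  have pn : ∀ x, ‖x‖ < R → ‖Hs ψ x‖ ≤ N1 * ψ 0 ∧ ∀ y, ‖y - x‖ ≤ t / 2 → ‖Hs ψ y - Hs ψ x‖ ≤ N1 * ψ 0 * √‖y - x‖ := fun x hx => by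
    have sb : ∀ z ∈ ball x t, ‖z‖ < R + 1 := fun z hz => by
      rw [mem_ball_iff_norm] at hz
      have := norm_add_le (z - x) x
      rw [sub_add_cancel] at this; linarith
    have P := HS a b r x t (1 + N0) (H * ψ 0) δ ψ t0 t1 Kt (hD.mono fun z hz => by
        rw [mem_ball_zero_iff]; linarith [sb z hz]) gb ps (fun z hz => hk 0 z n0 (by linarith [sb z hz]))
      (fun z hz => by
        have h1 := g2 z (by rw [mem_ball_zero_iff]; linarith [sb z hz])
        have h2 := mul_le_mul_of_nonneg_left (hk 0 z n0 (by linarith [sb z hz])) N00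
        have h3 : 0 ≤ H * ψ 0 * (1 + N0) := by positivity
        have h4 := le_div_self h3 t0 t1
        have h5 : 0 < H * ψ 0 := by positivity
        linarith) (by linarith) d0 d1 (fun z hz => hc z (by rw [mem_ball_zero_iff]; linarith [sb z hz]))
      (fun z hz => (hq z (by rw [mem_ball_zero_iff]; linarith [sb z hz])).1) x s s0 (by rw [st]; simp)
    have e : C1 * ((1 + N0) * (H * ψ 0)) = s ^ 5 * (N1 * ψ 0) := by rw [hN1]; field_simp
    rw [e, st] at P
    have s5 : 0 < s ^ 5 := by positivity
    refine ⟨?_, fun y hy => ?_⟩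
    · have h1 : s ^ 5 * ‖Hs ψ x‖ ≤ s ^ 4 * ‖Hs ψ x‖ := 
        mul_le_mul_of_nonneg_right (pow_le_pow_of_le_one s0.le s1 (by norm_num)) (norm_nonneg _)
      exact le_of_mul_le_mul_left (h1.trans P.1) s5
    · have := P.2 y hy
      rw [mul_assoc] at this
      exact le_of_mul_le_mul_left this s5
  have i0 : 0 < (ψ 0)⁻¹ := by positivity
  have ii : (ψ 0)⁻¹ * ψ 0 = 1 := inv_mul_cancel₀ q0.ne'
  have sc : ∀ X T, X ≤ T * ψ 0 → (ψ 0)⁻¹ * X ≤ T := fun X T h => by rw [inv_mul_le_iff₀ q0]; linarith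
  refine ⟨fun x y hx hy => ⟨?_, ?_, ?_, ?_⟩, fun x hx => ?_, ?_⟩
  · rw [abs_of_pos (mul_pos i0 (ps x))]
    linarith [sc _ _ (hk 0 x n0 (by linarith))]
  · rw [D_smul ψ2, norm_smul, Real.norm_of_nonneg i0.le]
    have h1 := g2 x (by rw [mem_ball_zero_iff]; linarith)
    have h2 := mul_le_mul_of_nonneg_left (hk 0 x n0 (by linarith)) N00
    linarith [sc ‖fderiv ℝ ψ x‖ (N0 * H) (by linarith)]
  · rw [Hs_smul ψ2, bil_nsm i0.le]
    linarith [sc _ _ (pn x hx).1]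
  · rw [Hs_smul ψ2, Hs_smul ψ2, bil_ss, bil_nsm i0.le]
    have sq := Real.sqrt_nonneg ‖y - x‖
    rcases le_or_gt ‖y - x‖ (t / 2) with h | h
    · have h1 := sc ‖Hs ψ y - Hs ψ x‖ (N1 * √‖y - x‖) (by linarith [(pn x hx).2 y h])
      refine h1.trans (mul_le_mul_of_nonneg_right (by linarith) sq)
    · have h1 := norm_sub_le (Hs ψ y) (Hs ψ x)
      have h2 := sc ‖Hs ψ y - Hs ψ x‖ (2 * N1) (by linarith [(pn x hx).1, (pn y hy).1])
      have h3 : t / 2 ≤ √‖y - x‖ := by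
        refine Real.le_sqrt_of_sq_le ?_
        nlinarith
      have h4 := mul_le_mul_of_nonneg_left h3 z2
      have h5 : 4 / t * N1 * (t / 2) = 2 * N1 := by field_simp; ring
      have h6 : 4 / t * N1 * √‖y - x‖ ≤ (H + N0 * H + N1 + 4 / t * N1 + Cc) * √‖y - x‖ := mul_le_mul_of_nonneg_right (by linarith) sq
      linarith
  · have h1 := mul_le_mul_of_nonneg_left (hk x 0 (by linarith) n0) i0.le
    have h2 : H * ((ψ 0)⁻¹ * ψ x) ≤ (H + N0 * H + N1 + 4 / t * N1 + Cc) * ((ψ 0)⁻¹ * ψ x) :=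
      mul_le_mul_of_nonneg_right (by linarith) (mul_pos i0 (ps x)).le
    linarith
  · linarith [hc 0 (by rw [mem_ball_zero_iff, norm_zero]; linarith)]

theorem main_abs (hLoc : ∀ R > 0, ∃ L K B M, 1 ≤ L ∧ 1 ≤ K ∧ 0 ≤ B ∧ 0 ≤ M ∧ LocD (closedBall 0 R) L K B M a b r) {lp : ℝ}
    (h : ∀ ε > 0, ∃ l φ, l ≤ lp + ε ∧ ContDiff ℝ 2 φ ∧ (∀ x, 0 < φ x) ∧ ∀ x, Gt a b r φ x ≤ l * φ x) :
    ∃ l ψ, l ≤ lp ∧ ContDiff ℝ 2 ψ ∧ (∀ x, 0 < ψ x) ∧ ψ 0 = 1 ∧ ∀ x, Gt a b r ψ x = l * ψ x := by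
  have en : ∀ n : ℕ, (0 : ℝ) < 1 / ((n : ℝ) + 1) ∧ 1 / ((n : ℝ) + 1) ≤ 1 := fun n =>
    ⟨by positivity, by rw [div_le_one (by positivity)]; linarith [Nat.cast_nonneg (α := ℝ) n]⟩
  have seq : ∀ n : ℕ, ∃ (δ : ℝ) (ψ : Eu d → ℝ), 0 < δ ∧ δ ≤ 1 / ((n : ℝ) + 1) ∧ (∃ N, GB N ψ) ∧ (∃ c > 0, ∀ x, c ≤ ψ x) ∧
      ∀ x ∈ ball (0 : Eu d) ((n : ℝ) + 1), Gt a b r ψ x = δ * (ψ x * Real.log (ψ x)) ∧ δ * Real.log (ψ x) ≤ lp + 2 * (1 / ((n : ℝ) + 1)) := fun n => by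
    obtain ⟨l, φ, hl, h1, h2, h3⟩ := h _ (en n).1
    obtain ⟨δ, ψ, k1, k2, k3, k4, k5⟩ := trunc hLoc h1 h2 h3 (R := (n : ℝ) + 1) (by positivity) (en n).1
    exact ⟨δ, ψ, k1, k2, k3, k4, fun x hx => ⟨(k5 x hx).1, by linarith [(k5 x hx).2]⟩⟩
  choose δ ψ k1 k2 k3 k4 k5 using seq
  have ps : ∀ n x, 0 < ψ n x := fun n x => by
    obtain ⟨c, c0, hc⟩ := k4 n
    exact c0.trans_le (hc x)
  have ψ2 : ∀ n, ContDiff ℝ 2 (ψ n) := fun n => (k3 n).choose_spec.1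
  have atT : ∀ R : ℝ, ∀ᶠ n : ℕ in (Filter.hyperfilter ℕ : Filter ℕ), R ≤ (n : ℝ) + 1 := fun R => by
    refine Nat.hyperfilter_le_atTop ?_
    obtain ⟨m, hm⟩ := exists_nat_ge R
    filter_upwards [Filter.eventually_ge_atTop m] with n hn
    have : (m : ℝ) ≤ n := by exact_mod_cast hn
    linarith
  have e0 : Filter.Tendsto (fun n : ℕ => 1 / ((n : ℝ) + 1)) (Filter.hyperfilter ℕ) (nhds 0) :=
    (tendsto_one_div_add_atTop_nhds_zero_nat (𝕜 := ℝ)).mono_left Nat.hyperfilter_le_atTop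
  have key : ∀ R > 0, ∃ Q, 0 ≤ Q ∧ ∀ᶠ n : ℕ in (Filter.hyperfilter ℕ : Filter ℕ), LB R Q (fun z => (ψ n 0)⁻¹ * ψ n z) ∧
      (∀ x, ‖x‖ < R → 1 ≤ Q * ((ψ n 0)⁻¹ * ψ n x)) ∧ |δ n * Real.log (ψ n 0)| ≤ Q := fun R hR => by
    obtain ⟨Q, Q0, hQ⟩ := loc_LB hLoc hR (lp + 2)
    refine ⟨Q, Q0, ?_⟩
    filter_upwards [atT (R + 4)] with n hn
    refine hQ _ _ (k1 n).le ((k2 n).trans (en n).2) (k3 n) (k4 n) fun x hx => ?_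
    have := k5 n x (ball_subset_ball hn hx)
    exact ⟨this.1, by linarith [this.2, (en n).2]⟩
  obtain ⟨v, v2, hv⟩ := compact_lim (U := Filter.hyperfilter ℕ) (u := fun n z => (ψ n 0)⁻¹ * ψ n z)
    (fun n => contDiff_const.mul (ψ2 n)) (fun R => by
      obtain ⟨Q, -, hQ⟩ := key (max R 1) (by positivity)
      refine ⟨Q, hQ.mono fun n hn x y hx hy => hn.1 x y (lt_max_of_lt_left hx) (lt_max_of_lt_left hy)⟩)
  obtain ⟨l, hl⟩ : ∃ l, Filter.Tendsto (fun n => δ n * Real.log (ψ n 0)) (Filter.hyperfilter ℕ) (nhds l) := by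
    obtain ⟨Q, -, hQ⟩ := key 1 one_pos
    exact ultra_lim (M := Q) (hQ.mono fun n hn => hn.2.2)
  have vp : ∀ x, 0 < v x := fun x => by
    obtain ⟨Q, Q0, hQ⟩ := key (‖x‖ + 1) (by positivity)
    have h1 : 1 ≤ Q * v x := ge_of_tendsto ((hv x).1.const_mul Q) (hQ.mono fun n hn => hn.2.1 x (by linarith))
    by_contra! hc
    have := mul_nonpos_of_nonneg_of_nonpos Q0 hc
    linarith
  have dl : Filter.Tendsto δ (Filter.hyperfilter ℕ) (nhds 0) := squeeze_zero (fun n => (k1 n).le) k2 e0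
  refine ⟨l, v, ?_, v2, vp, ?_, fun x => ?_⟩
  · have h1 : Filter.Tendsto (fun n : ℕ => lp + 2 * (1 / ((n : ℝ) + 1))) (Filter.hyperfilter ℕ) (nhds (lp + 2 * 0)) :=
      (e0.const_mul 2).const_add lp
    have := le_of_tendsto_of_tendsto hl h1 (Filter.Eventually.of_forall fun n => (k5 n 0 (by simp; positivity)).2)
    linarith
  · refine tendsto_nhds_unique (hv 0).1 (tendsto_const_nhds.congr fun n => ?_)
    exact (inv_mul_cancel₀ (ps n 0).ne').symm
  · obtain ⟨L, K, B, M, hL, hK, hB, hM, hD⟩ := hLoc (‖x‖ + 1) (by positivity)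
    have xm : x ∈ closedBall (0 : Eu d) (‖x‖ + 1) := by simp
    have t1 := trM_tend (a x) (hv x).2.2
    have t0 : Filter.Tendsto (fun n : ℕ => ‖fderiv ℝ (fun z => (ψ n 0)⁻¹ * ψ n z) x - fderiv ℝ v x‖ * B +
        M * |(ψ n 0)⁻¹ * ψ n x - v x|) (Filter.hyperfilter ℕ) (nhds 0) := by
      have c2 := (tendsto_iff_norm_sub_tendsto_zero.1 (hv x).2.1).mul_const B
      have c3 := (tendsto_iff_norm_sub_tendsto_zero.1 (hv x).1).const_mul M
      simpa using c2.add c3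
    have t3 : Filter.Tendsto (fun n => ⨅ u, (fderiv ℝ (fun z => (ψ n 0)⁻¹ * ψ n z) x (b x u) + r x u * ((ψ n 0)⁻¹ * ψ n x)))
        (Filter.hyperfilter ℕ) (nhds (⨅ u, (fderiv ℝ v x (b x u) + r x u * v x))) := by
      rw [tendsto_iff_norm_sub_tendsto_zero]
      refine squeeze_zero (fun n => norm_nonneg _) (fun n => ?_) t0
      refine inf_lip (lin_ge2 (hD.bb x xm) (hD.rb x xm) _) (lin_ge2 (hD.bb x xm) (hD.rb x xm) _) fun u => ?_
      have := lin_abs (q := (ψ n 0)⁻¹ * ψ n x - v x) (hD.bb x xm u) (hD.rb x xm u) (fderiv ℝ (fun z => (ψ n 0)⁻¹ * ψ n z) x - fderiv ℝ v x)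
      rw [sub_apply, mul_sub] at this
      refine (le_of_eq ?_).trans this
      congr 1; ring
    have t2 : Filter.Tendsto (fun n => (ψ n 0)⁻¹ * ψ n x * (δ n * Real.log ((ψ n 0)⁻¹ * ψ n x) + δ n * Real.log (ψ n 0)))
        (Filter.hyperfilter ℕ) (nhds (v x * (0 * Real.log (v x) + l))) :=
      (hv x).1.mul ((dl.mul ((hv x).1.log (vp x).ne')).add hl)
    have t4 := tendsto_nhds_unique_of_eventuallyEq (t1.add t3) t2 (by
      filter_upwards [atT (‖x‖ + 1)] with n hn
      have h1 := Gt_smul (a := a) (b := b) (r := r) (ψ2 n) (inv_pos.2 (ps n 0)).le x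
      rw [(k5 n x (by rw [mem_ball_zero_iff]; linarith)).1] at h1
      refine Eq.trans h1 ?_
      rw [Real.log_mul (inv_pos.2 (ps n 0)).ne' (ps n x).ne', Real.log_inv]
      ring)
    rw [Gt, t4]; ring
end fin
end

lemma sdv_eq {d : ℕ} {φ : Eu d → ℝ} (hφ : ContDiff ℝ 2 φ) (x : Eu d) (i j : Fin d) : sdv φ x i j = Hs φ x (eb i) (eb j) := by
  have h := ((ContinuousLinearMap.apply ℝ ℝ (eb j : Eu d)).hasFDerivAt.comp x (c2_d2 hφ x)).fderiv
  have h2 := congrArg (fun T : Eu d →L[ℝ] ℝ => T (eb i)) h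
  exact h2

lemma Gop_eq {d : ℕ} {U : Type*} {a : Eu d → Matrix (Fin d) (Fin d) ℝ} {b : Eu d → U → Eu d} {r : Eu d → U → ℝ}
    {φ : Eu d → ℝ} (hφ : ContDiff ℝ 2 φ) (x : Eu d) : Gop a b r φ x = Gt a b r φ x := by
  simp only [Gop, Gt, trM, sdv_eq hφ]
  congr 2
  funext u
  rw [real_inner_comm, gradient, InnerProductSpace.toDual_symm_apply]

lemma hLoc_of {d : ℕ} {U : Type*} [MetricSpace U] [CompactSpace U]
    {a : Eu d → Matrix (Fin d) (Fin d) ℝ} {b : Eu d → U → Eu d} {r : Eu d → U → ℝ}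
    (ha_lip : ∀ R : ℝ, 0 < R → ∃ K : NNReal, ∀ i j, LipschitzOnWith K (fun x => a x i j) (closedBall 0 R))
    (ha_symm : ∀ x, (a x).IsSymm)
    (ha_ell : ∀ R : ℝ, 0 < R → ∃ C : ℝ, 1 ≤ C ∧ ∀ x ∈ closedBall (0 : Eu d) R, ∀ z : Eu d,
      C⁻¹ * ‖z‖ ^ 2 ≤ quadForm (a x) z ∧ quadForm (a x) z ≤ C * ‖z‖ ^ 2)
    (hb_cont : Continuous fun p : Eu d × U => b p.1 p.2) (hr_cont : Continuous fun p : Eu d × U => r p.1 p.2)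
    (hb_lip : ∀ R : ℝ, 0 < R → ∃ K : NNReal, ∀ u : U, LipschitzOnWith K (fun x => b x u) (closedBall 0 R))
    (hr_lip : ∀ R : ℝ, 0 < R → ∃ K : NNReal, ∀ u : U, LipschitzOnWith K (fun x => r x u) (closedBall 0 R)) :
    ∀ R > 0, ∃ L K B M, 1 ≤ L ∧ 1 ≤ K ∧ 0 ≤ B ∧ 0 ≤ M ∧ LocD (closedBall 0 R) L K B M a b r := fun R hR => by
  obtain ⟨L, hL, h1⟩ := ha_ell R hR
  obtain ⟨K1, k1⟩ := ha_lip R hR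
  obtain ⟨K2, k2⟩ := hb_lip R hR
  obtain ⟨K3, k3⟩ := hr_lip R hR
  have cp := (isCompact_closedBall (0 : Eu d) R).prod (isCompact_univ (X := U))
  obtain ⟨B, hB⟩ := cp.exists_bound_of_continuousOn hb_cont.continuousOn
  obtain ⟨M, hM⟩ := cp.exists_bound_of_continuousOn hr_cont.continuousOn
  have n1 := K1.2
  have n2 := K2.2
  have n3 := K3.2
  have up : ∀ (x y : Eu d) (k : ℝ), k ≤ 1 + K1 + K2 + K3 → k * ‖x - y‖ ≤ (1 + K1 + K2 + K3) * ‖x - y‖ := fun x y k hk =>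
    mul_le_mul_of_nonneg_right hk (norm_nonneg _)
  refine ⟨L, 1 + K1 + K2 + K3, max B 0, max M 0, hL, ?_, le_max_right _ _, le_max_right _ _, ?_⟩
  · have : (0:ℝ) ≤ K1 := n1
    have : (0:ℝ) ≤ K2 := n2
    have : (0:ℝ) ≤ K3 := n3
    linarith
  have m1 : (0:ℝ) ≤ K1 := n1
  have m2 : (0:ℝ) ≤ K2 := n2
  have m3 : (0:ℝ) ≤ K3 := n3
  refine ⟨fun x hx => ⟨ha_symm x, h1 x hx⟩, fun x hx y hy i j => ?_, fun x hx u => (hB (x, u) ⟨hx, mem_univ _⟩).trans (le_max_left _ _),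
    fun x hx u => (hM (x, u) ⟨hx, mem_univ _⟩).trans (le_max_left _ _), fun x hx y hy u => ?_, fun x hx y hy u => ?_⟩
  · have := (k1 i j).dist_le_mul x hx y hy
    rw [Real.dist_eq, dist_eq_norm] at this
    exact this.trans (up x y _ (by linarith))
  · have := (k2 u).dist_le_mul x hx y hy
    rw [dist_eq_norm, dist_eq_norm] at this
    exact this.trans (up x y _ (by linarith))
  · have := (k3 u).dist_le_mul x hx y hy
    rw [Real.dist_eq, dist_eq_norm] at this
    exact this.trans (up x y _ (by linarith))

/-- **Theorem 4.1 (existence part, bounded-cost case), classical-solution rendering.**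
If the running cost `r` is bounded above by `R₀`, then the generalized principal eigenvalue
`λ⁺ = inf { λ | ∃ φ ∈ C²(ℝ^d), φ > 0, Gφ ≤ λφ on ℝ^d }` is a finite real number,
`λ⁺ ≤ R₀`, and it admits a positive eigenfunction `ψ` normalized by `ψ(0) = 1`. -/
theorem principal_eigenpair_exists_wholespace
    {d : ℕ} (hd : 1 ≤ d) {U : Type*} [MetricSpace U] [CompactSpace U] [Nonempty U]
    (a : EuclideanSpace ℝ (Fin d) → Matrix (Fin d) (Fin d) ℝ)
    (b : EuclideanSpace ℝ (Fin d) → U → EuclideanSpace ℝ (Fin d))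
    (r : EuclideanSpace ℝ (Fin d) → U → ℝ)
    -- `a` is locally Lipschitz
    (ha_lip : ∀ R : ℝ, 0 < R → ∃ K : NNReal, ∀ i j,
      LipschitzOnWith K (fun x => a x i j) (closedBall 0 R))
    -- each `a(x)` is symmetric
    (ha_symm : ∀ x, (a x).IsSymm)
    -- local uniform ellipticity
    (ha_ell : ∀ R : ℝ, 0 < R → ∃ C : ℝ, 1 ≤ C ∧ ∀ x ∈ closedBall (0 : EuclideanSpace ℝ (Fin d)) R,
      ∀ z : EuclideanSpace ℝ (Fin d),
      C⁻¹ * ‖z‖ ^ 2 ≤ quadForm (a x) z ∧ quadForm (a x) z ≤ C * ‖z‖ ^ 2)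
    -- joint continuity of `b` and `r`
    (hb_cont : Continuous fun p : EuclideanSpace ℝ (Fin d) × U => b p.1 p.2)
    (hr_cont : Continuous fun p : EuclideanSpace ℝ (Fin d) × U => r p.1 p.2)
    -- local Lipschitz continuity in `x`, uniformly in `u`
    (hb_lip : ∀ R : ℝ, 0 < R → ∃ K : NNReal, ∀ u : U,
      LipschitzOnWith K (fun x => b x u) (closedBall 0 R))
    (hr_lip : ∀ R : ℝ, 0 < R → ∃ K : NNReal, ∀ u : U,
      LipschitzOnWith K (fun x => r x u) (closedBall 0 R))
    -- the running cost is bounded above by `R₀`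
    (R₀ : ℝ) (hr_bd : ∀ x u, r x u ≤ R₀) :
    (({ lam : ℝ | ∃ φ : EuclideanSpace ℝ (Fin d) → ℝ, ContDiff ℝ 2 φ ∧ (∀ x, 0 < φ x) ∧
        ∀ x, Gop a b r φ x ≤ lam * φ x }).Nonempty) ∧
    BddBelow { lam : ℝ | ∃ φ : EuclideanSpace ℝ (Fin d) → ℝ, ContDiff ℝ 2 φ ∧ (∀ x, 0 < φ x) ∧
        ∀ x, Gop a b r φ x ≤ lam * φ x } ∧
    sInf { lam : ℝ | ∃ φ : EuclideanSpace ℝ (Fin d) → ℝ, ContDiff ℝ 2 φ ∧ (∀ x, 0 < φ x) ∧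
        ∀ x, Gop a b r φ x ≤ lam * φ x } ≤ R₀ ∧
    ∃ ψ : EuclideanSpace ℝ (Fin d) → ℝ, ContDiff ℝ 2 ψ ∧ (∀ x, 0 < ψ x) ∧ ψ 0 = 1 ∧
      ∀ x, Gop a b r ψ x =
        sInf { lam : ℝ | ∃ φ : EuclideanSpace ℝ (Fin d) → ℝ, ContDiff ℝ 2 φ ∧ (∀ x, 0 < φ x) ∧
          ∀ x, Gop a b r φ x ≤ lam * φ x } * ψ x := by
  have hLoc := hLoc_of ha_lip ha_symm ha_ell hb_cont hr_cont hb_lip hr_lip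
  obtain ⟨S, hS⟩ : ∃ S, S = { lam : ℝ | ∃ φ : EuclideanSpace ℝ (Fin d) → ℝ, ContDiff ℝ 2 φ ∧ (∀ x, 0 < φ x) ∧
        ∀ x, Gop a b r φ x ≤ lam * φ x } := ⟨_, rfl⟩
  rw [← hS]
  have mS : ∀ l, l ∈ S ↔ ∃ φ : Eu d → ℝ, ContDiff ℝ 2 φ ∧ (∀ x, 0 < φ x) ∧ ∀ x, Gt a b r φ x ≤ l * φ x := fun l => by
    rw [hS]
    constructor
    · rintro ⟨φ, h1, h2, h3⟩
      exact ⟨φ, h1, h2, fun x => by rw [← Gop_eq h1]; exact h3 x⟩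
    · rintro ⟨φ, h1, h2, h3⟩
      exact ⟨φ, h1, h2, fun x => by rw [Gop_eq h1]; exact h3 x⟩
  have m0 : R₀ ∈ S := by
    rw [mS]
    refine ⟨fun _ => 1, contDiff_const, fun _ => one_pos, fun x => ?_⟩
    have e1 : fderiv ℝ (fun _ : Eu d => (1 : ℝ)) = fun _ => 0 := by funext y; simp
    have e2 : Hs (fun _ : Eu d => (1 : ℝ)) x = 0 := by rw [Hs, e1]; simp
    simp only [Gt, e1, e2, trM, zero_apply, mul_zero, Finset.sum_const_zero, zero_add, mul_one]
    obtain ⟨L, K, B, M, -, -, -, -, hD⟩ := hLoc (‖x‖ + 1) (by positivity)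
    exact (ciInf_le (bdB fun u => (abs_le.1 (hD.rb x (by simp) u)).1) (Classical.arbitrary U)).trans (hr_bd x _)
  have bb : BddBelow S := by
    obtain ⟨L, K, B, M, hL, hK, hB, hM, hD⟩ := hLoc 1 one_pos
    refine ⟨-(M + (8 / L + 4 * (d * L) + 4 * B) ^ 2 / (4 * (8 / L))), fun l hl => ?_⟩
    obtain ⟨φ, h1, h2, h3⟩ := (mS l).1 hl
    obtain ⟨x, -, -, hx⟩ := lower (c := fun _ => l) hL hB (hD.mono ball_subset_closedBall) h1 h2 (fun x _ => h3 x)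
    exact hx
  refine ⟨⟨R₀, m0⟩, bb, csInf_le bb m0, ?_⟩
  obtain ⟨l, ψ, hl, h1, h2, h3, h4⟩ := main_abs hLoc (lp := sInf S) (fun ε hε => by
    obtain ⟨l, hl, hlt⟩ := exists_lt_of_csInf_lt ⟨R₀, m0⟩ (lt_add_of_pos_right (sInf S) hε)
    obtain ⟨φ, h1, h2, h3⟩ := (mS l).1 hl
    exact ⟨l, φ, hlt.le, h1, h2, h3⟩)
  have hl2 : sInf S ≤ l := csInf_le bb ((mS l).2 ⟨ψ, h1, h2, fun x => (h4 x).le⟩)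
  have el := le_antisymm hl hl2
  refine ⟨ψ, h1, h2, h3, fun x => ?_⟩
  rw [Gop_eq h1, h4 x, el]
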